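/- arXiv:math/0411282 — 4 statements merged into one kernel-verified Lean document; each statement's English description precedes it below -/
import Mathlib

section
/- For every x > 0 one has 2·∫_0^{x·φ(x)} e^{−s}·e^{x(1−e^{−s/x})} ds = 2/3 + ∫_1^∞ ξ'(t)·e^{−x(t−1)} dt, where ξ' denotes the derivative of ξ on (1,∞). -/
open MeasureTheory Filter Set

/-- Logarithm bound behind the monotonicity of `ξ`. -/
lemma aux_log_bound (k : ℝ) (hk : 1 ≤ k) :
    3 * Real.log k ≤ (k + 1) * (k ^ 3 - 1) / (k * (k ^ 2 + 1)) := by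
  have hd : ∀ y : ℝ, 0 < y → HasDerivAt
      (fun k : ℝ => (k + 1) * (k ^ 3 - 1) / (k * (k ^ 2 + 1)) - 3 * Real.log k)
      ((y - 1) ^ 4 * (y ^ 2 + y + 1) / (y * (y ^ 2 + 1)) ^ 2) y := by
    intro y hy
    have h1 : HasDerivAt (fun k : ℝ => (k + 1) * (k ^ 3 - 1))
        (1 * (y ^ 3 - 1) + (y + 1) * (3 * y ^ 2)) y := by
      have := ((hasDerivAt_id y).add_const 1).mul (((hasDerivAt_pow 3 y)).sub_const 1)
      exact this.congr_deriv (by simp)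
    have h2 : HasDerivAt (fun k : ℝ => k * (k ^ 2 + 1))
        (1 * (y ^ 2 + 1) + y * (2 * y)) y := by
      have := (hasDerivAt_id y).mul (((hasDerivAt_pow 2 y)).add_const 1)
      exact this.congr_deriv (by simp)
    have h3 := (h1.div h2 (by positivity)).sub ((Real.hasDerivAt_log hy.ne').const_mul 3)
    refine h3.congr_deriv ?_
    field_simp
    ring
  have hmono : MonotoneOn
      (fun k : ℝ => (k + 1) * (k ^ 3 - 1) / (k * (k ^ 2 + 1)) - 3 * Real.log k) (Ici 1) := by
    apply monotoneOn_of_deriv_nonneg (convex_Ici 1)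
    · intro y hy
      exact (hd y (lt_of_lt_of_le one_pos hy)).continuousAt.continuousWithinAt
    · intro y hy
      rw [interior_Ici] at hy
      exact (hd y (lt_trans one_pos hy)).differentiableAt.differentiableWithinAt
    · intro y hy
      rw [interior_Ici] at hy
      have hy0 : (0:ℝ) < y := lt_trans one_pos hy
      rw [(hd y hy0).deriv]
      positivity
  have := hmono (mem_Ici.2 le_rfl) (mem_Ici.2 hk) hk
  simp at this
  linarith

/-- The sign of `ξ'`. -/
lemma aux_sign (p q : ℝ) (hp : 0 < p) (hq : 0 < q)
    (h : Real.exp (-p) + p = Real.exp q - q) :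
    Real.exp (-p) / (1 - Real.exp (-p)) ^ 3 ≤ Real.exp q / (Real.exp q - 1) ^ 3 := by
  set k := Real.exp ((p + q) / 3) with hk
  have hk1 : 1 < k := by rw [hk]; exact Real.one_lt_exp_iff.2 (by positivity)
  have hk3 : k ^ 3 = Real.exp (p + q) := by
    rw [hk, ← Real.exp_nat_mul]; congr 1; push_cast; ring
  have hlog : 3 * Real.log k = p + q := by rw [hk, Real.log_exp]; ring
  have hb := aux_log_bound k hk1.le
  rw [hlog] at hb
  have hE : Real.exp q = k ^ 3 * Real.exp (-p) := by
    rw [hk3, ← Real.exp_add]; congr 1; ring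
  have hc1 : Real.exp (-p) < 1 := Real.exp_lt_one_iff.2 (by linarith)
  have hc0 : 0 < Real.exp (-p) := Real.exp_pos _
  have ha1 : 1 < Real.exp q := Real.one_lt_exp_iff.2 hq
  set c := Real.exp (-p) with hc
  set d := Real.exp q with hdd
  have h2 : (k ^ 3 - 1) * c = p + q := by linarith
  have h4 : c * (k * (k ^ 2 + 1)) ≤ k + 1 := by
    rw [← h2, le_div_iff₀ (by positivity)] at hb
    have h3 : 0 < k ^ 3 - 1 := by
      have : 1 < k ^ 3 := one_lt_pow₀ hk1 (by norm_num)
      linarith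
    by_contra hcon
    push Not at hcon
    nlinarith [mul_lt_mul_of_pos_left hcon h3]
  have h5 : d - 1 ≤ k * (1 - c) := by
    rw [hE]
    nlinarith
  have h6 : (d - 1) ^ 3 ≤ (k * (1 - c)) ^ 3 :=
    pow_le_pow_left₀ (by linarith) h5 3
  rw [div_le_div_iff₀ (pow_pos (by linarith) 3) (pow_pos (by linarith) 3)]
  calc c * (d - 1) ^ 3 ≤ c * (k * (1 - c)) ^ 3 := by gcongr
    _ = d * (1 - c) ^ 3 := by rw [hE]; ring

/-- The limit of `ξ` in terms of `L = v - u`. -/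
lemma aux_limit : Tendsto (fun L : ℝ => (Real.exp L - 1) *
      (1 / (Real.exp L - 1 - L) - 1 / (L * Real.exp L - Real.exp L + 1)))
      (nhdsWithin 0 (Ioi 0)) (nhds (2 / 3)) := by
  have h0 := (Real.exp_sub_sum_range_succ_isLittleO_pow 3).tendsto_div_nhds_zero
  have h0' := h0.mono_left (nhdsWithin_le_nhds (s := Ioi (0:ℝ)))
  have hid : Tendsto (fun L : ℝ => L) (nhdsWithin 0 (Ioi 0)) (nhds 0) :=
    tendsto_id.mono_left nhdsWithin_le_nhds
  set e : ℝ → ℝ := fun x => (Real.exp x - ∑ i ∈ Finset.range (3 + 1), x ^ i / (i.factorial : ℝ)) / x ^ 3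
    with he
  have r3 : Tendsto (fun L => 1 / 6 + e L) (nhdsWithin 0 (Ioi 0)) (nhds (1 / 6)) := by
    have := h0'.const_add (1 / 6)
    rwa [add_zero] at this
  have r2 : Tendsto (fun L => 1 / 2 + L * (1 / 6 + e L)) (nhdsWithin 0 (Ioi 0)) (nhds (1 / 2)) := by
    have := (hid.mul r3).const_add (1 / 2)
    rwa [zero_mul, add_zero] at this
  have r1 : Tendsto (fun L => 1 + L * (1 / 2 + L * (1 / 6 + e L)))
      (nhdsWithin 0 (Ioi 0)) (nhds 1) := by
    have := (hid.mul r2).const_add 1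
    rwa [zero_mul, add_zero] at this
  have hfin := (r1.mul (r2.sub (r3.const_mul 2))).div (r2.mul (r1.sub r2)) (by norm_num)
  have hval : (1:ℝ) * (1 / 2 - 2 * (1 / 6)) / (1 / 2 * (1 - 1 / 2)) = 2 / 3 := by norm_num
  rw [hval] at hfin
  refine hfin.congr' ?_
  filter_upwards [self_mem_nhdsWithin] with L hL
  have hL0 : (0:ℝ) < L := hL
  have hexp : Real.exp L = 1 + L + L ^ 2 / 2 + L ^ 3 / 6 + e L * L ^ 3 := by
    simp only [he, Finset.sum_range_succ, Finset.sum_range_zero]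
    norm_num [Nat.factorial]
    field_simp
    ring
  have hA : 0 < Real.exp L - 1 - L := by
    have := Real.add_one_lt_exp hL0.ne'
    linarith
  have hB : 0 < L * Real.exp L - Real.exp L + 1 := by
    have := Real.add_one_lt_exp (neg_ne_zero.2 hL0.ne')
    have h2 : Real.exp (-L) * Real.exp L = 1 := by rw [← Real.exp_add]; simp
    nlinarith [Real.exp_pos L]
  have eA : Real.exp L - 1 - L = L ^ 2 * (1 / 2 + L * (1 / 6 + e L)) := by rw [hexp]; ring
  have eB : L * Real.exp L - Real.exp L + 1 = L ^ 2 * 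
     ((1 + L * (1 / 2 + L * (1 / 6 + e L))) - (1 / 2 + L * (1 / 6 + e L))) := by rw [hexp]; ring
  have eC : Real.exp L - 1 = L * (1 + L * (1 / 2 + L * (1 / 6 + e L))) := by rw [hexp]; ring
  rw [eA] at hA
  rw [eB] at hB
  have hA' := pos_of_mul_pos_right hA (by positivity)
  have hB' := pos_of_mul_pos_right hB (by positivity)
  simp only [Pi.div_apply]
  rw [eA, eB, eC]
  generalize e L = z at *
  generalize hP : 1 / 2 + L * (1 / 6 + z) = P at *
  generalize hQ : 1 + L * P - P = Q at *
  field_simp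
  rw [← hQ, ← hP]
  ring

/-- Properties of inverse branches. -/
lemma aux_inv (F w : ℝ → ℝ) (hF : StrictMonoOn F (Ici 0)) (hF0 : F 0 = 1)
    (hw : ∀ t ≥ (1:ℝ), 0 ≤ w t ∧ F (w t) = t) :
    (∀ t > (1:ℝ), 0 < w t ∧ ContinuousAt w t) ∧
    Tendsto w (nhdsWithin 1 (Ioi 1)) (nhds 0) ∧ Tendsto w atTop atTop := by
  have hge : ∀ y, 0 ≤ y → 1 ≤ F y := fun y hy => by
    rw [← hF0]; exact hF.monotoneOn (mem_Ici.2 le_rfl) hy hy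
  have hwF : ∀ y, 0 ≤ y → w (F y) = y := fun y hy =>
    hF.injOn (hw _ (hge y hy)).1 hy (hw _ (hge y hy)).2
  have hmono : StrictMonoOn w (Ici 1) := by
    intro a ha b hb hab
    rw [← hF.lt_iff_lt (hw a ha).1 (hw b hb).1, (hw a ha).2, (hw b hb).2]
    exact hab
  have hw1 : w 1 = 0 := by rw [← hF0]; exact hwF 0 le_rfl
  have hpos : ∀ t > (1:ℝ), 0 < w t := fun t ht => by
    rw [← hw1]; exact hmono (mem_Ici.2 le_rfl) (mem_Ici.2 ht.le) ht
  refine ⟨fun t ht => ⟨hpos t ht, ?_⟩, ?_, ?_⟩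
  · apply continuousAt_of_monotoneOn_of_image_mem_nhds hmono.monotoneOn (Ici_mem_nhds ht)
    apply mem_of_superset (Ioi_mem_nhds (hpos t ht))
    intro y hy
    exact ⟨F y, hge y (le_of_lt hy), hwF y (le_of_lt hy)⟩
  · have : ContinuousWithinAt w (Ici 1) 1 := by
      apply hmono.continuousWithinAt_right_of_exists_between self_mem_nhdsWithin
      intro b hb
      rw [hw1] at *
      exact ⟨F b, hge b hb.le, by rw [hwF b hb.le]; exact ⟨hb, le_rfl⟩⟩
    have h2 := this.mono Ioi_subset_Ici_self
    unfold ContinuousWithinAt at h2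
    rwa [hw1] at h2
  · rw [tendsto_atTop]
    intro b
    have hm : 0 ≤ max b 0 := le_max_right _ _
    filter_upwards [eventually_ge_atTop (F (max b 0))] with t ht
    calc b ≤ max b 0 := le_max_left _ _
      _ = w (F (max b 0)) := (hwF _ hm).symm
      _ ≤ w t := hmono.monotoneOn (hge _ hm) (le_trans (hge _ hm) ht) ht

lemma aux_Fv : StrictMonoOn (fun s : ℝ => Real.exp (-s) + s) (Ici 0) := by
  apply strictMonoOn_of_deriv_pos (convex_Ici 0) (by fun_prop)
  intro y hy
  rw [interior_Ici] at hy
  have : HasDerivAt (fun s : ℝ => Real.exp (-s) + s) (Real.exp (-y) * (-1) + 1) y :=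
    ((hasDerivAt_neg y).exp).add (hasDerivAt_id y)
  rw [this.deriv]
  have : Real.exp (-y) < 1 := Real.exp_lt_one_iff.2 (by simpa using hy)
  linarith

lemma aux_Fu : StrictMonoOn (fun s : ℝ => Real.exp s - s) (Ici 0) := by
  apply strictMonoOn_of_deriv_pos (convex_Ici 0) (by fun_prop)
  intro y hy
  rw [interior_Ici] at hy
  have : HasDerivAt (fun s : ℝ => Real.exp s - s) (Real.exp y - 1) y :=
    (Real.hasDerivAt_exp y).sub (hasDerivAt_id y)
  rw [this.deriv]
  have : 1 < Real.exp y := Real.one_lt_exp_iff.2 hy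
  linarith

lemma aux_deriv (w : ℝ → ℝ) (t : ℝ) (ht : 1 < t) (hc : ContinuousAt w t) (h0 : w t ≠ 0)
    (hw : ∀ t ≥ (1:ℝ), Real.exp (-(w t)) + w t = t) :
    HasDerivAt w (1 / (1 - Real.exp (-(w t)))) t := by
  have hd : HasDerivAt (fun s : ℝ => Real.exp (-s) + s) (1 - Real.exp (-(w t))) (w t) := by
    have : HasDerivAt (fun s : ℝ => Real.exp (-s) + s) (Real.exp (-(w t)) * (-1) + 1) (w t) :=
      ((hasDerivAt_neg (w t)).exp).add (hasDerivAt_id (w t))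
    convert this using 1; ring
  have hne : 1 - Real.exp (-(w t)) ≠ 0 := by
    intro h
    have : Real.exp (-(w t)) = 1 := by linarith
    rw [Real.exp_eq_one_iff] at this
    exact h0 (by linarith)
  rw [one_div]
  refine HasDerivAt.of_local_left_inverse hc hd hne ?_
  filter_upwards [Ioi_mem_nhds ht] with y hy
  exact hw y (le_of_lt hy)

lemma aux_deriv2 (w : ℝ → ℝ) (t : ℝ) (h0 : w t ≠ 0)
    (hw : HasDerivAt w (1 / (1 - Real.exp (-(w t)))) t) :
    HasDerivAt (fun t => 1 / (1 - Real.exp (-(w t))))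
      (-(Real.exp (-(w t)) / (1 - Real.exp (-(w t))) ^ 3)) t := by
  have hne : 1 - Real.exp (-(w t)) ≠ 0 := by
    intro h
    have : Real.exp (-(w t)) = 1 := by linarith
    rw [Real.exp_eq_one_iff] at this
    exact h0 (by linarith)
  have := ((hw.neg.exp).const_sub 1).inv hne
  simp only [one_div]
  refine this.congr_deriv ?_
  simp only [Pi.neg_apply]
  field_simp

/-- Change of variables `t = x e^{-r}` in the Gamma integrals. -/
lemma aux_gamma (x : ℝ) (hx : 0 < x) (mx : ℝ) (hmx : 0 < mx)
    (h : (∫ t in Set.Ioc (0:ℝ) mx, Real.exp (-t) * t ^ (x - 1)) =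
        (1/2) * ∫ t in Set.Ioi (0:ℝ), Real.exp (-t) * t ^ (x - 1)) :
    Integrable (fun r : ℝ => Real.exp (-x * (Real.exp (-r) + r))) ∧
    2 * (∫ r in (0:ℝ)..(Real.log (x / mx)), Real.exp (-x * (Real.exp (-r) + r))) =
      (∫ r in Ioi (0:ℝ), Real.exp (-x * (Real.exp (-r) + r))) -
      ∫ r in Iic (0:ℝ), Real.exp (-x * (Real.exp (-r) + r)) := by
  set g : ℝ → ℝ := fun r : ℝ => Real.exp (-x * (Real.exp (-r) + r)) with hg
  set G : ℝ → ℝ := fun t => Real.exp (-t) * t ^ (x - 1) with hG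
  set T : ℝ → ℝ := fun r => x * Real.exp (-r) with hT
  have hTd : ∀ s : Set ℝ, ∀ r ∈ s, HasDerivWithinAt T (-(x * Real.exp (-r))) s r := by
    intro s r _
    have : HasDerivAt T (x * (Real.exp (-r) * (-1))) r :=
      ((hasDerivAt_neg r).exp).const_mul x
    exact (this.congr_deriv (by ring)).hasDerivWithinAt
  have hTi : Function.Injective T := by
    intro a b hab
    have := mul_left_cancel₀ hx.ne' hab
    have := Real.exp_injective this
    linarith
  have hfun : ∀ r, |-(x * Real.exp (-r))| • G (T r) = x ^ x * g r := by
    intro r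
    have hp : 0 < x * Real.exp (-r) := by positivity
    rw [abs_neg, abs_of_pos hp, smul_eq_mul]
    simp only [hG, hT, hg]
    have h1 : x * Real.exp (-r) * (Real.exp (-(x * Real.exp (-r))) * (x * Real.exp (-r)) ^ (x - 1))
      = Real.exp (-(x * Real.exp (-r))) * (x * Real.exp (-r)) ^ x := by
      rw [Real.rpow_sub_one hp.ne']
      field_simp
    rw [h1, Real.mul_rpow hx.le (Real.exp_pos _).le, ← Real.exp_mul, mul_left_comm, ← Real.exp_add]
    congr 2
    ring
  have hlogT : ∀ t, 0 < t → T (Real.log (x / t)) = t := by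
    intro t ht
    simp only [hT]
    rw [Real.exp_neg, Real.exp_log (by positivity)]
    field_simp
  have him1 : T '' univ = Ioi 0 := by
    ext t
    constructor
    · rintro ⟨r, _, rfl⟩
      exact mem_Ioi.2 (by positivity)
    · intro ht
      exact ⟨_, mem_univ _, hlogT t ht⟩
  have hanti : ∀ a b, T a ≤ T b ↔ b ≤ a := by
    intro a b
    simp only [hT]
    rw [mul_le_mul_iff_right₀ hx, Real.exp_le_exp, neg_le_neg_iff]
  have him2 : T '' (Ici (Real.log (x / mx))) = Ioc 0 mx := by
    ext t
    constructor
    · rintro ⟨r, hr, rfl⟩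
      refine ⟨by positivity, ?_⟩
      conv_rhs => rw [← hlogT mx hmx]
      exact (hanti _ _).2 hr
    · rintro ⟨ht, ht2⟩
      refine ⟨_, ?_, hlogT t ht⟩
      rw [mem_Ici, ← hanti, hlogT t ht, hlogT mx hmx]
      exact ht2
  have hxx : (0:ℝ) < x ^ x := Real.rpow_pos_of_pos hx _
  have hint : Integrable g := by
    have h1 : IntegrableOn G (T '' univ) := by
      rw [him1]; exact Real.GammaIntegral_convergent hx
    rw [integrableOn_image_iff_integrableOn_abs_deriv_smul MeasurableSet.univ (hTd univ)
      hTi.injOn] at h1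
    simp only [hfun, integrableOn_univ] at h1
    exact (integrable_const_mul_iff (IsUnit.mk0 _ hxx.ne') _).1 h1
  refine ⟨hint, ?_⟩
  rw [← him1, ← him2, integral_image_eq_integral_abs_deriv_smul MeasurableSet.univ (hTd univ)
      hTi.injOn, integral_image_eq_integral_abs_deriv_smul measurableSet_Ici (hTd _)
      hTi.injOn] at h
  have hfun2 : ∀ r, |-(x * Real.exp (-r))| • (Real.exp (-T r) * T r ^ (x - 1)) = x ^ x * g r := hfun
  simp only [hfun2] at h
  rw [integral_const_mul, integral_const_mul, integral_Ici_eq_integral_Ioi, setIntegral_univ] at h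
  have h3 := intervalIntegral.integral_Ioi_sub_Ioi' (hint.integrableOn (s := Ioi 0))
    (hint.integrableOn (s := Ioi (Real.log (x / mx))))
  have h4 := intervalIntegral.integral_Iic_add_Ioi (b := (0:ℝ)) hint.integrableOn hint.integrableOn
  have h5 : ∫ r in Ioi (Real.log (x / mx)), g r = 1 / 2 * ∫ r, g r := by
    have : x ^ x * ∫ r in Ioi (Real.log (x / mx)), g r = x ^ x * (1 / 2 * ∫ r, g r) := by
      rw [h]; ring
    exact mul_left_cancel₀ hxx.ne' this
  change 2 * (∫ r in (0:ℝ)..(Real.log (x / mx)), g r) = (∫ r in Ioi (0:ℝ), g r) - ∫ r in Iic (0:ℝ), g r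
  linarith

/-- Rewriting the left-hand side. -/
lemma aux_lhs (x : ℝ) (hx : 0 < x) (c : ℝ) :
    (∫ s in (0:ℝ)..(x * c), Real.exp (-s) * Real.exp (x * (1 - Real.exp (-s/x)))) =
      x * Real.exp x * ∫ r in (0:ℝ)..c, Real.exp (-x * (Real.exp (-r) + r)) := by
  have h := intervalIntegral.integral_comp_mul_left (a := 0) (b := c)
    (fun s => Real.exp (-s) * Real.exp (x * (1 - Real.exp (-s/x)))) hx.ne'
  rw [mul_zero, smul_eq_mul] at h
  have h2 : (∫ s in (0:ℝ)..(x * c), Real.exp (-s) * Real.exp (x * (1 - Real.exp (-s/x)))) =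
    x * ∫ r in (0:ℝ)..c, Real.exp (-(x * r)) * Real.exp (x * (1 - Real.exp (-(x * r)/x))) := by
    rw [h]; field_simp
  rw [h2, mul_assoc]
  congr 1
  rw [← intervalIntegral.integral_const_mul]
  apply intervalIntegral.integral_congr
  intro r _
  simp only
  rw [← Real.exp_add, ← Real.exp_add]
  have : -(x * r) / x = -r := by field_simp
  rw [this]
  congr 1
  ring

/-- At a point, `ξ` in terms of `L = v - u`. -/
lemma aux_xi_eq (p q : ℝ) (hp : 0 < p) (hq : 0 < q)
    (h : Real.exp (-p) + p = Real.exp q - q) :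
    1 / (1 - Real.exp (-p)) + 1 / (1 - Real.exp q) =
      (Real.exp (p + q) - 1) * (1 / (Real.exp (p + q) - 1 - (p + q)) -
        1 / ((p + q) * Real.exp (p + q) - Real.exp (p + q) + 1)) := by
  have hE : Real.exp q = Real.exp (p + q) * Real.exp (-p) := by
    rw [← Real.exp_add]; congr 1; ring
  have hc1 : Real.exp (-p) < 1 := Real.exp_lt_one_iff.2 (by linarith)
  have ha1 : 1 < Real.exp q := Real.one_lt_exp_iff.2 hq
  have hE1 : 1 < Real.exp (p + q) := Real.one_lt_exp_iff.2 (by linarith)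
  have hpq : p + q = (Real.exp (p + q) - 1) * Real.exp (-p) := by linarith
  set E := Real.exp (p + q) with hEd
  set c := Real.exp (-p) with hc
  have e1 : E - 1 - (p + q) = (E - 1) * (1 - c) := by rw [hpq]; ring
  have e2 : (p + q) * E - E + 1 = (E - 1) * (Real.exp q - 1) := by rw [hpq, hE]; ring
  rw [e1, e2]
  have : 1 - Real.exp q ≠ 0 := by linarith
  have : Real.exp q - 1 ≠ 0 := by linarith
  have : E - 1 ≠ 0 := by linarith
  have : 1 - c ≠ 0 := by linarith
  have e3 : 1 / (1 - Real.exp q) = - (1 / (Real.exp q - 1)) := by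
    rw [← neg_sub (Real.exp q) 1, one_div_neg_eq_neg_one_div]
  rw [e3]
  field_simp
  ring

theorem gammaMedian_key_identity' (m u v ξ ξ' : ℝ → ℝ)
    (hm : ∀ x > (0:ℝ), 0 < m x ∧
      (∫ t in Set.Ioc (0:ℝ) (m x), Real.exp (-t) * t ^ (x - 1)) =
        (1/2) * ∫ t in Set.Ioi (0:ℝ), Real.exp (-t) * t ^ (x - 1))
    (hu : ∀ t ≥ (1:ℝ), u t ≤ 0 ∧ Real.exp (-(u t)) + u t = t)
    (hv : ∀ t ≥ (1:ℝ), 0 ≤ v t ∧ Real.exp (-(v t)) + v t = t)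
    (hξ : ∀ t > (1:ℝ),
      ξ t = 1/(1 - Real.exp (-(v t))) + 1/(1 - Real.exp (-(u t))))
    (hξ' : ∀ t > (1:ℝ), HasDerivAt ξ (ξ' t) t) :
    ∀ x > (0:ℝ),
      2 * (∫ s in (0:ℝ)..(x * Real.log (x / m x)),
          Real.exp (-s) * Real.exp (x * (1 - Real.exp (-s/x)))) =
        2/3 + ∫ t in Set.Ioi (1:ℝ), ξ' t * Real.exp (-x * (t - 1)) := by
  intro x hx
  obtain ⟨hint, hmed⟩ := aux_gamma x hx (m x) (hm x hx).1 (hm x hx).2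
  rw [aux_lhs x hx]
  set g : ℝ → ℝ := fun r : ℝ => Real.exp (-x * (Real.exp (-r) + r)) with hg
  have hgc : Continuous g := by fun_prop
  obtain ⟨hv1, hv2, hv3⟩ := aux_inv _ v aux_Fv (by simp) hv
  obtain ⟨hu1, hu2, hu3⟩ := aux_inv _ (fun t => -(u t)) aux_Fu (by simp) (fun t ht => by
    obtain ⟨h1, h2⟩ := hu t ht
    exact ⟨by linarith, by linarith⟩)
  have hu0 : ∀ t > (1:ℝ), u t < 0 := fun t ht => by have := (hu1 t ht).1; linarith
  have huc : ∀ t > (1:ℝ), ContinuousAt u t := fun t ht => by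
    have := (hu1 t ht).2.neg
    simpa only [Pi.neg_def, neg_neg] using this
  have hvd : ∀ t > (1:ℝ), HasDerivAt v (1 / (1 - Real.exp (-(v t)))) t := fun t ht =>
    aux_deriv v t ht (hv1 t ht).2 (hv1 t ht).1.ne' (fun t ht => (hv t ht).2)
  have hud : ∀ t > (1:ℝ), HasDerivAt u (1 / (1 - Real.exp (-(u t)))) t := fun t ht =>
    aux_deriv u t ht (huc t ht) (hu0 t ht).ne (fun t ht => (hu t ht).2)
  have heq : ∀ t > (1:ℝ), Real.exp (-(v t)) + v t = Real.exp (-(u t)) - (-(u t)) := fun t ht => by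
    rw [(hv t ht.le).2]; linarith [(hu t ht.le).2]
  -- sign of the derivative
  have hpos : ∀ t > (1:ℝ), 0 ≤ ξ' t := by
    intro t ht
    have h1 := (aux_deriv2 v t (hv1 t ht).1.ne' (hvd t ht)).add
      (aux_deriv2 u t (hu0 t ht).ne (hud t ht))
    have h2 : ξ' t = _ := (hξ' t ht).unique (h1.congr_of_eventuallyEq (by
      filter_upwards [Ioi_mem_nhds ht] with y hy
      exact hξ y hy))
    have h3 := aux_sign (v t) (-(u t)) (hv1 t ht).1 (hu1 t ht).1 (heq t ht)
    have h4 : (1 - Real.exp (-(u t))) ^ 3 = -(Real.exp (-(u t)) - 1) ^ 3 := by ring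
    rw [h2, h4, div_neg]
    linarith
  -- limit at 1
  have hξ1 : Tendsto ξ (nhdsWithin 1 (Ioi 1)) (nhds (2 / 3)) := by
    have hL : Tendsto (fun t => v t + -(u t)) (nhdsWithin 1 (Ioi 1)) (nhdsWithin 0 (Ioi 0)) := by
      refine tendsto_nhdsWithin_iff.2 ⟨by simpa using hv2.add hu2, ?_⟩
      filter_upwards [self_mem_nhdsWithin] with t ht
      exact add_pos (hv1 t ht).1 (hu1 t ht).1
    refine (aux_limit.comp hL).congr' ?_
    filter_upwards [self_mem_nhdsWithin] with t ht
    rw [hξ t ht]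
    exact (aux_xi_eq (v t) (-(u t)) (hv1 t ht).1 (hu1 t ht).1 (heq t ht)).symm
  -- limit at infinity
  have hξ2 : Tendsto ξ atTop (nhds 1) := by
    have h1 : Tendsto (fun t => 1 / (1 - Real.exp (-(v t)))) atTop (nhds 1) := by
      have := ((Real.tendsto_exp_neg_atTop_nhds_zero.comp hv3).const_sub 1).inv₀ (by norm_num)
      simpa using this
    have h2 : Tendsto (fun t => 1 / (1 - Real.exp (-(u t)))) atTop (nhds 0) := by
      have h3 : Tendsto (fun t => Real.exp (-(u t)) - 1) atTop atTop :=
        tendsto_atTop_add_const_right _ _ (Real.tendsto_exp_atTop.comp hu3)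
      have h4 := (tendsto_inv_atTop_zero.comp h3).neg
      rw [neg_zero] at h4
      refine h4.congr fun t => ?_
      simp only [Function.comp]
      rw [one_div, ← inv_neg, neg_sub]
    have h5 := h1.add h2
    rw [add_zero] at h5
    refine h5.congr' ?_
    filter_upwards [eventually_gt_atTop 1] with t ht
    exact (hξ t ht).symm
  -- the primitive
  set P : ℝ → ℝ := fun y => ∫ r in (0:ℝ)..y, g r with hP
  have hPd : ∀ y, HasDerivAt P (g y) y := fun y =>
    intervalIntegral.integral_hasDerivAt_right (hgc.intervalIntegrable _ _)
      (hgc.stronglyMeasurableAtFilter _ _) hgc.continuousAt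
  have hP0 : P 0 = 0 := by simp [hP]
  have hPc : Tendsto P (nhds 0) (nhds 0) := by
    have := (hPd 0).continuousAt.tendsto
    rwa [hP0] at this
  have hu2' : Tendsto u (nhdsWithin 1 (Ioi 1)) (nhds 0) := by simpa using hu2.neg
  have hu3' : Tendsto u atTop atBot := by
    simpa only [Function.comp_def, neg_neg] using tendsto_neg_atTop_atBot.comp hu3
  set Φ : ℝ → ℝ := fun t => ξ t * Real.exp (-x * (t - 1)) +
    x * Real.exp x * (P (v t) + P (u t)) with hΦ
  have hΦd : ∀ t > (1:ℝ), HasDerivAt Φ (ξ' t * Real.exp (-x * (t - 1))) t := by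
    intro t ht
    have h1 : HasDerivAt (fun t => Real.exp (-x * (t - 1))) (Real.exp (-x * (t - 1)) * (-x * 1)) t :=
      (((hasDerivAt_id t).sub_const 1).const_mul (-x)).exp
    have h2 := ((hPd (v t)).comp t (hvd t ht)).add ((hPd (u t)).comp t (hud t ht))
    have h3 := ((hξ' t ht).mul h1).add (h2.const_mul (x * Real.exp x))
    refine h3.congr_deriv ?_
    have gv : g (v t) = Real.exp (-x * t) := by simp only [hg]; rw [(hv t ht.le).2]
    have gu : g (u t) = Real.exp (-x * t) := by simp only [hg]; rw [(hu t ht.le).2]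
    have ge : Real.exp (-x * (t - 1)) = Real.exp x * Real.exp (-x * t) := by
      rw [← Real.exp_add]; congr 1; ring
    rw [gv, gu, ge, hξ t ht]
    ring
  have hΦ1 : Tendsto Φ (nhdsWithin 1 (Ioi 1)) (nhds (2 / 3)) := by
    have h1 : Tendsto (fun t => Real.exp (-x * (t - 1))) (nhdsWithin 1 (Ioi 1)) (nhds 1) := by
      have : Continuous (fun t => Real.exp (-x * (t - 1))) := by fun_prop
      have := (this.tendsto 1).mono_left (nhdsWithin_le_nhds (s := Ioi (1:ℝ)))
      simpa using this
    have h2 := (hξ1.mul h1).add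
      (((hPc.comp hv2).add (hPc.comp hu2')).const_mul (x * Real.exp x))
    have h3 : (2:ℝ) / 3 * 1 + x * Real.exp x * (0 + 0) = 2 / 3 := by ring
    rw [h3] at h2
    exact h2
  have hΦ2 : Tendsto Φ atTop (nhds (x * Real.exp x *
      ((∫ r in Ioi (0:ℝ), g r) - ∫ r in Iic (0:ℝ), g r))) := by
    have h1 : Tendsto (fun t => Real.exp (-x * (t - 1))) atTop (nhds 0) := by
      have h : Tendsto (fun t : ℝ => x * (t - 1)) atTop atTop :=
        (tendsto_atTop_add_const_right _ _ tendsto_id).const_mul_atTop hx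
      refine (Real.tendsto_exp_neg_atTop_nhds_zero.comp h).congr fun t => ?_
      simp only [Function.comp]
      congr 1
      ring
    have hA : Tendsto (fun t => P (v t)) atTop (nhds (∫ r in Ioi (0:ℝ), g r)) :=
      intervalIntegral_tendsto_integral_Ioi 0 hint.integrableOn hv3
    have hB : Tendsto (fun t => P (u t)) atTop (nhds (-∫ r in Iic (0:ℝ), g r)) := by
      have := (intervalIntegral_tendsto_integral_Iic 0 hint.integrableOn hu3').neg
      refine this.congr fun t => ?_
      simp only [hP]
      rw [intervalIntegral.integral_symm (u t) 0]
    have h2 := (hξ2.mul h1).add ((hA.add hB).const_mul (x * Real.exp x))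
    rw [mul_zero, zero_add, ← sub_eq_add_neg] at h2
    exact h2
  -- conclusion
  have hfin := integral_Ioi_of_hasDerivAt_of_nonneg (a := 1) (g := Function.update Φ 1 (2 / 3))
    (g' := fun t => ξ' t * Real.exp (-x * (t - 1)))
    (l := x * Real.exp x * ((∫ r in Ioi (0:ℝ), g r) - ∫ r in Iic (0:ℝ), g r))
    (by
      rw [continuousWithinAt_update_same]
      rw [Ici_sdiff_left]
      exact hΦ1)
    (by
      intro t ht
      refine (hΦd t ht).congr_of_eventuallyEq ?_
      filter_upwards [Ioi_mem_nhds (show (1:ℝ) < t from ht)] with y hy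
      exact Function.update_of_ne (ne_of_gt hy) _ _)
    (by
      intro t ht
      exact mul_nonneg (hpos t ht) (Real.exp_pos _).le)
    (by
      refine hΦ2.congr' ?_
      filter_upwards [eventually_gt_atTop 1] with y hy
      exact (Function.update_of_ne (ne_of_gt hy) _ _).symm)
  rw [hfin, Function.update_self, ← hmed]
  ring
end

section
/- The function ξ is concave on the interval (1, ∞). -/
open MeasureTheory Filter Set

namespace XiAux

/-- Rational lower bound for `s` as a function of `L`. -/
noncomputable def Rp (L : ℝ) : ℝ :=
  1 + L - (1 - L)^3 * (5 + 5*L - 4*L^3 - 7*L^4 - 8*L^5 - 14*L^6 + 24*L^7) / 5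

noncomputable def Rd (L : ℝ) : ℝ :=
  1 + 3 * (1 - L)^2 * (5 + 5*L - 4*L^3 - 7*L^4 - 8*L^5 - 14*L^6 + 24*L^7) / 5
    - (1 - L)^3 * (5 - 12*L^2 - 28*L^3 - 40*L^4 - 84*L^5 + 168*L^6) / 5

lemma hasDerivAt_Rp (L : ℝ) : HasDerivAt Rp (Rd L) L := by
  unfold Rp
  have h : HasDerivAt (fun x : ℝ => x) 1 L := hasDerivAt_id L
  have h1 : HasDerivAt (fun x : ℝ => (1 - x)^3) (3 * (1 - L)^2 * (-1)) L := by
    refine HasDerivAt.congr_deriv ((h.const_sub 1).pow 3) ?_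
    norm_num
  have h2 : HasDerivAt (fun x : ℝ => 5 + 5*x - 4*x^3 - 7*x^4 - 8*x^5 - 14*x^6 + 24*x^7)
      (5 - 12*L^2 - 28*L^3 - 40*L^4 - 84*L^5 + 168*L^6) L := by
    have := (((((((h.const_mul 5).const_add 5).sub ((h.pow 3).const_mul 4)).sub
      ((h.pow 4).const_mul 7)).sub ((h.pow 5).const_mul 8)).sub ((h.pow 6).const_mul 14)).add
      ((h.pow 7).const_mul 24))
    refine this.congr_deriv ?_
    norm_num
    ring
  refine ((h.const_add 1).sub ((h1.mul h2).div_const 5)).congr_deriv ?_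
  unfold Rd
  ring

noncomputable def EE (s L : ℝ) : ℝ :=
  3*(5*L + 10*L^3 + L^5) - 5*s*(1 + 6*L^2 + L^4) + 2*s^2*(3*L + L^3)

set_option maxHeartbeats 2000000 in
lemma EE_Rp (L : ℝ) (h0 : 0 ≤ L) (h1 : L ≤ 1) : EE (Rp L) L ≤ 0 := by
  have h2 : 0 ≤ 1 - L := by linarith
  have key : EE (Rp L) L = - (L^5 * (1-L)^3 * ((1/5)*L^0*(1-L)^29
        + (67/5)*L^1*(1-L)^28
        + (6704/25)*L^2*(1-L)^27
        + (14517/5)*L^3*(1-L)^26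
        + (513961/25)*L^4*(1-L)^25
        + (2603422/25)*L^5*(1-L)^24
        + (9907568/25)*L^6*(1-L)^23
        + (5820874/5)*L^7*(1-L)^22
        + (66782483/25)*L^8*(1-L)^21
        + (23876569/5)*L^9*(1-L)^20
        + (162584772/25)*L^10*(1-L)^19
        + (158737663/25)*L^11*(1-L)^18
        + (94135519/25)*L^12*(1-L)^17
        + (20134896/25)*L^13*(1-L)^16
        + (41208272/25)*L^14*(1-L)^15
        + (229885596/25)*L^15*(1-L)^14
        + (538839939/25)*L^16*(1-L)^13
        + (811818169/25)*L^17*(1-L)^12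
        + (900727688/25)*L^18*(1-L)^11
        + (777153463/25)*L^19*(1-L)^10
        + (533942639/25)*L^20*(1-L)^9
        + (294641686/25)*L^21*(1-L)^8
        + (130474016/25)*L^22*(1-L)^7
        + (9193514/5)*L^23*(1-L)^6
        + (2534177/5)*L^24*(1-L)^5
        + (2658523/25)*L^25*(1-L)^4
        + (406052/25)*L^26*(1-L)^3
        + (1673)*L^27*(1-L)^2
        + (501/5)*L^28*(1-L)^1
        + (12/5)*L^29*(1-L)^0)) := by
    unfold EE Rp
    ring
  rw [key]
  have : 0 ≤ L^5 * (1-L)^3 * ((1/5)*L^0*(1-L)^29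
        + (67/5)*L^1*(1-L)^28
        + (6704/25)*L^2*(1-L)^27
        + (14517/5)*L^3*(1-L)^26
        + (513961/25)*L^4*(1-L)^25
        + (2603422/25)*L^5*(1-L)^24
        + (9907568/25)*L^6*(1-L)^23
        + (5820874/5)*L^7*(1-L)^22
        + (66782483/25)*L^8*(1-L)^21
        + (23876569/5)*L^9*(1-L)^20
        + (162584772/25)*L^10*(1-L)^19
        + (158737663/25)*L^11*(1-L)^18
        + (94135519/25)*L^12*(1-L)^17
        + (20134896/25)*L^13*(1-L)^16
        + (41208272/25)*L^14*(1-L)^15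
        + (229885596/25)*L^15*(1-L)^14
        + (538839939/25)*L^16*(1-L)^13
        + (811818169/25)*L^17*(1-L)^12
        + (900727688/25)*L^18*(1-L)^11
        + (777153463/25)*L^19*(1-L)^10
        + (533942639/25)*L^20*(1-L)^9
        + (294641686/25)*L^21*(1-L)^8
        + (130474016/25)*L^22*(1-L)^7
        + (9193514/5)*L^23*(1-L)^6
        + (2534177/5)*L^24*(1-L)^5
        + (2658523/25)*L^25*(1-L)^4
        + (406052/25)*L^26*(1-L)^3
        + (1673)*L^27*(1-L)^2
        + (501/5)*L^28*(1-L)^1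
        + (12/5)*L^29*(1-L)^0) := by positivity
  linarith

set_option maxHeartbeats 2000000 in
lemma CC_Rp (L : ℝ) (h0 : 0 ≤ L) (h1 : L ≤ 1) :
    0 ≤ Rp L * (1 - L^2) - (Rp L - 2*L) * (Rd L * (1 - L^2) + 2*L*Rp L) := by
  have h2 : 0 ≤ 1 - L := by linarith
  have key : Rp L * (1 - L^2) - (Rp L - 2*L) * (Rd L * (1 - L^2) + 2*L*Rp L)
      = L^5 * (1-L)^3 * ((17/25)*L^0*(1-L)^14
        + (9/25)*L^1*(1-L)^13
        + (6/5)*L^2*(1-L)^12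
        + (6008/25)*L^3*(1-L)^11
        + (47106/25)*L^4*(1-L)^10
        + (174599/25)*L^5*(1-L)^9
        + (77841/5)*L^6*(1-L)^8
        + (568351/25)*L^7*(1-L)^7
        + (552098/25)*L^8*(1-L)^6
        + (341258/25)*L^9*(1-L)^5
        + (126553/25)*L^10*(1-L)^4
        + (27689/25)*L^11*(1-L)^3
        + (607/5)*L^12*(1-L)^2
        + (6)*L^13*(1-L)^1
        + (4/5)*L^14*(1-L)^0) := by
    unfold Rp Rd
    ring
  rw [key]
  positivity

lemma Rp_lt (L : ℝ) (h0 : 0 ≤ L) (h1 : L < 1) : Rp L < 1 + L := by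
  have h2 : 0 < 1 - L := by linarith
  have key : Rp L = 1 + L - (1-L)^3 * ((1)*L^0*(1-L)^9
        + (10)*L^1*(1-L)^8
        + (44)*L^2*(1-L)^7
        + (556/5)*L^3*(1-L)^6
        + (879/5)*L^4*(1-L)^5
        + (877/5)*L^5*(1-L)^4
        + (504/5)*L^6*(1-L)^3
        + (124/5)*L^7*(1-L)^2
        + (1/5)*L^9*(1-L)^0) := by
    unfold Rp
    ring
  rw [key]
  have : 0 < (1-L)^3 * ((1)*L^0*(1-L)^9
        + (10)*L^1*(1-L)^8
        + (44)*L^2*(1-L)^7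
        + (556/5)*L^3*(1-L)^6
        + (879/5)*L^4*(1-L)^5
        + (877/5)*L^5*(1-L)^4
        + (504/5)*L^6*(1-L)^3
        + (124/5)*L^7*(1-L)^2
        + (1/5)*L^9*(1-L)^0) := by positivity
  linarith

lemma Rp_nonneg (L : ℝ) (h0 : 0 ≤ L) (h1 : L ≤ 1) : 0 ≤ Rp L := by
  rcases h0.eq_or_lt with rfl | h0
  · norm_num [Rp]
  · by_contra! h
    have h3 := EE_Rp L h0.le h1
    unfold EE at h3
    have a1 : 0 < 3*(5*L + 10*L^3 + L^5) := by positivity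
    have a2 : 0 < (-Rp L)*(1 + 6*L^2 + L^4) := mul_pos (by linarith) (by positivity)
    have a3 : 0 ≤ 2*(Rp L)^2*(3*L + L^3) := by positivity
    linarith

noncomputable def Psi (s L : ℝ) : ℝ :=
  Real.log (1 - L + s) - Real.log (1 - L) - Real.log (1 + L - s) + Real.log (1 + L)
    - 2 * s / (1 - L^2)

lemma Psi_zero (L : ℝ) : Psi 0 L = 0 := by
  simp [Psi]

lemma Psi_Rp (L : ℝ) (h0 : 0 ≤ L) (h1 : L < 1) : Psi (Rp L) L ≤ 0 := by
  have hd : ∀ x ∈ Ico (0:ℝ) 1, HasDerivAt (fun x => Psi (Rp x) x)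
      (-(2 * Rp x * (Rp x * (1 - x^2) - (Rp x - 2*x) * (Rd x * (1 - x^2) + 2*x*Rp x)))
        / ((1 - x^2)^2 * (1 - x + Rp x) * (1 + x - Rp x))) x := by
    intro x hx
    obtain ⟨hx0, hx1⟩ := hx
    have p1 := Rp_nonneg x hx0 hx1.le
    have p2 := Rp_lt x hx0 hx1
    have n1 : 1 - x ≠ 0 := by linarith
    have n2 : 1 + x ≠ 0 := by linarith
    have n3 : 1 - x + Rp x ≠ 0 := by linarith
    have n4 : 1 + x - Rp x ≠ 0 := by linarith
    have n5 : 1 - x^2 ≠ 0 := by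
      have : 1 - x^2 = (1-x)*(1+x) := by ring
      rw [this]; exact mul_ne_zero n1 n2
    have hR := hasDerivAt_Rp x
    have h : HasDerivAt (fun x : ℝ => x) 1 x := hasDerivAt_id x
    have d1 := h.const_sub 1
    have d2 := h.const_add 1
    have d3 := d1.add hR
    have d4 := d2.sub hR
    have d5 := (h.pow 2).const_sub 1
    have := ((((d3.log n3).sub (d1.log n1)).sub (d4.log n4)).add (d2.log n2)).sub
      ((hR.const_mul 2).div d5 n5)
    refine HasDerivAt.congr_deriv this ?_
    simp only [Pi.add_apply, Pi.sub_apply, Pi.pow_apply]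
    generalize Rp x = r at *
    generalize Rd x = r' at *
    have e5 : 1 - x^2 = (1-x)*(1+x) := by ring
    simp only [e5]
    field_simp
    ring
  have hanti : AntitoneOn (fun x => Psi (Rp x) x) (Ico (0:ℝ) 1) := by
    apply antitoneOn_of_deriv_nonpos (convex_Ico 0 1)
    · exact fun x hx => (hd x hx).continuousAt.continuousWithinAt
    · intro x hx
      exact (hd x (interior_subset hx)).differentiableAt.differentiableWithinAt
    · intro x hx
      have hx' := interior_subset hx
      rw [(hd x hx').deriv]
      obtain ⟨hx0, hx1⟩ := hx'
      have p1 := Rp_nonneg x hx0 hx1.le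
      have p2 := Rp_lt x hx0 hx1
      have p3 := CC_Rp x hx0 hx1.le
      apply div_nonpos_of_nonpos_of_nonneg
      · have : 0 ≤ 2 * Rp x * (Rp x * (1 - x^2) - (Rp x - 2*x) * (Rd x * (1 - x^2) + 2*x*Rp x)) :=
          mul_nonneg (by linarith) p3
        linarith
      · have q1 : 0 ≤ 1 - x + Rp x := by linarith
        have q2 : 0 ≤ 1 + x - Rp x := by linarith
        positivity
  have := hanti (left_mem_Ico.2 one_pos) ⟨h0, h1⟩ h0
  have hz : Rp 0 = 0 := by norm_num [Rp]
  simpa [hz, Psi_zero] using this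

lemma Psi_deriv (L s : ℝ) (h1 : -1 < L) (h2 : L < 1) (h3 : 0 ≤ s) (h4 : s < 1 + L) :
    HasDerivAt (fun s => Psi s L)
      (2 * s * (s - 2*L) / ((1 - L^2) * (1 - L + s) * (1 + L - s))) s := by
  have n1 : 1 - L ≠ 0 := by linarith
  have n2 : 1 + L ≠ 0 := by linarith
  have n3 : 1 - L + s ≠ 0 := by linarith
  have n4 : 1 + L - s ≠ 0 := by linarith
  have h : HasDerivAt (fun x : ℝ => x) 1 s := hasDerivAt_id s
  have := (((((h.const_add (1-L)).log n3).sub_const (Real.log (1-L))).sub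
    ((h.const_sub (1+L)).log n4)).add_const (Real.log (1+L))).sub
      ((h.const_mul 2).div_const (1-L^2))
  refine HasDerivAt.congr_deriv this ?_
  have e5 : 1 - L^2 = (1-L)*(1+L) := by ring
  simp only [e5]
  field_simp
  ring

lemma Psi_strictMono (L : ℝ) (h1 : -1 < L) (h2 : L < 1) (a : ℝ) (ha : 0 ≤ a) (ha' : 2*L ≤ a) :
    StrictMonoOn (fun s => Psi s L) (Ico a (1+L)) := by
  apply strictMonoOn_of_deriv_pos (convex_Ico _ _)
  · intro x hx
    exact (Psi_deriv L x h1 h2 (ha.trans hx.1) hx.2).continuousAt.continuousWithinAt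
  · intro x hx
    rw [interior_Ico] at hx
    have hx0 : 0 < x := ha.trans_lt hx.1
    rw [(Psi_deriv L x h1 h2 hx0.le hx.2).deriv]
    have q0 : 0 < 1 - L^2 := by nlinarith
    have q1 : 0 < 1 - L + x := by linarith
    have q2 : 0 < 1 + L - x := by linarith [hx.2]
    have q3 : 0 < x - 2*L := by linarith [hx.1]
    positivity

lemma Psi_strictAnti (L : ℝ) (h1 : -1 < L) (h2 : L < 1) :
    StrictAntiOn (fun s => Psi s L) (Icc 0 (2*L)) := by
  apply strictAntiOn_of_deriv_neg (convex_Icc _ _)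
  · intro x hx
    exact (Psi_deriv L x h1 h2 hx.1 (by linarith [hx.2])).continuousAt.continuousWithinAt
  · intro x hx
    rw [interior_Icc] at hx
    have hx0 : 0 < x := hx.1
    have hx2 : x < 2*L := hx.2
    rw [(Psi_deriv L x h1 h2 hx0.le (by linarith)).deriv]
    have q0 : 0 < 1 - L^2 := by nlinarith
    have q1 : 0 < 1 - L + x := by linarith
    have q2 : 0 < 1 + L - x := by linarith
    have q3 : 0 < 2*L - x := by linarith
    apply div_neg_of_neg_of_pos
    · nlinarith [mul_pos hx0 q3]
    · positivity

lemma EE_nonpos (L s : ℝ) (h1 : -1 < L) (h2 : L < 1) (h3 : 0 < s) (h4 : s < 1 + L)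
    (h : Psi s L = 0) : EE s L ≤ 0 := by
  have hL : 0 < L := by
    by_contra! hL
    have := Psi_strictMono L h1 h2 0 le_rfl (by linarith) ⟨le_rfl, by linarith⟩ ⟨h3.le, h4⟩ h3
    simp only [Psi_zero, h] at this
    exact lt_irrefl _ this
  have h5 : 2*L < s := by
    by_contra! h5
    have := Psi_strictAnti L h1 h2 ⟨le_rfl, by linarith⟩ ⟨h3.le, h5⟩ h3
    simp only [Psi_zero, h] at this
    exact lt_irrefl _ this
  have h6 : Rp L ≤ s := by
    by_contra! h6
    have := Psi_strictMono L h1 h2 (2*L) (by linarith) le_rfl ⟨h5.le, h4⟩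
      ⟨by linarith, Rp_lt L hL.le h2⟩ h6
    simp only [h] at this
    linarith [Psi_Rp L hL.le h2]
  have e1 := EE_Rp L hL.le h2.le
  have e2 : EE (1+L) L ≤ 0 := by
    have : EE (1+L) L = -((1-L)^3*(5-L)) := by unfold EE; ring
    rw [this]
    have : 0 ≤ (1-L)^3*(5-L) := mul_nonneg (pow_nonneg (by linarith) 3) (by linarith)
    linarith
  have hR := Rp_lt L hL.le h2
  generalize Rp L = r at *
  have hA : 0 < 2*(3*L+L^3) := by positivity
  have id : EE s L * (1+L-r) = EE r L * (1+L-s) + EE (1+L) L * (s-r)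
      - 2*(3*L+L^3) * ((s-r)*(1+L-s)*(1+L-r)) := by unfold EE; ring
  have t1 : 0 ≤ 2*(3*L+L^3) * ((s-r)*(1+L-s)*(1+L-r)) := by
    have : 0 ≤ s - r := by linarith
    have : 0 ≤ 1+L-s := by linarith
    have : 0 ≤ 1+L-r := by linarith
    positivity
  have t2 : EE r L * (1+L-s) ≤ 0 := mul_nonpos_of_nonpos_of_nonneg e1 (by linarith)
  have t3 : EE (1+L) L * (s-r) ≤ 0 := mul_nonpos_of_nonpos_of_nonneg e2 (by linarith)
  by_contra! hc
  have : 0 < EE s L * (1+L-r) := mul_pos hc (by linarith)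
  linarith

lemma key_wz (w z : ℝ) (hw : 0 < w) (hw1 : w < 1) (hz : 0 < z)
    (h : -w - Real.log (1 - w) = z - Real.log (1 + z)) :
    3*(1/w)^5 - 5*(1/w)^4 + 2*(1/w)^3 ≤ 3*(1/z)^5 + 5*(1/z)^4 + 2*(1/z)^3 := by
  obtain ⟨L, hL⟩ : ∃ L, L = (z-w)/(z+w) := ⟨_, rfl⟩
  obtain ⟨s, hs⟩ : ∃ s, s = 2*w*z/(z+w) := ⟨_, rfl⟩
  have hzw : 0 < z + w := by linarith
  have e1 : 1 - L = 2*w/(z+w) := by rw [hL]; field_simp; ring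
  have e2 : 1 + L = 2*z/(z+w) := by rw [hL]; field_simp; ring
  have p1 : 0 < 1 - L := by rw [e1]; positivity
  have p2 : 0 < 1 + L := by rw [e2]; positivity
  have p3 : 0 < s := by rw [hs]; positivity
  have e3 : 1 - L + s = (1 - L) * (1 + z) := by rw [e1, hs]; field_simp
  have e4 : 1 + L - s = (1 + L) * (1 - w) := by rw [e2, hs]; field_simp
  have p4 : s < 1 + L := by
    have : 0 < 1 + L - s := by rw [e4]; exact mul_pos p2 (by linarith)
    linarith
  have e5 : 2 * s / (1 - L^2) = z + w := by
    have : 1 - L^2 = (1-L)*(1+L) := by ring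
    rw [this, e1, e2, hs]; field_simp; try ring
  have hPsi : Psi s L = 0 := by
    unfold Psi
    rw [e3, e4, e5, Real.log_mul p1.ne' (by linarith), Real.log_mul p2.ne' (by linarith)]
    linarith
  have hE := EE_nonpos L s (by linarith) (by linarith) p3 p4 hPsi
  have w1 : 1/w = (1+L)/s := by rw [e2, hs]; field_simp
  have z1 : 1/z = (1-L)/s := by rw [e1, hs]; field_simp
  have hid : 3*(1/w)^5 - 5*(1/w)^4 + 2*(1/w)^3 - (3*(1/z)^5 + 5*(1/z)^4 + 2*(1/z)^3)
      = 2 / s^5 * EE s L := by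
    rw [w1, z1]; unfold EE; field_simp; ring
  have : 2 / s^5 * EE s L ≤ 0 := mul_nonpos_of_nonneg_of_nonpos (by positivity) hE
  linarith

lemma hasDerivAt_f (s : ℝ) :
    HasStrictDerivAt (fun s : ℝ => Real.exp (-s) + s) (1 - Real.exp (-s)) s := by
  have h : HasStrictDerivAt (fun x : ℝ => x) 1 s := hasStrictDerivAt_id s
  refine (h.neg.exp.add h).congr_deriv ?_
  simp only [Pi.neg_apply]
  ring

lemma inj_pos : InjOn (fun s : ℝ => Real.exp (-s) + s) (Ioi 0) := by
  apply StrictMonoOn.injOn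
  apply strictMonoOn_of_deriv_pos (convex_Ioi _)
  · exact fun x _ => (hasDerivAt_f x).hasDerivAt.continuousAt.continuousWithinAt
  · intro x hx
    rw [interior_Ioi] at hx
    rw [(hasDerivAt_f x).hasDerivAt.deriv]
    have : Real.exp (-x) < 1 := Real.exp_lt_one_iff.2 (by simpa using hx)
    linarith

lemma inj_neg : InjOn (fun s : ℝ => Real.exp (-s) + s) (Iio 0) := by
  apply StrictAntiOn.injOn
  apply strictAntiOn_of_deriv_neg (convex_Iio _)
  · exact fun x _ => (hasDerivAt_f x).hasDerivAt.continuousAt.continuousWithinAt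
  · intro x hx
    rw [interior_Iio] at hx
    rw [(hasDerivAt_f x).hasDerivAt.deriv]
    have : 1 < Real.exp (-x) := Real.one_lt_exp_iff.2 (by simpa using hx)
    linarith

lemma deriv_inv (S : Set ℝ) (hS : IsOpen S) (hinj : InjOn (fun s : ℝ => Real.exp (-s) + s) S)
    (h0 : (0:ℝ) ∉ S) (g : ℝ → ℝ) (hg : ∀ t > (1:ℝ), g t ∈ S ∧ Real.exp (-(g t)) + g t = t)
    (t : ℝ) (ht : 1 < t) : HasDerivAt g (1 / (1 - Real.exp (-(g t)))) t := by
  have hne : 1 - Real.exp (-(g t)) ≠ 0 := by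
    intro h
    have h1 : Real.exp (-(g t)) = 1 := by linarith
    rw [Real.exp_eq_one_iff] at h1
    apply h0
    have := (hg t ht).1
    rwa [show g t = 0 by linarith] at this
  have hs := hasDerivAt_f (g t)
  have hd := hs.to_localInverse hne
  have hr := HasStrictDerivAt.eventually_right_inverse hs hne
  have hval : HasStrictDerivAt.localInverse _ _ (g t) hs hne (Real.exp (-(g t)) + g t) = g t :=
    HasStrictFDerivAt.localInverse_apply_image (hs.hasStrictFDerivAt_equiv hne)
  have hc := hd.hasDerivAt.continuousAt
  simp only [(hg t ht).2] at hd hr hval hc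
  have hmem : ∀ᶠ x in nhds t, HasStrictDerivAt.localInverse _ _ (g t) hs hne x ∈ S := by
    apply hc.eventually_mem
    rw [hval]
    exact hS.mem_nhds (hg t ht).1
  have heq : g =ᶠ[nhds t] HasStrictDerivAt.localInverse _ _ (g t) hs hne := by
    filter_upwards [hr, hmem, lt_mem_nhds ht] with x hx1 hx2 hx3
    apply hinj (hg x hx3).1 hx2
    simp only [(hg x hx3).2]
    exact hx1.symm
  rw [one_div]
  exact hd.hasDerivAt.congr_of_eventuallyEq heq

lemma deriv_p (g : ℝ → ℝ) (t : ℝ) (hne : 1 - Real.exp (-(g t)) ≠ 0)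
    (h : HasDerivAt g (1 / (1 - Real.exp (-(g t)))) t) :
    HasDerivAt (fun t => 1 / (1 - Real.exp (-(g t))))
      ((1 / (1 - Real.exp (-(g t))))^2 - (1 / (1 - Real.exp (-(g t))))^3) t := by
  have := (h.neg.exp.const_sub 1).inv hne
  simp only [one_div] at this ⊢
  refine HasDerivAt.congr_deriv this ?_
  simp only [Pi.neg_apply]
  generalize Real.exp (-(g t)) = e at *
  field_simp
  ring

end XiAux

open XiAux in
/-- The function `ξ` is concave on `(1,∞)`.  Here `u t ≤ 0 ≤ v t` are the
two solutions of `e^{-s} + s = t` for `t ≥ 1`, and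
`ξ(t) = 1/(1 − e^{-v t}) + 1/(1 − e^{-u t})` for `t > 1`. -/
theorem xi_concave (u v ξ : ℝ → ℝ)
    (hu : ∀ t ≥ (1:ℝ), u t ≤ 0 ∧ Real.exp (-(u t)) + u t = t)
    (hv : ∀ t ≥ (1:ℝ), 0 ≤ v t ∧ Real.exp (-(v t)) + v t = t)
    (hξ : ∀ t > (1:ℝ),
      ξ t = 1/(1 - Real.exp (-(v t))) + 1/(1 - Real.exp (-(u t)))) :
    ConcaveOn ℝ (Set.Ioi 1) ξ := by
  have hu' : ∀ t > (1:ℝ), u t ∈ Iio (0:ℝ) ∧ Real.exp (-(u t)) + u t = t := by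
    intro t ht
    obtain ⟨a, b⟩ := hu t ht.le
    refine ⟨lt_of_le_of_ne a ?_, b⟩
    intro h
    rw [h] at b
    norm_num at b
    linarith
  have hv' : ∀ t > (1:ℝ), v t ∈ Ioi (0:ℝ) ∧ Real.exp (-(v t)) + v t = t := by
    intro t ht
    obtain ⟨a, b⟩ := hv t ht.le
    refine ⟨lt_of_le_of_ne a ?_, b⟩
    intro h
    rw [← h] at b
    norm_num at b
    linarith
  have hue : ∀ t > (1:ℝ), 1 < Real.exp (-(u t)) := by
    intro t ht
    have h : u t < 0 := (hu' t ht).1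
    exact Real.one_lt_exp_iff.2 (by linarith)
  have hve : ∀ t > (1:ℝ), Real.exp (-(v t)) < 1 := by
    intro t ht
    have h : 0 < v t := (hv' t ht).1
    exact Real.exp_lt_one_iff.2 (by linarith)
  obtain ⟨p, hp⟩ : ∃ p : ℝ → ℝ, p = fun t => 1/(1 - Real.exp (-(v t))) := ⟨_, rfl⟩
  obtain ⟨q, hq⟩ : ∃ q : ℝ → ℝ, q = fun t => 1/(1 - Real.exp (-(u t))) := ⟨_, rfl⟩
  have dp : ∀ t > (1:ℝ), HasDerivAt p ((p t)^2 - (p t)^3) t := by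
    intro t ht
    rw [hp]
    exact deriv_p v t (by linarith [hve t ht])
      (deriv_inv _ isOpen_Ioi inj_pos (by simp) v hv' t ht)
  have dq : ∀ t > (1:ℝ), HasDerivAt q ((q t)^2 - (q t)^3) t := by
    intro t ht
    rw [hq]
    exact deriv_p u t (by linarith [hue t ht])
      (deriv_inv _ isOpen_Iio inj_neg (by simp) u hu' t ht)
  have dξ : ∀ t > (1:ℝ), HasDerivAt ξ ((p t)^2 - (p t)^3 + ((q t)^2 - (q t)^3)) t := by
    intro t ht
    apply ((dp t ht).add (dq t ht)).congr_of_eventuallyEq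
    filter_upwards [lt_mem_nhds ht] with x hx
    rw [hξ x hx, hp, hq]
    rfl
  have dξ2 : ∀ t > (1:ℝ), HasDerivAt (deriv ξ)
      ((2 * p t - 3 * (p t)^2) * ((p t)^2 - (p t)^3)
        + (2 * q t - 3 * (q t)^2) * ((q t)^2 - (q t)^3)) t := by
    intro t ht
    have h := (((dp t ht).pow 2).sub ((dp t ht).pow 3)).add (((dq t ht).pow 2).sub ((dq t ht).pow 3))
    have h2 := h.congr_of_eventuallyEq (f₁ := deriv ξ) (by
      filter_upwards [lt_mem_nhds ht] with x hx
      rw [(dξ x hx).deriv]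
      rfl)
    refine h2.congr_deriv ?_
    norm_num
    ring
  apply concaveOn_of_deriv2_nonpos' (convex_Ioi 1)
  · exact fun t ht => (dξ t ht).differentiableAt.differentiableWithinAt
  · exact fun t ht => (dξ2 t ht).differentiableAt.differentiableWithinAt
  · intro t ht
    have ht : 1 < t := ht
    change deriv (deriv ξ) t ≤ 0
    rw [(dξ2 t ht).deriv]
    have k := key_wz (1 - Real.exp (-(v t))) (Real.exp (-(u t)) - 1) (by linarith [hve t ht])
      (by linarith [Real.exp_pos (-(v t))]) (by linarith [hue t ht]) (by
        have a := (hu' t ht).2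
        have b := (hv' t ht).2
        rw [show 1 - (1 - Real.exp (-(v t))) = Real.exp (-(v t)) by ring,
          show 1 + (Real.exp (-(u t)) - 1) = Real.exp (-(u t)) by ring, Real.log_exp, Real.log_exp]
        linarith)
    have e1 : 1 / (1 - Real.exp (-(v t))) = p t := by rw [hp]
    have e2 : 1 / (Real.exp (-(u t)) - 1) = - q t := by
      rw [hq]
      simp only
      rw [← neg_sub 1, one_div, one_div, inv_neg]
    rw [e1, e2] at k
    nlinarith [k]
end

section
/- As x → 0+, the median of the gamma distribution satisfies: (i) m(x)^x → 1/2; (ii) m(x)·2^{1/x} → e^{−γ}, i.e. m(x) ∼ e^{−γ}·2^{−1/x}; (iii) m'(x)·x²·2^{1/x} → (log 2)·e^{−γ}, i.e. m'(x) ∼ (log 2)·e^{−γ}·2^{−1/x}/x². Here γ is the Euler–Mascheroni constant. -/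
open MeasureTheory Filter Set
lemma gm_int1 (x : ℝ) (hx : 0 < x) (M : ℝ) : IntervalIntegrable (fun t : ℝ => Real.exp (-t) * t ^ (x - 1)) volume 0 M := by
  apply IntervalIntegrable.continuousOn_mul
  · exact intervalIntegral.intervalIntegrable_rpow' (by linarith)
  · fun_prop

lemma gm_int2 (x : ℝ) (hx : 0 < x) (a M : ℝ) : IntervalIntegrable (fun t : ℝ => Real.exp (-t) * t ^ x) volume a M := by
  apply IntervalIntegrable.continuousOn_mul
  · exact intervalIntegral.intervalIntegrable_rpow' (by linarith)
  · fun_prop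

lemma gm_parts (x : ℝ) (hx : 0 < x) (M : ℝ) (hM : 0 ≤ M) :
    x * ∫ t in (0:ℝ)..M, Real.exp (-t) * t ^ (x - 1) =
      Real.exp (-M) * M ^ x + ∫ t in (0:ℝ)..M, Real.exp (-t) * t ^ x := by
  have h := intervalIntegral.integral_eq_sub_of_hasDerivAt_of_le (a := 0) (b := M) hM
    (f := fun t => Real.exp (-t) * t ^ x)
    (f' := fun t => x * (Real.exp (-t) * t ^ (x - 1)) - Real.exp (-t) * t ^ x)
    (by
      apply ContinuousOn.mul (by fun_prop)
      exact (Real.continuous_rpow_const hx.le).continuousOn)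
    (by
      intro t ht
      have h1 : HasDerivAt (fun t : ℝ => Real.exp (-t)) (Real.exp (-t) * (-1)) t :=
        (hasDerivAt_neg t).exp
      have h2 := Real.hasDerivAt_rpow_const (x := t) (p := x) (Or.inl ht.1.ne')
      exact (h1.mul h2).congr_deriv (by ring))
    (((gm_int1 x hx M).const_mul x).sub (gm_int2 x hx 0 M))
  rw [intervalIntegral.integral_sub ((gm_int1 x hx M).const_mul x) (gm_int2 x hx 0 M),
    intervalIntegral.integral_const_mul] at h
  simp only [Real.zero_rpow hx.ne', mul_zero, sub_zero] at h
  linarith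

lemma gm_lower (x : ℝ) (hx : 0 < x) (d M : ℝ) (hd : 0 ≤ d) (hM : d ≤ M) :
    Real.exp (-d) * d ^ x ≤ x * ∫ t in (0:ℝ)..M, Real.exp (-t) * t ^ (x - 1) := by
  have h1 : Real.exp (-d) * d ^ x ≤ x * ∫ t in (0:ℝ)..d, Real.exp (-t) * t ^ (x - 1) := by
    rw [gm_parts x hx d hd]
    have : 0 ≤ ∫ t in (0:ℝ)..d, Real.exp (-t) * t ^ x := by
      apply intervalIntegral.integral_nonneg hd
      intro t ht
      have := Real.rpow_nonneg ht.1 x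
      positivity
    linarith
  refine h1.trans (mul_le_mul_of_nonneg_left ?_ hx.le)
  apply intervalIntegral.integral_mono_interval le_rfl hd hM _ (gm_int1 x hx M)
  filter_upwards [ae_restrict_mem measurableSet_Ioc] with t ht
  have := Real.rpow_nonneg ht.1.le (x-1)
  simp only [Pi.zero_apply]
  positivity

lemma gm_upper (x : ℝ) (hx : 0 < x) (M : ℝ) (hM : 0 ≤ M) :
    x * ∫ t in (0:ℝ)..M, Real.exp (-t) * t ^ (x - 1) ≤ M ^ x := by
  have h1 : ∫ t in (0:ℝ)..M, Real.exp (-t) * t ^ (x - 1) ≤ ∫ t in (0:ℝ)..M, t ^ (x - 1) := by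
    apply intervalIntegral.integral_mono_on hM (gm_int1 x hx M)
      (intervalIntegral.intervalIntegrable_rpow' (by linarith))
    intro t ht
    have := Real.rpow_nonneg ht.1 (x-1)
    have h2 : Real.exp (-t) ≤ 1 := Real.exp_le_one_iff.2 (by linarith [ht.1])
    nlinarith
  rw [integral_rpow (Or.inl (by linarith))] at h1
  simp only [sub_add_cancel, Real.zero_rpow hx.ne', sub_zero] at h1
  calc _ ≤ x * (M ^ x / x) := mul_le_mul_of_nonneg_left h1 hx.le
    _ = _ := by field_simp

lemma gm_lip (x y M N : ℝ) (hx : 0 < x) (hy : 0 < y) (hM : 0 < M) (hN : 0 < N) (hM1 : M ≤ 1) (hN1 : N ≤ 1) :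
    |(∫ t in (0:ℝ)..N, Real.exp (-t) * t ^ y) - ∫ t in (0:ℝ)..M, Real.exp (-t) * t ^ x|
      ≤ |y - x| + |N - M| := by
  have e : (∫ t in (0:ℝ)..N, Real.exp (-t) * t ^ y) - ∫ t in (0:ℝ)..M, Real.exp (-t) * t ^ x
     = (∫ t in (0:ℝ)..M, (Real.exp (-t) * t ^ y - Real.exp (-t) * t ^ x)) + ∫ t in M..N, Real.exp (-t) * t ^ y := by
    rw [intervalIntegral.integral_sub (gm_int2 y hy 0 M) (gm_int2 x hx 0 M),
      ← intervalIntegral.integral_add_adjacent_intervals (gm_int2 y hy 0 M) (gm_int2 y hy M N)]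
    ring
  have b2 : |∫ t in M..N, Real.exp (-t) * t ^ y| ≤ |N - M| := by
    have := intervalIntegral.norm_integral_le_of_norm_le_const (a := M) (b := N) (C := 1)
      (f := fun t => Real.exp (-t) * t ^ y) (by
        intro t ht
        have h0 : 0 < t := lt_of_le_of_lt (le_min hM.le hN.le) ht.1
        have h1 : t ≤ 1 := ht.2.trans (max_le hM1 hN1)
        have h2 : Real.exp (-t) ≤ 1 := Real.exp_le_one_iff.2 (by linarith)
        have h3 : t ^ y ≤ 1 := Real.rpow_le_one h0.le h1 hy.le
        have h4 := Real.rpow_nonneg h0.le y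
        rw [Real.norm_of_nonneg (by positivity)]
        nlinarith [Real.exp_pos (-t)])
    simpa using this
  have key : ∀ x y : ℝ, 0 < x → x ≤ y → ∫ t in (0:ℝ)..1, |t ^ y - t ^ x| ≤ |y - x| := by
    intro x y hx hxy
    have : ∫ t in (0:ℝ)..1, |t ^ y - t ^ x| = ∫ t in (0:ℝ)..1, (t ^ x - t ^ y) := by
      rw [intervalIntegral.integral_of_le zero_le_one, intervalIntegral.integral_of_le zero_le_one]
      apply setIntegral_congr_fun measurableSet_Ioc
      intro t ht
      have := Real.rpow_le_rpow_of_exponent_ge ht.1 ht.2 hxy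
      simp only
      rw [abs_of_nonpos (by linarith)]; ring
    rw [this, intervalIntegral.integral_sub (intervalIntegral.intervalIntegrable_rpow' (by linarith)) (intervalIntegral.intervalIntegrable_rpow' (by linarith)),
      integral_rpow (Or.inl (by linarith)), integral_rpow (Or.inl (by linarith)), abs_of_nonneg (by linarith)]
    rw [Real.zero_rpow (by linarith), Real.zero_rpow (by linarith), Real.one_rpow, Real.one_rpow, sub_zero,
      div_sub_div _ _ (by linarith) (by linarith), div_le_iff₀ (by nlinarith)]
    nlinarith [mul_nonneg (sub_nonneg.2 hxy) (mul_nonneg hx.le (hx.le.trans hxy))]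
  have b1 : |∫ t in (0:ℝ)..M, (Real.exp (-t) * t ^ y - Real.exp (-t) * t ^ x)| ≤ |y - x| := by
    have i0 : ∀ M : ℝ, IntervalIntegrable (fun t : ℝ => |t ^ y - t ^ x|) volume 0 M := fun M =>
      ((intervalIntegral.intervalIntegrable_rpow' (by linarith)).sub
        (intervalIntegral.intervalIntegrable_rpow' (by linarith))).abs
    calc _ ≤ ∫ t in (0:ℝ)..M, |Real.exp (-t) * t ^ y - Real.exp (-t) * t ^ x| :=
          intervalIntegral.abs_integral_le_integral_abs hM.le
      _ ≤ ∫ t in (0:ℝ)..M, |t ^ y - t ^ x| := by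
          apply intervalIntegral.integral_mono_on hM.le ((gm_int2 y hy 0 M).sub (gm_int2 x hx 0 M)).abs (i0 M)
          intro t ht
          have h2 : Real.exp (-t) ≤ 1 := Real.exp_le_one_iff.2 (by linarith [ht.1])
          rw [← mul_sub, abs_mul, abs_of_pos (Real.exp_pos _)]
          exact mul_le_of_le_one_left (abs_nonneg _) h2
      _ ≤ ∫ t in (0:ℝ)..1, |t ^ y - t ^ x| := by
          apply intervalIntegral.integral_mono_interval le_rfl hM.le hM1 _ (i0 1)
          exact Eventually.of_forall fun t => abs_nonneg _
      _ ≤ _ := by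
          rcases le_total x y with h | h
          · exact key x y hx h
          · have := key y x hy h
            simpa only [abs_sub_comm (_ ^ y), abs_sub_comm y x] using this
  rw [e]
  exact (abs_add_le _ _).trans (add_le_add b1 b2)

lemma gm_logGamma : Tendsto (fun x : ℝ => Real.log (Real.Gamma (x + 1)) / x) (nhdsWithin 0 (Set.Ioi 0))
    (nhds (-Real.eulerMascheroniConstant)) := by
  have h1 : HasDerivAt Real.Gamma (-Real.eulerMascheroniConstant) (0 + 1) := by
    rw [Real.eulerMascheroniConstant_eq_neg_deriv, neg_neg, zero_add]
    apply DifferentiableAt.hasDerivAt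
    apply Real.differentiableAt_Gamma
    intro k hk
    have : (0:ℝ) ≤ k := k.cast_nonneg
    linarith
  have h2 : HasDerivAt (fun x : ℝ => Real.Gamma (x + 1)) (-Real.eulerMascheroniConstant) 0 :=
    h1.comp_add_const 0 1
  have h3 := (h2.log (by simp)).tendsto_slope_zero_right
  simp only [zero_add, Real.Gamma_one, Real.log_one, sub_zero, div_one, smul_eq_mul] at h3
  refine h3.congr fun x => ?_
  ring

lemma gm_Gamma_bdd : ∃ C, ∀ x : ℝ, 0 < x → x ≤ 1 → |deriv Real.Gamma (x + 1)| ≤ C := by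
  have hmono := Real.convexOn_Gamma.monotoneOn_deriv (fun x (hx : 0 < x) =>
    Real.differentiableAt_Gamma (s := x) (by
      intro k hk
      have : (0:ℝ) ≤ k := k.cast_nonneg
      linarith))
  refine ⟨max |deriv Real.Gamma 1| |deriv Real.Gamma 2|, fun x h0 h1 => ?_⟩
  have a := hmono (a := 1) (b := x + 1) (by simp) (by simp; linarith) (by linarith)
  have b := hmono (a := x + 1) (b := 2) (by simp; linarith) (by simp) (by linarith)
  exact abs_le_max_abs_abs a b

lemma gm_slope (R m : ℝ → ℝ) (R' m' x : ℝ) (hR : HasDerivAt R R' x) (hm : HasDerivAt m m' x)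
    (h : ∀ᶠ y in nhds x, |R y - R x| ≤ |y - x| + |m y - m x|) : |R'| ≤ 1 + |m'| := by
  have h1 := hR.tendsto_slope.abs
  have h2 := (hm.tendsto_slope.abs).const_add 1
  refine le_of_tendsto_of_tendsto h1 h2 ?_
  filter_upwards [h.filter_mono nhdsWithin_le_nhds, self_mem_nhdsWithin] with y hy hne
  have hp : 0 < |y - x| := abs_pos.2 (sub_ne_zero.2 hne)
  rw [slope_def_field, slope_def_field, abs_div, abs_div, div_le_iff₀ hp, add_mul, div_mul_cancel₀ _ hp.ne']
  linarith

lemma gm_split (r d : ℝ) (h : |r| ≤ 1 + |d|) : ∃ e1 e2 : ℝ, |e1| ≤ 1 ∧ |e2| ≤ 1 ∧ r = e1 + e2 * d := by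
  have hp : 0 < 1 + |d| := by positivity
  refine ⟨r / (1 + |d|), r / (1 + |d|) * SignType.sign d, ?_, ?_, ?_⟩
  · rw [abs_div, abs_of_pos hp, div_le_one hp]; exact h
  · rw [abs_mul, abs_div, abs_of_pos hp]
    have : |r| / (1 + |d|) ≤ 1 := (div_le_one hp).2 h
    have h2 : |((SignType.sign d : SignType) : ℝ)| ≤ 1 := by
      rcases lt_trichotomy d 0 with h | h | h <;> simp [h]
    exact mul_le_one₀ this (abs_nonneg _) h2
  · rw [mul_assoc, sign_mul_self]; field_simp

lemma gm_bdd_mul {l : Filter ℝ} (f g : ℝ → ℝ) (C : ℝ) (hf : ∀ᶠ x in l, |f x| ≤ C) (hg : Tendsto g l (nhds 0)) :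
    Tendsto (fun x => f x * g x) l (nhds 0) := by
  have := (hg.abs).const_mul C
  simp only [abs_zero, mul_zero] at this
  refine squeeze_zero_norm' ?_ this
  filter_upwards [hf] with x hx
  rw [Real.norm_eq_abs, abs_mul]
  exact mul_le_mul_of_nonneg_right hx (abs_nonneg _)

theorem gammaMedian_asymptotics_at_zero (m m' : ℝ → ℝ)
    (hm : ∀ x > (0:ℝ), 0 < m x ∧
      (∫ t in Set.Ioc (0:ℝ) (m x), Real.exp (-t) * t ^ (x - 1)) =
        (1/2) * ∫ t in Set.Ioi (0:ℝ), Real.exp (-t) * t ^ (x - 1))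
    (hm' : ∀ x > (0:ℝ), HasDerivAt m (m' x) x) :
    Tendsto (fun x => m x ^ x) (nhdsWithin 0 (Set.Ioi 0)) (nhds (1/2)) ∧
    Tendsto (fun x => m x * (2:ℝ) ^ (1/x)) (nhdsWithin 0 (Set.Ioi 0))
      (nhds (Real.exp (-Real.eulerMascheroniConstant))) ∧
    Tendsto (fun x => m' x * x ^ 2 * (2:ℝ) ^ (1/x)) (nhdsWithin 0 (Set.Ioi 0))
      (nhds (Real.log 2 * Real.exp (-Real.eulerMascheroniConstant))) := by
  have mpos : ∀ x > (0:ℝ), 0 < m x := fun x hx => (hm x hx).1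
  have hG : ∀ x > (0:ℝ), x * ∫ t in (0:ℝ)..(m x), Real.exp (-t) * t ^ (x - 1) = Real.Gamma (x + 1) / 2 := by
    intro x hx
    rw [intervalIntegral.integral_of_le (mpos x hx).le, (hm x hx).2, ← Real.Gamma_eq_integral hx,
      Real.Gamma_add_one hx.ne']
    ring
  have hpos : ∀ᶠ x in nhdsWithin (0:ℝ) (Set.Ioi 0), 0 < x := self_mem_nhdsWithin
  have hx0 : Tendsto (fun x : ℝ => x) (nhdsWithin 0 (Set.Ioi 0)) (nhds 0) := nhdsWithin_le_nhds
  have hlt1 : ∀ᶠ x in nhdsWithin (0:ℝ) (Set.Ioi 0), x < 1 := hx0.eventually_lt_const one_pos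
  have dG : ∀ x > (-1:ℝ), HasDerivAt (fun x => Real.Gamma (x + 1)) (deriv Real.Gamma (x + 1)) x := by
    intro x hx
    apply HasDerivAt.comp_add_const x 1
    apply DifferentiableAt.hasDerivAt
    apply Real.differentiableAt_Gamma
    intro k hk
    have : (0:ℝ) ≤ k := k.cast_nonneg
    linarith
  have tG : Tendsto (fun x : ℝ => Real.Gamma (x + 1)) (nhdsWithin 0 (Set.Ioi 0)) (nhds 1) := by
    have := (dG 0 (by norm_num)).continuousAt.tendsto
    simp only [zero_add, Real.Gamma_one] at this
    exact this.mono_left nhdsWithin_le_nhds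
  have m0 : Tendsto m (nhdsWithin 0 (Set.Ioi 0)) (nhds 0) := by
    rw [tendsto_order]
    constructor
    · intro a ha
      filter_upwards [hpos] with x hx using ha.trans (mpos x hx)
    · intro d0 hd0
      set d := min d0 (1/2) with hd
      have d1 : 0 < d := lt_min hd0 (by norm_num)
      have d2 : d ≤ 1/2 := min_le_right _ _
      have d3 : d ≤ d0 := min_le_left _ _
      have t1 : Tendsto (fun x : ℝ => Real.exp (-d) * d ^ x) (nhdsWithin 0 (Set.Ioi 0)) (nhds (Real.exp (-d))) := by
        have := ((tendsto_const_nhds (x := d)).rpow hx0 (Or.inl d1.ne')).const_mul (Real.exp (-d))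
        simpa using this
      have t2 := tG.div_const 2
      have lt : (1:ℝ)/2 < Real.exp (-d) := by
        have := Real.add_one_lt_exp (x := -d) (by linarith)
        linarith
      filter_upwards [hpos, t2.eventually_lt t1 lt] with x hx h
      by_contra hc
      push Not at hc
      have := gm_lower x hx d (m x) d1.le (d3.trans hc)
      rw [hG x hx] at this
      linarith
  have lo : ∀ x > (0:ℝ), Real.exp (-m x) * m x ^ x ≤ Real.Gamma (x + 1) / 2 := by
    intro x hx
    rw [← hG x hx]
    exact gm_lower x hx _ _ (mpos x hx).le le_rfl
  have up : ∀ x > (0:ℝ), Real.Gamma (x + 1) / 2 ≤ m x ^ x := by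
    intro x hx
    rw [← hG x hx]
    exact gm_upper x hx _ (mpos x hx).le
  have lo' : ∀ x > (0:ℝ), m x ^ x ≤ Real.exp (m x) * (Real.Gamma (x + 1) / 2) := by
    intro x hx
    have := mul_le_mul_of_nonneg_left (lo x hx) (Real.exp_pos (m x)).le
    rwa [← mul_assoc, ← Real.exp_add, add_neg_cancel, Real.exp_zero, one_mul] at this
  have e0 : Tendsto (fun x => Real.exp (m x)) (nhdsWithin 0 (Set.Ioi 0)) (nhds 1) := by
    have := m0.rexp
    simpa using this
  have I1 : Tendsto (fun x => m x ^ x) (nhdsWithin 0 (Set.Ioi 0)) (nhds (1/2)) := by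
    have t2 := tG.div_const 2
    have t3 := e0.mul t2
    rw [one_mul] at t3
    refine tendsto_of_tendsto_of_tendsto_of_le_of_le' t2 t3 ?_ ?_
    · filter_upwards [hpos] with x hx using up x hx
    · filter_upwards [hpos] with x hx using lo' x hx
  have xlog : Tendsto (fun x => x * Real.log (m x)) (nhdsWithin 0 (Set.Ioi 0)) (nhds (-Real.log 2)) := by
    have := I1.log (by norm_num)
    rw [one_div, Real.log_inv] at this
    refine this.congr' ?_
    filter_upwards [hpos] with x hx using Real.log_rpow (mpos x hx) x
  have mx : Tendsto (fun x => m x / x) (nhdsWithin 0 (Set.Ioi 0)) (nhds 0) := by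
    have t := (tendsto_rpow_mul_exp_neg_mul_atTop_nhds_zero 1 (1/2) (by norm_num)).comp
      (tendsto_inv_nhdsGT_zero (𝕜 := ℝ))
    refine tendsto_of_tendsto_of_tendsto_of_le_of_le' tendsto_const_nhds t ?_ ?_
    · filter_upwards [hpos] with x hx using (div_pos (mpos x hx) hx).le
    · have : -Real.log 2 < -(1/2) := by linarith [Real.log_two_gt_d9]
      filter_upwards [hpos, xlog.eventually_lt_const this] with x hx h
      simp only [Function.comp, Real.rpow_one]
      rw [div_eq_inv_mul]
      apply mul_le_mul_of_nonneg_left _ (inv_pos.2 hx).le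
      rw [← Real.log_le_iff_le_exp (mpos x hx), ← div_eq_mul_inv, le_div_iff₀ hx]
      linarith
  have I2 : Tendsto (fun x => m x * (2:ℝ) ^ (1/x)) (nhdsWithin 0 (Set.Ioi 0))
      (nhds (Real.exp (-Real.eulerMascheroniConstant))) := by
    have key : Tendsto (fun x => (x * Real.log (m x) + Real.log 2) / x) (nhdsWithin 0 (Set.Ioi 0))
        (nhds (-Real.eulerMascheroniConstant)) := by
      have t3 := mx.add gm_logGamma
      rw [zero_add] at t3
      refine tendsto_of_tendsto_of_tendsto_of_le_of_le' gm_logGamma t3 ?_ ?_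
      · filter_upwards [hpos] with x hx
        have g : 0 < Real.Gamma (x + 1) := Real.Gamma_pos_of_pos (by linarith)
        have := Real.log_le_log (by linarith) (up x hx)
        rw [Real.log_rpow (mpos x hx), Real.log_div g.ne' two_ne_zero] at this
        apply div_le_div_of_nonneg_right _ hx.le
        linarith
      · filter_upwards [hpos] with x hx
        have g : 0 < Real.Gamma (x + 1) := Real.Gamma_pos_of_pos (by linarith)
        have := Real.log_le_log (Real.rpow_pos_of_pos (mpos x hx) x) (lo' x hx)
        rw [Real.log_rpow (mpos x hx), Real.log_mul (Real.exp_pos _).ne' (by linarith), Real.log_exp,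
          Real.log_div g.ne' two_ne_zero] at this
        rw [← add_div]
        apply div_le_div_of_nonneg_right _ hx.le
        linarith
    refine key.rexp.congr' ?_
    filter_upwards [hpos] with x hx
    rw [add_div, mul_div_cancel_left₀ _ hx.ne', Real.exp_add, Real.exp_log (mpos x hx),
      Real.rpow_def_of_pos two_pos]
    congr 2
    ring
  refine ⟨I1, I2, ?_⟩
  -- the derivative identity
  have D1 : ∀ᶠ x in nhdsWithin (0:ℝ) (Set.Ioi 0), ∃ e1 e2 : ℝ, |e1| ≤ 1 ∧ |e2| ≤ 1 ∧
      deriv Real.Gamma (x + 1) / 2 = Real.exp (-m x) * m x ^ x *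
        (Real.log (m x) + x * m' x / m x - m' x) + (e1 + e2 * m' x) := by
    filter_upwards [hpos, m0.eventually_lt_const one_pos] with x hx hm1
    have mp := mpos x hx
    have hd := hm' x hx
    set R : ℝ → ℝ := fun y => Real.Gamma (y + 1) / 2 - Real.exp (-m y) * m y ^ y with hRdef
    have hRint : ∀ y > (0:ℝ), R y = ∫ t in (0:ℝ)..(m y), Real.exp (-t) * t ^ y := by
      intro y hy
      have := gm_parts y hy (m y) (mpos y hy).le
      rw [hG y hy] at this
      simp only [hRdef]
      linarith
    have hR := ((dG x (by linarith)).div_const 2).sub ((hd.neg.exp).mul (hd.rpow (hasDerivAt_id x) mp))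
    have hlip : ∀ᶠ y in nhds x, |R y - R x| ≤ |y - x| + |m y - m x| := by
      filter_upwards [lt_mem_nhds hx, hd.continuousAt.eventually_lt_const hm1] with y hy hy1
      rw [hRint y hy, hRint x hx]
      exact gm_lip x y (m x) (m y) hx hy mp (mpos y hy) hm1.le hy1.le
    obtain ⟨e1, e2, h1, h2, h3⟩ := gm_split _ _ (gm_slope R m _ _ x hR hd hlip)
    refine ⟨e1, e2, h1, h2, ?_⟩
    rw [← h3]
    simp only [id, Pi.neg_apply, mul_one, Real.rpow_sub_one mp.ne']
    field_simp
    ring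
  obtain ⟨C, hC⟩ := gm_Gamma_bdd
  have : ∃ e1 e2 : ℝ → ℝ, ∀ᶠ x in nhdsWithin (0:ℝ) (Set.Ioi 0), |e1 x| ≤ 1 ∧ |e2 x| ≤ 1 ∧
      deriv Real.Gamma (x + 1) / 2 = Real.exp (-m x) * m x ^ x *
        (Real.log (m x) + x * m' x / m x - m' x) + (e1 x + e2 x * m' x) := by
    obtain ⟨e1, h⟩ := D1.choice
    obtain ⟨e2, h⟩ := h.choice
    exact ⟨e1, e2, h⟩
  obtain ⟨e1, e2, he⟩ := this
  set a : ℝ → ℝ := fun x => Real.exp (m x) / m x ^ x with ha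
  have ta : Tendsto a (nhdsWithin 0 (Set.Ioi 0)) (nhds 2) := by
    have := e0.div I1 (by norm_num)
    norm_num at this
    exact this
  have hN : Tendsto (fun x => -(x * Real.log (m x)) + a x * ((deriv Real.Gamma (x + 1) / 2 - e1 x) * x))
      (nhdsWithin 0 (Set.Ioi 0)) (nhds (Real.log 2)) := by
    have t := gm_bdd_mul (fun x => deriv Real.Gamma (x + 1) / 2 - e1 x) (fun x => x) (C / 2 + 1) (by
      filter_upwards [hpos, hlt1, he] with x hx h1 h2
      have := hC x hx h1.le
      refine (abs_sub _ _).trans (add_le_add ?_ h2.1)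
      rw [abs_div, abs_two]
      linarith) hx0
    have := xlog.neg.add (ta.mul t)
    simpa using this
  have hD : Tendsto (fun x => 1 - m x / x + a x * (e2 x * (m x / x))) (nhdsWithin 0 (Set.Ioi 0)) (nhds 1) := by
    have t := gm_bdd_mul e2 (fun x => m x / x) 1 (he.mono fun x h => h.2.1) mx
    have := (mx.const_sub 1).add (ta.mul t)
    simpa using this
  have hfin := (hN.div hD one_ne_zero).mul I2
  rw [div_one] at hfin
  refine hfin.congr' ?_
  filter_upwards [hpos, he, hD.eventually_ne one_ne_zero] with x hx h hne
  have mp := mpos x hx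
  have id1 : deriv Real.Gamma (x + 1) / 2 - e1 x = Real.exp (-m x) * m x ^ x *
        (Real.log (m x) + x * m' x / m x - m' x) + e2 x * m' x := by linarith [h.2.2]
  have id2 : a x * (Real.exp (-m x) * m x ^ x) = 1 := by
    have := (Real.rpow_pos_of_pos mp x).ne'
    simp only [ha, Real.exp_neg]
    field_simp
  have : (-(x * Real.log (m x)) + a x * ((deriv Real.Gamma (x + 1) / 2 - e1 x) * x)) /
      (1 - m x / x + a x * (e2 x * (m x / x))) * m x = m' x * x ^ 2 := by
    rw [div_mul_eq_mul_div, div_eq_iff hne, id1]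
    have : a x * ((Real.exp (-m x) * m x ^ x *
        (Real.log (m x) + x * m' x / m x - m' x) + e2 x * m' x) * x) =
        (a x * (Real.exp (-m x) * m x ^ x)) * (Real.log (m x) + x * m' x / m x - m' x) * x
          + a x * e2 x * m' x * x := by ring
    rw [this, id2]
    field_simp
    ring
  simp only [Pi.div_apply]
  rw [← mul_assoc, this]
end

section
/- As x → ∞ the median of the gamma distribution and its derivative satisfy the asymptotic expansions m(x) = x − 1/3 + 8/(405x) + 184/(25515x²) + o(x^{−2}) and m'(x) = 1 − 8/(405x²) − 368/(25515x³) + o(x^{−3}); that is, lim_{x→∞} x²·( m(x) − x + 1/3 − 8/(405x) ) = 184/25515 and lim_{x→∞} x³·( m'(x) − 1 + 8/(405x²) ) = −368/25515. -/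
open MeasureTheory Filter Set

namespace GM
open Asymptotics

def Bd {α : Type*} (l : Filter α) (f : α → ℝ) : Prop := f =O[l] (fun _ => (1:ℝ))

section X
variable {α : Type*} {l : Filter α}

lemma Bd.const (c : ℝ) : Bd l (fun _ => c) := isBigO_const_const c one_ne_zero l
lemma Bd.add {f g : α → ℝ} (hf : Bd l f) (hg : Bd l g) : Bd l (fun p => f p + g p) := IsBigO.add hf hg
lemma Bd.sub {f g : α → ℝ} (hf : Bd l f) (hg : Bd l g) : Bd l (fun p => f p - g p) := IsBigO.sub hf hg
lemma Bd.neg {f : α → ℝ} (hf : Bd l f) : Bd l (fun p => - f p) := IsBigO.neg_left hf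
lemma Bd.mul {f g : α → ℝ} (hf : Bd l f) (hg : Bd l g) : Bd l (fun p => f p * g p) := by
  have := IsBigO.mul hf hg
  simpa [Bd] using this
lemma Bd.pow {f : α → ℝ} (hf : Bd l f) (n : ℕ) : Bd l (fun p => f p ^ n) := by
  have := IsBigO.pow hf n
  simpa [Bd] using this
lemma Bd.div_const {f : α → ℝ} (hf : Bd l f) (c : ℝ) : Bd l (fun p => f p / c) := by
  simp only [div_eq_mul_inv]
  exact hf.mul (Bd.const _)
lemma Bd.sum {ι : Type*} (s : Finset ι) {f : ι → α → ℝ} (hf : ∀ i ∈ s, Bd l (f i)) :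
    Bd l (fun p => ∑ i ∈ s, f i p) := IsBigO.fun_sum hf
lemma Bd.comp {β : Type*} {l' : Filter β} {f : α → ℝ} (hf : Bd l f) {k : β → α} (hk : Tendsto k l' l) :
    Bd l' (fun p => f (k p)) := IsBigO.comp_tendsto hf hk
lemma Bd.of_tendsto {f : α → ℝ} {c : ℝ} (hf : Tendsto f l (nhds c)) : Bd l f := hf.isBigO_one ℝ

/-- `f = a + b e + c e² + d e³ + g e⁴ + O(e⁵)` with bounded coefficient functions. -/
structure X5 (l : Filter α) (e f a b c d g : α → ℝ) : Prop where
  ha : Bd l a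
  hb : Bd l b
  hc : Bd l c
  hd : Bd l d
  hg : Bd l g
  rem : (fun p => f p - (a p + b p * e p + c p * e p ^ 2 + d p * e p ^ 3 + g p * e p ^ 4)) =O[l]
    (fun p => e p ^ 5)

variable {e f f' a b c d g a' b' c' d' g' : α → ℝ}

lemma X5.of_eq (h : X5 l e f a b c d g) (h0 : ∀ p, f p = f' p) (h1 : ∀ p, a p = a' p) (h2 : ∀ p, b p = b' p)
    (h3 : ∀ p, c p = c' p) (h4 : ∀ p, d p = d' p) (h5 : ∀ p, g p = g' p) : X5 l e f' a' b' c' d' g' := by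
  obtain rfl := funext h0
  obtain rfl := funext h1
  obtain rfl := funext h2
  obtain rfl := funext h3
  obtain rfl := funext h4
  obtain rfl := funext h5
  exact h

lemma X5.congr_f (h : X5 l e f a b c d g) (h0 : f =ᶠ[l] f') : X5 l e f' a b c d g := by
  refine ⟨h.ha, h.hb, h.hc, h.hd, h.hg, ?_⟩
  refine h.rem.congr' ?_ EventuallyEq.rfl
  filter_upwards [h0] with p hp
  rw [hp]

lemma bigO_of_bd (hf : Bd l f) (n : ℕ) : (fun p => e p ^ n * f p) =O[l] (fun p => e p ^ n) := by
  have := (isBigO_refl (fun p => e p ^ n) l).mul hf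
  simpa using this

lemma X5.bd (he : Bd l e) (h : X5 l e f a b c d g) : Bd l f := by
  have h1 : Bd l (fun p => f p - (a p + b p * e p + c p * e p ^ 2 + d p * e p ^ 3 + g p * e p ^ 4)) :=
    h.rem.trans (he.pow 5)
  have h2 : Bd l (fun p => (a p + b p * e p + c p * e p ^ 2 + d p * e p ^ 3 + g p * e p ^ 4)) :=
    (((h.ha.add (h.hb.mul he)).add (h.hc.mul (he.pow 2))).add (h.hd.mul (he.pow 3))).add (h.hg.mul (he.pow 4))
  simpa using h1.add h2

lemma X5.add (h : X5 l e f a b c d g) (h' : X5 l e f' a' b' c' d' g') :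
    X5 l e (fun p => f p + f' p) (fun p => a p + a' p) (fun p => b p + b' p) (fun p => c p + c' p)
      (fun p => d p + d' p) (fun p => g p + g' p) := by
  refine ⟨h.ha.add h'.ha, h.hb.add h'.hb, h.hc.add h'.hc, h.hd.add h'.hd, h.hg.add h'.hg, ?_⟩
  refine (h.rem.add h'.rem).congr_left ?_
  intro p; ring

lemma X5.const_mul (h : X5 l e f a b c d g) (k : ℝ) :
    X5 l e (fun p => k * f p) (fun p => k * a p) (fun p => k * b p) (fun p => k * c p)
      (fun p => k * d p) (fun p => k * g p) := by
  have hk := Bd.const (l := l) k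
  refine ⟨hk.mul h.ha, hk.mul h.hb, hk.mul h.hc, hk.mul h.hd, hk.mul h.hg, ?_⟩
  refine (h.rem.const_mul_left k).congr_left ?_
  intro p; ring

lemma X5.of_bd (ha : Bd l a) : X5 l e a a (fun _ => 0) (fun _ => 0) (fun _ => 0) (fun _ => 0) := by
  refine ⟨ha, Bd.const 0, Bd.const 0, Bd.const 0, Bd.const 0, ?_⟩
  simp only [zero_mul, add_zero, sub_self]
  exact isBigO_zero _ _

lemma X5.const (k : ℝ) : X5 l e (fun _ => k) (fun _ => k) (fun _ => 0) (fun _ => 0) (fun _ => 0) (fun _ => 0) :=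
  X5.of_bd (Bd.const k)

lemma X5.var : X5 l e e (fun _ => 0) (fun _ => 1) (fun _ => 0) (fun _ => 0) (fun _ => 0) := by
  refine ⟨Bd.const 0, Bd.const 1, Bd.const 0, Bd.const 0, Bd.const 0, ?_⟩
  simp only [zero_mul, add_zero, sub_self, one_mul, zero_add]
  exact isBigO_zero _ _

lemma X5.mul (he : Bd l e) (h : X5 l e f a b c d g) (h' : X5 l e f' a' b' c' d' g') :
    X5 l e (fun p => f p * f' p) (fun p => a p * a' p) (fun p => a p * b' p + b p * a' p)
      (fun p => a p * c' p + b p * b' p + c p * a' p)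
      (fun p => a p * d' p + b p * c' p + c p * b' p + d p * a' p)
      (fun p => a p * g' p + b p * d' p + c p * c' p + d p * b' p + g p * a' p) := by
  have hf' := h'.bd he
  obtain ⟨ha, hb, hc, hd, hg, hr⟩ := h
  obtain ⟨ha', hb', hc', hd', hg', hr'⟩ := h'
  refine ⟨ha.mul ha', (ha.mul hb').add (hb.mul ha'), ((ha.mul hc').add (hb.mul hb')).add (hc.mul ha'),
    (((ha.mul hd').add (hb.mul hc')).add (hc.mul hb')).add (hd.mul ha'),
    ((((ha.mul hg').add (hb.mul hd')).add (hc.mul hc')).add (hd.mul hb')).add (hg.mul ha'), ?_⟩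
  have hP : Bd l (fun p => (a p + b p * e p + c p * e p ^ 2 + d p * e p ^ 3 + g p * e p ^ 4)) :=
    (((ha.add (hb.mul he)).add (hc.mul (he.pow 2))).add (hd.mul (he.pow 3))).add (hg.mul (he.pow 4))
  have t1 := hr.mul hf'
  have t2 := IsBigO.mul hP hr'
  simp only [mul_one, one_mul] at t1 t2
  have hR : Bd l (fun p => (b p * g' p + c p * d' p + d p * c' p + g p * b' p)
      + (c p * g' p + d p * d' p + g p * c' p) * e p + (d p * g' p + g p * d' p) * e p ^ 2
      + (g p * g' p) * e p ^ 3) :=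
    ((((((hb.mul hg').add (hc.mul hd')).add (hd.mul hc')).add (hg.mul hb'))).add
      ((((hc.mul hg').add (hd.mul hd')).add (hg.mul hc')).mul he)).add
      (((hd.mul hg').add (hg.mul hd')).mul (he.pow 2)) |>.add ((hg.mul hg').mul (he.pow 3))
  have t3 := bigO_of_bd (e := e) hR 5
  refine ((t1.add t2).add t3).congr_left ?_
  intro p; ring

lemma X5.shift (he : Bd l e) (h : X5 l e f a b c d g) :
    X5 l e (fun p => e p * f p) (fun _ => 0) a b c d := by
  refine (X5.mul he X5.var h).of_eq (fun p => rfl) ?_ ?_ ?_ ?_ ?_ <;> intro p <;> ring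

lemma X5.sum {ι : Type*} (s : Finset ι) {F A B C D G : ι → α → ℝ}
    (h : ∀ i ∈ s, X5 l e (F i) (A i) (B i) (C i) (D i) (G i)) :
    X5 l e (fun p => ∑ i ∈ s, F i p) (fun p => ∑ i ∈ s, A i p) (fun p => ∑ i ∈ s, B i p)
      (fun p => ∑ i ∈ s, C i p) (fun p => ∑ i ∈ s, D i p) (fun p => ∑ i ∈ s, G i p) := by
  classical
  induction s using Finset.induction_on with
  | empty => simpa using X5.const (l := l) (e := e) 0
  | insert i s hi ih =>
    simp only [Finset.sum_insert hi]
    exact (h i (by simp)).add (ih (fun j hj => h j (by simp [hj])))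

lemma X5.comp {β : Type*} {l' : Filter β} {k : β → α} (h : X5 l e f a b c d g) (hk : Tendsto k l' l) :
    X5 l' (fun p => e (k p)) (fun p => f (k p)) (fun p => a (k p)) (fun p => b (k p)) (fun p => c (k p))
      (fun p => d (k p)) (fun p => g (k p)) :=
  ⟨h.ha.comp hk, h.hb.comp hk, h.hc.comp hk, h.hd.comp hk, h.hg.comp hk, h.rem.comp_tendsto hk⟩

/-- functions `f = 1 + O(e)` etc. -/
lemma X5.tendsto_sub (he : Tendsto e l (nhds 0)) (h : X5 l e f a b c d g) :
    Tendsto (fun p => f p - a p) l (nhds 0) := by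
  have he' : Bd l e := Bd.of_tendsto he
  have h1 : (fun p => f p - (a p + b p * e p + c p * e p ^ 2 + d p * e p ^ 3 + g p * e p ^ 4)) =O[l] e := by
    refine h.rem.trans ?_
    have := bigO_of_bd (e := e) (he'.pow 4) 1
    simp only [pow_one] at this
    exact this.congr_left (fun p => by ring)
  have h2 : (fun p => e p ^ 1 * (b p + c p * e p + d p * e p ^ 2 + g p * e p ^ 3)) =O[l] (fun p => e p ^ 1) :=
    bigO_of_bd (((h.hb.add (h.hc.mul he')).add (h.hd.mul (he'.pow 2))).add (h.hg.mul (he'.pow 3))) 1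
  simp only [pow_one] at h2
  refine ((h1.add h2).congr_left (fun p => ?_)).trans_tendsto he
  ring

lemma X5.of_rem_eq (h : X5 l e f a b c d g) (hr : (fun p => f' p - f p) =O[l] (fun p => e p ^ 5)) :
    X5 l e f' a b c d g :=
  ⟨h.ha, h.hb, h.hc, h.hd, h.hg, (hr.add h.rem).congr_left (fun p => by ring)⟩

lemma X5.inv (he : Tendsto e l (nhds 0)) (h : X5 l e f (fun _ => 1) b c d g) :
    X5 l e (fun p => (f p)⁻¹) (fun _ => 1) (fun p => - b p) (fun p => b p ^ 2 - c p)
      (fun p => - b p ^ 3 + 2 * b p * c p - d p)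
      (fun p => b p ^ 4 - 3 * b p ^ 2 * c p + c p ^ 2 + 2 * b p * d p - g p) := by
  have he' : Bd l e := Bd.of_tendsto he
  obtain ⟨ha, hb, hc, hd, hg, hr⟩ := id h
  have hc2 := (hb.pow 2).sub hc
  have hd2 := ((hb.pow 3).neg.add (((Bd.const 2).mul hb).mul hc)).sub hd
  have hg2 := ((((hb.pow 4).sub (((Bd.const 3).mul (hb.pow 2)).mul hc)).add (hc.pow 2)).add
      (((Bd.const 2).mul hb).mul hd)).sub hg
  refine ⟨ha, hb.neg, hc2, hd2, hg2, ?_⟩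
  set G : α → ℝ := fun p => 1 + (- b p) * e p + (b p ^ 2 - c p) * e p ^ 2
      + (- b p ^ 3 + 2 * b p * c p - d p) * e p ^ 3
      + (b p ^ 4 - 3 * b p ^ 2 * c p + c p ^ 2 + 2 * b p * d p - g p) * e p ^ 4 with hG
  have hGX : X5 l e G (fun _ => 1) (fun p => - b p) (fun p => b p ^ 2 - c p)
      (fun p => - b p ^ 3 + 2 * b p * c p - d p)
      (fun p => b p ^ 4 - 3 * b p ^ 2 * c p + c p ^ 2 + 2 * b p * d p - g p) := by
    refine ⟨ha, hb.neg, hc2, hd2, hg2, ?_⟩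
    refine (isBigO_zero _ _).congr_left (f₁ := fun _ => (0:ℝ)) (fun p => ?_)
    simp only [hG]; ring
  have hp := (X5.mul he' h hGX).rem
  have hlim : Tendsto f l (nhds 1) := by
    have := (h.tendsto_sub he).add_const 1
    simpa using this
  have hbi : Bd l (fun p => (f p)⁻¹) := Bd.of_tendsto (hlim.inv₀ one_ne_zero)
  have hne : ∀ᶠ p in l, f p ≠ 0 := hlim.eventually_ne one_ne_zero
  have t := hp.neg_left.mul hbi
  simp only [mul_one] at t
  refine t.congr' ?_ EventuallyEq.rfl
  filter_upwards [hne] with p hp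
  rw [show (1 + (- b p) * e p + (b p ^ 2 - c p) * e p ^ 2
      + (- b p ^ 3 + 2 * b p * c p - d p) * e p ^ 3
      + (b p ^ 4 - 3 * b p ^ 2 * c p + c p ^ 2 + 2 * b p * d p - g p) * e p ^ 4) = G p from rfl]
  field_simp
  ring

lemma X5.exp (he : Tendsto e l (nhds 0)) (h : X5 l e f (fun _ => 0) b c d g) :
    X5 l e (fun p => Real.exp (f p)) (fun _ => 1) b (fun p => c p + b p ^ 2 / 2)
      (fun p => d p + b p * c p + b p ^ 3 / 6)
      (fun p => g p + b p * d p + c p ^ 2 / 2 + b p ^ 2 * c p / 2 + b p ^ 4 / 24) := by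
  have he' : Bd l e := Bd.of_tendsto he
  have h2 := X5.mul he' h h
  have h3 := X5.mul he' h2 h
  have h4 := X5.mul he' h3 h
  have hlim : Tendsto f l (nhds 0) := by
    have := (h.tendsto_sub he)
    simpa using this
  have hfe : f =O[l] e := by
    have h1 := h.rem
    have h1' : (fun p => f p - (0 + b p * e p + c p * e p ^ 2 + d p * e p ^ 3 + g p * e p ^ 4)) =O[l] e := by
      refine h1.trans ?_
      have := bigO_of_bd (e := e) (he'.pow 4) 1
      simp only [pow_one] at this
      exact this.congr_left (fun p => by ring)
    have h2 : (fun p => e p ^ 1 * (b p + c p * e p + d p * e p ^ 2 + g p * e p ^ 3)) =O[l] (fun p => e p ^ 1) :=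
      bigO_of_bd (((h.hb.add (h.hc.mul he')).add (h.hd.mul (he'.pow 2))).add (h.hg.mul (he'.pow 3))) 1
    simp only [pow_one] at h2
    exact (h1'.add h2).congr_left (fun p => by ring)
  have hs := (((X5.const (l := l) (e := e) 1).add h).add (h2.const_mul (1/2))).add
    ((h3.const_mul (1/6)).add (h4.const_mul (1/24)))
  have hs' := hs.of_rem_eq (f' := fun p => Real.exp (f p)) (by
    have hf5 : (fun p => f p ^ 5) =O[l] (fun p => e p ^ 5) := hfe.pow 5
    refine IsBigO.trans (IsBigO.of_bound 1 ?_) hf5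
    have hsm : ∀ᶠ p in l, |f p| ≤ 1 := by
      have := hlim.abs
      simp only [abs_zero] at this
      exact this.eventually_le_const (by norm_num)
    filter_upwards [hsm] with p hp
    have := Real.exp_bound hp (n := 5) (by norm_num)
    simp only [Finset.sum_range_succ, Finset.sum_range_zero, Nat.factorial, Nat.cast_one, pow_zero] at this
    norm_num at this
    rw [Real.norm_eq_abs, Real.norm_eq_abs, abs_pow]
    rw [show Real.exp (f p) - (1 + f p + 1 / 2 * (f p * f p) + (1 / 6 * (f p * f p * f p) + 1 / 24 * (f p * f p * f p * f p)))
      = Real.exp (f p) - (1 + f p + f p ^ 2 / 2 + f p ^ 3 / 6 + f p ^ 4 / 24) by ring]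
    refine this.trans ?_
    have : 0 ≤ |f p| ^ 5 := by positivity
    nlinarith)
  refine hs'.of_eq (fun p => rfl) ?_ ?_ ?_ ?_ ?_ <;> intro p <;> ring

/-- `e⁻¹ log (1 + e Y)` -/
lemma X5.logdiv (he : Tendsto e l (nhds 0)) (hne : ∀ᶠ p in l, e p ≠ 0) (h : X5 l e f a b c d g) :
    X5 l e (fun p => Real.log (1 + e p * f p) / e p) a (fun p => b p - a p ^ 2 / 2)
      (fun p => c p - a p * b p + a p ^ 3 / 3)
      (fun p => d p - (2 * a p * c p + b p ^ 2) / 2 + a p ^ 2 * b p - a p ^ 4 / 4)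
      (fun p => g p - (a p * d p + b p * c p) + (a p ^ 2 * c p + a p * b p ^ 2) - a p ^ 3 * b p + a p ^ 5 / 5) := by
  have he' : Bd l e := Bd.of_tendsto he
  have hf := h.bd he'
  have h2 := X5.mul he' h h
  have h3 := X5.mul he' h2 h
  have h4 := X5.mul he' h3 h
  have h5 := X5.mul he' h4 h
  have s2 := h2.shift he'
  have s3 := (h3.shift he').shift he'
  have s4 := ((h4.shift he').shift he').shift he'
  have s5 := (((h5.shift he').shift he').shift he').shift he'
  have hs := (h.add (s2.const_mul (-1/2))).add
    (((s3.const_mul (1/3)).add (s4.const_mul (-1/4))).add (s5.const_mul (1/5)))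
  have hs' := hs.of_rem_eq (f' := fun p => Real.log (1 + e p * f p) / e p) (by
    have hz : Tendsto (fun p => e p * f p) l (nhds 0) := by
      have : (fun p => e p * f p) =O[l] e := by
        have := bigO_of_bd (e := e) hf 1
        simpa using this
      exact this.trans_tendsto he
    have hf6 : (fun p => e p ^ 5 * (f p) ^ 6) =O[l] (fun p => e p ^ 5) := bigO_of_bd (hf.pow 6) 5
    refine IsBigO.trans (IsBigO.of_bound 2 ?_) hf6
    have hsm : ∀ᶠ p in l, |e p * f p| ≤ 1/2 := by
      have := hz.abs
      simp only [abs_zero] at this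
      exact this.eventually_le_const (by norm_num)
    filter_upwards [hsm, hne] with p hp hpe
    have hz1 : |-(e p * f p)| < 1 := by rw [abs_neg]; linarith
    have := Real.abs_log_sub_add_sum_range_le hz1 5
    simp only [Finset.sum_range_succ, Finset.sum_range_zero, abs_neg] at this
    set z := e p * f p with hzd
    have hb : |z| ^ (5+1) / (1 - |z|) ≤ 2 * |z| ^ 6 := by
      rw [div_le_iff₀ (by linarith)]
      have h6 : 0 ≤ |z|^6 := by positivity
      change |z| ^ 6 ≤ _
      nlinarith [mul_nonneg h6 (sub_nonneg.mpr hp)]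
    have h3 := this.trans hb
    rw [Real.norm_eq_abs, Real.norm_eq_abs]
    have hep : 0 < |e p| := abs_pos.mpr hpe
    have key : |e p| * |Real.log (1 + z) / e p - (f p + -1 / 2 * (e p * (f p * f p)) +
            (1 / 3 * (e p * (e p * (f p * f p * f p))) +
                -1 / 4 * (e p * (e p * (e p * (f p * f p * f p * f p)))) +
              1 / 5 * (e p * (e p * (e p * (e p * (f p * f p * f p * f p * f p)))))))| ≤ |e p| * (2 * |e p ^ 5 * f p ^ 6|) := by
      rw [← abs_mul]
      calc _ = |0 + (-z) ^ (0 + 1) / (((0:ℕ):ℝ) + 1) + (-z) ^ (1 + 1) / (((1:ℕ):ℝ) + 1) + (-z) ^ (2 + 1) / (((2:ℕ):ℝ) + 1) + (-z) ^ (3 + 1) / (((3:ℕ):ℝ) + 1) +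
            (-z) ^ (4 + 1) / (((4:ℕ):ℝ) + 1) + Real.log (1 - -z)| := by
            congr 1
            rw [mul_sub, mul_div_cancel₀ _ hpe, sub_neg_eq_add, hzd]
            push_cast
            ring
        _ ≤ 2 * |z| ^ 6 := h3
        _ = _ := by
          rw [hzd, abs_mul, abs_mul, abs_pow, abs_pow]; ring
    exact le_of_mul_le_mul_left key hep)
  refine hs'.of_eq (fun p => rfl) ?_ ?_ ?_ ?_ ?_ <;> intro p <;> ring

end X

lemma einv0 : Tendsto (fun x : ℝ => x⁻¹) atTop (nhds 0) := tendsto_inv_atTop_zero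
lemma einvBd : Bd atTop (fun x : ℝ => x⁻¹) := Bd.of_tendsto einv0

def l2 : Filter (ℝ × ℝ) := atTop ×ˢ 𝓟 (Icc (0:ℝ) 2)

lemma l2_fst : Tendsto (fun p : ℝ × ℝ => p.1) l2 atTop := tendsto_fst
lemma l2_e0 : Tendsto (fun p : ℝ × ℝ => p.1⁻¹) l2 (nhds 0) := einv0.comp l2_fst
lemma l2_s : Bd l2 (fun p : ℝ × ℝ => p.2) := by
  refine IsBigO.of_bound 2 ?_
  rw [l2, eventually_prod_principal_iff]
  refine Eventually.of_forall fun x s hs => ?_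
  simp only [Real.norm_eq_abs, abs_one, mul_one]
  rw [abs_of_nonneg hs.1]; exact hs.2

lemma X5.of4 {α : Type*} {l : Filter α} {e f a b c d : α → ℝ} (hne : ∀ᶠ p in l, e p ≠ 0)
    (ha : Bd l a) (hb : Bd l b) (hc : Bd l c) (hd : Bd l d)
    (hr : (fun p => f p - (a p + b p * e p + c p * e p ^ 2 + d p * e p ^ 3)) =O[l] (fun p => e p ^ 4)) :
    ∃ r, X5 l e f a b c d r := by
  refine ⟨fun p => (f p - (a p + b p * e p + c p * e p ^ 2 + d p * e p ^ 3)) * ((e p)^4)⁻¹, ha, hb, hc, hd, ?_, ?_⟩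
  · have := hr.mul (isBigO_refl (fun p => ((e p)^4)⁻¹) l)
    refine this.trans ?_
    refine IsBigO.of_bound 1 ?_
    filter_upwards [hne] with p hp
    rw [mul_inv_cancel₀ (pow_ne_zero _ hp)]
    simp
  · refine (isBigO_zero _ _).congr' (f₁ := fun _ => (0:ℝ)) ?_ EventuallyEq.rfl
    filter_upwards [hne] with p hp
    field_simp
    ring

lemma X5.to4 {α : Type*} {l : Filter α} {e f a b c d g : α → ℝ} (he : Bd l e) (h : X5 l e f a b c d g) :
    (fun p => f p - (a p + b p * e p + c p * e p ^ 2 + d p * e p ^ 3)) =O[l] (fun p => e p ^ 4) := by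
  have h1 : (fun p => e p ^ 5) =O[l] (fun p => e p ^ 4) :=
    (bigO_of_bd (e := e) he 4).congr_left (fun p => by ring)
  exact ((h.rem.trans h1).add (bigO_of_bd (e := e) h.hg 4)).congr_left (fun p => by ring)

lemma X5.pow1 {α : Type*} {l : Filter α} {e h u v w : α → ℝ} (he : Bd l e)
    (hh : X5 l e h (fun _ => 1) (fun _ => 0) u v w) (n : ℕ) :
    ∃ r, X5 l e (fun p => h p ^ n) (fun _ => 1) (fun _ => 0) (fun p => n * u p) (fun p => n * v p) r := by
  induction n with
  | zero =>
    refine ⟨_, (X5.const 1).of_eq ?_ (fun _ => rfl) (fun _ => rfl) ?_ ?_ (fun _ => rfl)⟩ <;> intro p <;> simp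
  | succ n ih =>
    obtain ⟨r, hr⟩ := ih
    refine ⟨_, (X5.mul he hr hh).of_eq ?_ ?_ ?_ ?_ ?_ (fun _ => rfl)⟩ <;> intro p <;> push_cast <;> ring

lemma int_poly (N : ℕ) (c : ℕ → ℝ) (h : ℝ) :
    ∫ s in (0:ℝ)..h, ∑ j ∈ Finset.range N, c j * s ^ j = ∑ j ∈ Finset.range N, c j * (h ^ (j+1) / (j+1)) := by
  rw [intervalIntegral.integral_finsetSum]
  · refine Finset.sum_congr rfl fun j _ => ?_
    rw [intervalIntegral.integral_const_mul, integral_pow]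
    simp
  · intro j _
    exact (by fun_prop : Continuous fun s : ℝ => c j * s ^ j).intervalIntegrable _ _

lemma int_X5 (N : ℕ) (A0 A1 A2 A3 B3 : ℕ → ℝ) (mu : ℝ → ℝ) (hmu : Bd atTop mu) (f : ℝ × ℝ → ℝ) (r4 : ℝ × ℝ → ℝ)
    (hX : X5 l2 (fun p => p.1⁻¹) f (fun p => ∑ j ∈ Finset.range N, A0 j * p.2 ^ j)
      (fun p => ∑ j ∈ Finset.range N, A1 j * p.2 ^ j) (fun p => ∑ j ∈ Finset.range N, A2 j * p.2 ^ j)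
      (fun p => ∑ j ∈ Finset.range N, (A3 j + B3 j * mu p.1) * p.2 ^ j) r4)
    (hcont : ∀ᶠ x in atTop, ContinuousOn (fun s => f (x, s)) (Icc 0 2))
    (h u v w : ℝ → ℝ) (hh : X5 atTop (fun x => x⁻¹) h (fun _ => 1) (fun _ => 0) u v w) :
    ∃ r, X5 atTop (fun x => x⁻¹) (fun x => ∫ s in (0:ℝ)..h x, f (x, s))
      (fun _ => ∑ j ∈ Finset.range N, A0 j / (j+1)) (fun _ => ∑ j ∈ Finset.range N, A1 j / (j+1))
      (fun x => ∑ j ∈ Finset.range N, A2 j / (j+1) + u x * ∑ j ∈ Finset.range N, A0 j)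
      (fun x => ∑ j ∈ Finset.range N, (A3 j + B3 j * mu x) / (j+1) + v x * ∑ j ∈ Finset.range N, A0 j
        + u x * ∑ j ∈ Finset.range N, A1 j) r := by
  have hlim : Tendsto h atTop (nhds 1) := by
    have := (hh.tendsto_sub einv0).add_const 1
    simpa using this
  have hh0 : ∀ᶠ x in atTop, 0 ≤ h x := hlim.eventually_const_le (by norm_num)
  have hh2 : ∀ᶠ x in atTop, h x ≤ 2 := hlim.eventually_le_const (by norm_num)
  have hne : ∀ᶠ x : ℝ in atTop, x⁻¹ ≠ 0 := by
    filter_upwards [eventually_gt_atTop 0] with x hx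
    positivity
  have h4 := hX.to4 (Bd.of_tendsto l2_e0)
  obtain ⟨C, hC⟩ := h4.bound
  rw [l2, eventually_prod_principal_iff] at hC
  -- the polynomial
  set cc : ℝ → ℕ → ℝ := fun x j => A0 j + A1 j * x⁻¹ + A2 j * x⁻¹ ^ 2 + (A3 j + B3 j * mu x) * x⁻¹ ^ 3 with hcc
  have hdiff : (fun x => (∫ s in (0:ℝ)..h x, f (x, s)) - ∑ j ∈ Finset.range N, cc x j * (h x ^ (j+1) / (j+1)))
      =O[atTop] (fun x => x⁻¹ ^ 4) := by
    refine IsBigO.of_bound (C * 2) ?_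
    filter_upwards [hh0, hh2, hC, hcont] with x h0 h2 hCx hcx
    rw [← int_poly]
    have hsub : uIcc 0 (h x) ⊆ Icc 0 2 := by
      rw [uIcc_of_le h0]; exact Icc_subset_Icc le_rfl h2
    rw [← intervalIntegral.integral_sub]
    · have hb : ∀ s ∈ uIoc 0 (h x), ‖f (x, s) - ∑ j ∈ Finset.range N, cc x j * s ^ j‖ ≤ C * ‖x⁻¹ ^ 4‖ := by
        intro s hs
        have hs' : s ∈ Icc (0:ℝ) 2 := hsub (uIoc_subset_uIcc hs)
        have := hCx s hs'
        convert this using 3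
        simp only [hcc, add_mul, Finset.sum_add_distrib, Finset.sum_mul]
        simp only [mul_right_comm]
      have := intervalIntegral.norm_integral_le_of_norm_le_const hb
      refine this.trans ?_
      rw [sub_zero, abs_of_nonneg h0]
      have h5 : 0 ≤ C * ‖x⁻¹ ^ 4‖ := (norm_nonneg _).trans (hCx 0 ⟨le_rfl, by norm_num⟩)
      nlinarith
    · exact (hcx.mono hsub).intervalIntegrable
    · exact (by fun_prop : Continuous fun s : ℝ => ∑ j ∈ Finset.range N, cc x j * s ^ j).intervalIntegrable _ _
  -- expansion of the sum
  have hpw := fun n : ℕ => X5.pow1 einvBd hh n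
  choose rr hrr using hpw
  have hterm : ∀ j ∈ Finset.range N, X5 atTop (fun x : ℝ => x⁻¹) (fun x => cc x j * (h x ^ (j+1) / (j+1)))
      (fun _ => A0 j / (j+1)) (fun _ => A1 j / (j+1)) (fun x => A2 j / (j+1) + u x * A0 j)
      (fun x => (A3 j + B3 j * mu x) / (j+1) + v x * A0 j + u x * A1 j) 
      (fun x => 1 * (1 / ((j:ℝ)+1) * rr (j+1) x) * A0 j + A1 j * v x + A2 j * u x) := by
    intro j _
    have hc : X5 atTop (fun x : ℝ => x⁻¹) (fun x => cc x j) (fun _ => A0 j) (fun _ => A1 j) (fun _ => A2 j)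
        (fun x => A3 j + B3 j * mu x) (fun _ => 0) := by
      refine ⟨Bd.const _, Bd.const _, Bd.const _, (Bd.const _).add ((Bd.const _).mul hmu), Bd.const _, ?_⟩
      refine (isBigO_zero _ _).congr_left (f₁ := fun _ => (0:ℝ)) (fun x => ?_)
      simp only [hcc]; ring
    have hj : ((j:ℝ) + 1) ≠ 0 := by positivity
    refine (X5.mul einvBd hc ((hrr (j+1)).const_mul (1 / ((j:ℝ)+1)))).of_eq ?_ ?_ ?_ ?_ ?_ ?_ <;> intro x <;>
      push_cast <;> field_simp <;> ring
  have hsum := X5.sum (Finset.range N) hterm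
  have hs4 := (hdiff.add (hsum.to4 einvBd))
  refine X5.of4 hne (Bd.const _) (Bd.const _) ?_ ?_ ?_
  · exact (Bd.const _).add (hh.hc.mul (Bd.const _))
  · refine ((Bd.sum _ fun j _ => ?_).add (hh.hd.mul (Bd.const _))).add (hh.hc.mul (Bd.const _))
    exact ((Bd.const _).add ((Bd.const _).mul hmu)).div_const _
  · refine hs4.congr_left fun x => ?_
    simp only [Finset.sum_add_distrib, Finset.mul_sum]
    ring

/-- `(1 + s/a)^x e^{-s}` -/
noncomputable def Ek (x a s : ℝ) : ℝ := Real.exp (x * Real.log (1 + s / a) - s)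

section
variable {mu a : ℝ → ℝ} (hmu : Bd atTop mu)
  (ha : ∀ᶠ x in atTop, a x = x - 1/3 + 8/405 * x⁻¹ + mu x * x⁻¹ ^ 2)
include hmu ha

lemma X5q : X5 atTop (fun x => x⁻¹) (fun x => x / a x) (fun _ => 1) (fun _ => 1/3) (fun _ => 37/405)
    (fun x => 29/1215 - mu x) (fun x => 1009/164025 - 2/3 * mu x) := by
  have h1 : X5 atTop (fun x : ℝ => x⁻¹) (fun x => 1 - 1/3 * x⁻¹ + 8/405 * x⁻¹ ^ 2 + mu x * x⁻¹ ^ 3) (fun _ => 1)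
      (fun _ => -1/3) (fun _ => 8/405) (fun x => mu x) (fun _ => 0) := by
    refine ⟨Bd.const _, Bd.const _, Bd.const _, hmu, Bd.const _, ?_⟩
    refine (isBigO_zero _ _).congr_left (f₁ := fun _ => (0:ℝ)) (fun x => ?_)
    ring
  have h2 := h1.inv einv0
  have h3 := h2.congr_f (f' := fun x => x / a x) (by
    filter_upwards [ha, eventually_gt_atTop 0] with x hx hx0
    rw [hx]
    rw [show x - 1/3 + 8/405 * x⁻¹ + mu x * x⁻¹ ^ 2 = x * (1 - 1/3 * x⁻¹ + 8/405 * x⁻¹ ^ 2 + mu x * x⁻¹ ^ 3) by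
      field_simp]
    rw [div_mul_eq_div_div, div_self hx0.ne']
    exact (one_div _).symm)
  refine h3.of_eq ?_ ?_ ?_ ?_ ?_ ?_ <;> intro x <;> ring

lemma X5Lam : X5 l2 (fun p => p.1⁻¹) (fun p => p.1 * Real.log (1 + p.2 / a p.1)) (fun p => p.2)
    (fun p => (1/3) * p.2 + (-1/2) * p.2^2)
    (fun p => (37/405) * p.2 + (-1/3) * p.2^2 + (1/3) * p.2^3)
    (fun p => (29/1215) * p.2 + (-1) * p.2 * mu p.1 + (-119/810) * p.2^2 + (1/3) * p.2^3 + (-1/4) * p.2^4)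
    (fun p => (1009/164025) * p.2 + (-2/3) * p.2 * mu p.1 + (-22/405) * p.2^2 + 1 * p.2^2 * mu p.1 + (82/405) * p.2^3 + (-1/3) * p.2^4 + (1/5) * p.2^5) := by
  have hq := (X5q hmu ha).comp l2_fst
  have hY := X5.mul (Bd.of_tendsto l2_e0) (X5.of_bd (e := fun p : ℝ × ℝ => p.1⁻¹) l2_s) hq
  have hpos : ∀ᶠ p : ℝ × ℝ in l2, 0 < p.1 := l2_fst.eventually (eventually_gt_atTop 0)
  have hL := hY.logdiv l2_e0 (by
    filter_upwards [hpos] with p hp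
    positivity)
  have hL' := hL.congr_f (f' := fun p => p.1 * Real.log (1 + p.2 / a p.1)) (by
    filter_upwards [hpos] with p hp
    rw [show p.1⁻¹ * (p.2 * (p.1 / a p.1)) = p.2 / a p.1 by field_simp]
    rw [div_inv_eq_mul, mul_comm])
  refine hL'.of_eq ?_ ?_ ?_ ?_ ?_ ?_ <;> intro x <;> ring

lemma X5E : X5 l2 (fun p => p.1⁻¹) (fun p => Ek p.1 (a p.1) p.2) (fun _ => 1)
    (fun p => (1/3) * p.2 + (-1/2) * p.2^2)
    (fun p => (37/405) * p.2 + (-5/18) * p.2^2 + (1/6) * p.2^3 + (1/8) * p.2^4)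
    (fun p => (29/1215) * p.2 + (-1) * p.2 * mu p.1 + (-283/2430) * p.2^2 + (74/405) * p.2^3 + (-1/8) * p.2^5 + (-1/48) * p.2^6)
    (fun p => (1009/164025) * p.2 + (-2/3) * p.2 * mu p.1 + (-13841/328050) * p.2^2 + (2/3) * p.2^2 * mu p.1 + (847/7290) * p.2^3 + (1/2) * p.2^3 * mu p.1 + (-311/3240) * p.2^4 + (-17/216) * p.2^5 + (13/144) * p.2^6 + (5/144) * p.2^7 + (1/384) * p.2^8) := by
  have hL := (X5Lam hmu ha).add (X5.of_bd l2_s.neg)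
  have hL2 := hL.of_eq (a' := fun _ => 0) (fun _ => rfl) (fun p => by ring) (fun _ => rfl) (fun _ => rfl) (fun _ => rfl) (fun _ => rfl)
  refine (hL2.exp l2_e0).of_eq ?_ ?_ ?_ ?_ ?_ ?_ <;> intro p
  · simp only [Ek]; congr 1
  all_goals ring

lemma a_tendsto : Tendsto a atTop atTop := by
  have hl : Tendsto (fun x : ℝ => 8/405 * x⁻¹ + mu x * x⁻¹ ^ 2) atTop (nhds 0) := by
    have h1 := einv0.const_mul (8/405)
    have h2 : Tendsto (fun x : ℝ => mu x * x⁻¹ ^ 2) atTop (nhds 0) := by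
      have : (fun x : ℝ => x⁻¹^2 * mu x) =O[atTop] (fun x : ℝ => x⁻¹^2) := bigO_of_bd hmu 2
      have h3 : Tendsto (fun x : ℝ => x⁻¹ ^ 2) atTop (nhds 0) := by simpa using einv0.pow 2
      exact (this.trans_tendsto h3).congr (fun x => by ring)
    simpa using h1.add h2
  have hx : Tendsto (fun x : ℝ => x - 1/3) atTop atTop := tendsto_atTop_add_const_right _ _ tendsto_id
  refine (hx.atTop_add hl).congr' ?_
  filter_upwards [ha] with x hx
  rw [hx]; ring

lemma Ek_cont : ∀ᶠ x in atTop, ContinuousOn (fun s => Ek x (a x) s) (Icc 0 2) := by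
  filter_upwards [(a_tendsto hmu ha).eventually_gt_atTop 0] with x hx
  unfold Ek
  have : ∀ s ∈ Icc (0:ℝ) 2, 1 + s / a x ≠ 0 := by
    intro s hs
    have := hs.1
    positivity
  fun_prop (disch := assumption)

lemma log_cont : ∀ᶠ x in atTop, ContinuousOn (fun s => Real.log (1 + s / a x)) (Icc 0 2) := by
  filter_upwards [(a_tendsto hmu ha).eventually_gt_atTop 0] with x hx
  have : ∀ s ∈ Icc (0:ℝ) 2, 1 + s / a x ≠ 0 := by
    intro s hs
    have := hs.1
    positivity
  fun_prop (disch := assumption)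

lemma X5I {h u v w : ℝ → ℝ} (hh : X5 atTop (fun x => x⁻¹) h (fun _ => 1) (fun _ => 0) u v w) :
    ∃ r, X5 atTop (fun x => x⁻¹) (fun x => ∫ s in (0:ℝ)..h x, Ek x (a x) s) (fun _ => 1) (fun _ => 0)
      (fun x => 8/405 + u x) (fun x => -44/25515 - mu x / 2 + v x + (-1/6) * (u x + 8/405)) r := by
  have hE := X5E hmu ha
  obtain ⟨r, hr⟩ := int_X5 7 (fun j => match j with | 0 => 1 | _ => 0)
    (fun j => match j with | 1 => 1/3 | 2 => -1/2 | _ => 0)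
    (fun j => match j with | 1 => 37/405 | 2 => -5/18 | 3 => 1/6 | 4 => 1/8 | _ => 0)
    (fun j => match j with | 1 => 29/1215 | 2 => -283/2430 | 3 => 74/405 | 5 => -1/8 | 6 => -1/48 | _ => 0)
    (fun j => match j with | 1 => -1 | _ => 0) mu hmu (fun p => Ek p.1 (a p.1) p.2) _
    (hE.of_eq (fun _ => rfl) (by intro p; simp [Finset.sum_range_succ]) (by intro p; simp [Finset.sum_range_succ])
      (by intro p; simp [Finset.sum_range_succ]) (by intro p; simp [Finset.sum_range_succ]; ring) (fun _ => rfl))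
    (Ek_cont hmu ha) h u v w hh
  refine ⟨r, hr.of_eq (fun _ => rfl) ?_ ?_ ?_ ?_ (fun _ => rfl)⟩ <;> intro x <;>
    simp only [Finset.sum_range_succ, Finset.sum_range_zero] <;> push_cast <;> ring

lemma X5J {h v w : ℝ → ℝ} (hh : X5 atTop (fun x => x⁻¹) h (fun _ => 1) (fun _ => 0) (fun _ => -8/405) v w) :
    ∃ r, X5 atTop (fun x => x⁻¹) (fun x => ∫ s in (0:ℝ)..h x, Ek x (a x) s * (x * Real.log (1 + s / a x)))
      (fun _ => 1/2) (fun _ => -1/72)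
      (fun _ => 331/19440) (fun x => -5701/1814400 - mu x / 3 + (v x - 44/25515 - mu x / 2)) r := by
  have hE := X5.mul (Bd.of_tendsto l2_e0) (X5E hmu ha) (X5Lam hmu ha)
  obtain ⟨r, hr⟩ := int_X5 8 (fun j => match j with | 1 => 1 | _ => 0)
    (fun j => match j with | 1 => 1/3 | 2 => -1/6 | 3 => -1/2 | _ => 0)
    (fun j => match j with | 1 => 37/405 | 2 => -53/405 | 3 => -5/18 | 4 => 5/12 | 5 => 1/8 | _ => 0)
    (fun j => match j with | 1 => 29/1215 | 2 => -151/2430 | 3 => -19/243 | 4 => 164/405 | 5 => -5/24 | 6 => -3/16 | 7 => -1/48 | _ => 0)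
    (fun j => match j with | 1 => -1 | 2 => -1 | _ => 0) mu hmu
    (fun p => Ek p.1 (a p.1) p.2 * (p.1 * Real.log (1 + p.2 / a p.1))) _
    (hE.of_eq (fun _ => rfl) (by intro p; simp [Finset.sum_range_succ]) (by intro p; simp [Finset.sum_range_succ]; ring)
      (by intro p; simp [Finset.sum_range_succ]; ring) (by intro p; simp [Finset.sum_range_succ]; ring) (fun _ => rfl))
    (by
      filter_upwards [Ek_cont hmu ha, log_cont hmu ha] with x h1 h2
      exact h1.mul (continuousOn_const.mul h2)) h _ v w hh
  refine ⟨r, hr.of_eq (fun _ => rfl) ?_ ?_ ?_ ?_ (fun _ => rfl)⟩ <;> intro x <;>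
    simp only [Finset.sum_range_succ, Finset.sum_range_zero] <;> push_cast <;> ring

end

lemma X5.lim3 {f d g : ℝ → ℝ} {D : ℝ} (h : X5 atTop (fun x => x⁻¹) f (fun _ => 1) (fun _ => 0) (fun _ => 0) d g)
    (hd : Tendsto d atTop (nhds D)) : Tendsto (fun x => x ^ 3 * (f x - 1)) atTop (nhds D) := by
  have h4 := h.to4 einvBd
  have h5 := ((isBigO_refl (fun x : ℝ => x ^ 3) atTop).mul h4)
  have h6 : Tendsto (fun x : ℝ => x ^ 3 * x⁻¹ ^ 4) atTop (nhds 0) := by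
    refine einv0.congr' ?_
    filter_upwards [eventually_gt_atTop 0] with x hx
    field_simp
  have h7 := (h5.trans_tendsto h6).add hd
  rw [zero_add] at h7
  refine h7.congr' ?_
  filter_upwards [eventually_gt_atTop 0] with x hx
  field_simp
  ring

lemma X5.lim4 {f g : ℝ → ℝ} {D : ℝ} (h : X5 atTop (fun x => x⁻¹) f (fun _ => 0) (fun _ => 0) (fun _ => 0) (fun _ => 0) g)
    (hd : Tendsto g atTop (nhds D)) : Tendsto (fun x => x ^ 4 * f x) atTop (nhds D) := by
  have h4 := h.rem
  have h5 := ((isBigO_refl (fun x : ℝ => x ^ 4) atTop).mul h4)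
  have h6 : Tendsto (fun x : ℝ => x ^ 4 * x⁻¹ ^ 5) atTop (nhds 0) := by
    refine einv0.congr' ?_
    filter_upwards [eventually_gt_atTop 0] with x hx
    field_simp
  have h7 := (h5.trans_tendsto h6).add hd
  rw [zero_add] at h7
  refine h7.congr' ?_
  filter_upwards [eventually_gt_atTop 0] with x hx
  field_simp
  ring

/-- expansion of `1/(x+1)` -/
lemma X5succ : X5 atTop (fun x : ℝ => x⁻¹) (fun x => (x+1)⁻¹) (fun _ => 0) (fun _ => 1) (fun _ => -1) (fun _ => 1)
    (fun _ => -1) := by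
  have h1 : X5 atTop (fun x : ℝ => x⁻¹) (fun x => 1 + x⁻¹) (fun _ => 1) (fun _ => 1) (fun _ => 0) (fun _ => 0)
    (fun _ => 0) := by
    refine ((X5.const 1).add X5.var).of_eq ?_ ?_ ?_ ?_ ?_ ?_ <;> intro x <;> ring
  have h2 := ((h1.inv einv0).shift einvBd).congr_f (f' := fun x => (x+1)⁻¹) (by
    filter_upwards [eventually_gt_atTop 0] with x hx
    rw [← mul_inv]
    congr 1
    field_simp)
  refine h2.of_eq ?_ ?_ ?_ ?_ ?_ ?_ <;> intro x <;> norm_num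

noncomputable def ac (c x : ℝ) : ℝ := x - 1/3 + 8/405 * x⁻¹ + c * x⁻¹ ^ 2

lemma X5h1 (c : ℝ) : ∃ w, X5 atTop (fun x : ℝ => x⁻¹) (fun x => ac c (x+1) - ac c x) (fun _ => 1) (fun _ => 0)
    (fun _ => -8/405) (fun _ => 8/405 - 2 * c) w := by
  have h2 := X5.mul einvBd X5succ X5succ
  have hv := X5.var (l := atTop) (e := fun x : ℝ => x⁻¹)
  have hv2 := X5.mul einvBd hv hv
  have := ((X5.const (l := atTop) (e := fun x : ℝ => x⁻¹) 1).add
    ((X5succ.add (hv.const_mul (-1))).const_mul (8/405))).add ((h2.add (hv2.const_mul (-1))).const_mul c)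
  refine ⟨_, this.of_eq ?_ ?_ ?_ ?_ ?_ (fun _ => rfl)⟩ <;> intro x <;> (try simp only [ac]) <;> ring

lemma I_lim (c : ℝ) : Tendsto (fun x => x ^ 3 * ((∫ s in (0:ℝ)..(ac c (x+1) - ac c x), Ek x (ac c x) s) - 1)) atTop
    (nhds (92/5103 - 5/2 * c)) := by
  obtain ⟨w, hw⟩ := X5h1 c
  obtain ⟨r, hr⟩ := X5I (mu := fun _ => c) (a := ac c) (Bd.const c) (Eventually.of_forall fun x => rfl) hw
  have h2 := hr.of_eq (c' := fun _ => 0) (d' := fun _ => 92/5103 - 5/2 * c) (fun _ => rfl) (fun _ => rfl) (fun _ => rfl) (fun _ => by norm_num)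
    (fun _ => by ring) (fun _ => rfl)
  exact h2.lim3 tendsto_const_nhds

section
variable {mu m : ℝ → ℝ} {M : ℝ} (hM : Tendsto mu atTop (nhds M))
  (ha : ∀ᶠ x in atTop, m x = x - 1/3 + 8/405 * x⁻¹ + mu x * x⁻¹ ^ 2)
  (hI : ∀ᶠ x in atTop, ∫ s in (0:ℝ)..(m (x+1) - m x), Ek x (m x) s = 1)
include hM ha

lemma d_lim : Tendsto (fun x => m (x+1) - m x) atTop (nhds 1) := by
  have ht : Tendsto (fun x : ℝ => x + 1) atTop atTop := tendsto_atTop_add_const_right _ _ tendsto_id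
  have hk : Tendsto (fun x : ℝ => 8/405 * x⁻¹ + mu x * x⁻¹ ^ 2) atTop (nhds 0) := by
    have := (einv0.const_mul (8/405)).add (hM.mul (einv0.pow 2))
    simpa using this
  have h2 := ((hk.comp ht).sub hk).const_add 1
  simp only [sub_zero, add_zero] at h2
  refine h2.congr' ?_
  filter_upwards [ha, ht.eventually ha] with x h1 h2
  rw [h1, h2]
  simp only [Function.comp]
  ring

include hI

lemma X5d : ∃ w, X5 atTop (fun x : ℝ => x⁻¹) (fun x => m (x+1) - m x) (fun _ => 1) (fun _ => 0)
    (fun _ => -8/405) (fun x => 44/25515 + mu x / 2) w := by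
  have hmu : Bd atTop mu := Bd.of_tendsto hM
  have hne : ∀ᶠ x : ℝ in atTop, x⁻¹ ≠ 0 := by
    filter_upwards [eventually_gt_atTop 0] with x hx
    positivity
  have hv : Bd atTop (fun x => 44/25515 + mu x / 2) := (Bd.const _).add (hmu.div_const 2)
  set d0 : ℝ → ℝ := fun x => 1 + (-8/405) * x⁻¹ ^ 2 + (44/25515 + mu x / 2) * x⁻¹ ^ 3 with hd0
  have hX0 : X5 atTop (fun x : ℝ => x⁻¹) d0 (fun _ => 1) (fun _ => 0)
    (fun _ => -8/405) (fun x => 44/25515 + mu x / 2) (fun _ => 0) := by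
    refine ⟨Bd.const _, Bd.const _, Bd.const _, hv, Bd.const _, ?_⟩
    refine (isBigO_zero _ _).congr_left (f₁ := fun _ => (0:ℝ)) (fun x => ?_)
    simp only [hd0]; ring
  obtain ⟨r, hr⟩ := X5I hmu ha hX0
  have hr' := hr.to4 einvBd
  have hlim0 : Tendsto d0 atTop (nhds 1) := by
    have := (hX0.tendsto_sub einv0).add_const 1
    simpa using this
  have hlim := d_lim hM ha
  have hE := X5E hmu ha
  have hE1 : Tendsto (fun p : ℝ × ℝ => Ek p.1 (m p.1) p.2) l2 (nhds 1) := by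
    have := (hE.tendsto_sub l2_e0).add_const 1
    simpa using this
  have hE2 : ∀ᶠ p in l2, (1/2 : ℝ) ≤ Ek p.1 (m p.1) p.2 := hE1.eventually_const_le (by norm_num)
  rw [l2, eventually_prod_principal_iff] at hE2
  have hcmp : (fun x => (m (x+1) - m x) - d0 x) =O[atTop] (fun x : ℝ => x⁻¹ ^ 4) := by
    refine IsBigO.trans (IsBigO.of_bound 2 ?_) hr'
    filter_upwards [hI, hE2, Ek_cont hmu ha, hlim0.eventually_const_le (show (0:ℝ) < 1 by norm_num),
      hlim0.eventually_le_const (show (1:ℝ) < 2 by norm_num), hlim.eventually_const_le (show (0:ℝ) < 1 by norm_num),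
      hlim.eventually_le_const (show (1:ℝ) < 2 by norm_num)] with x hx1 hx2 hx3 h01 h02 h1 h2
    set D := m (x+1) - m x
    have hInt : ∀ u ∈ Icc (0:ℝ) 2, ∀ v ∈ Icc (0:ℝ) 2, IntervalIntegrable (fun s => Ek x (m x) s) volume u v := by
      intro u hu v hv
      exact (hx3.mono (uIcc_subset_Icc hu hv)).intervalIntegrable
    have key : ∀ u ∈ Icc (0:ℝ) 2, ∀ v ∈ Icc (0:ℝ) 2, u ≤ v → (v - u) / 2 ≤
        (∫ s in (0:ℝ)..v, Ek x (m x) s) - ∫ s in (0:ℝ)..u, Ek x (m x) s := by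
      intro u hu v hv huv
      have h0 : (0:ℝ) ∈ Icc (0:ℝ) 2 := ⟨le_rfl, by norm_num⟩
      rw [intervalIntegral.integral_interval_sub_left (hInt 0 h0 v hv) (hInt 0 h0 u hu)]
      have : ∫ s in u..v, (1/2:ℝ) = (v - u) / 2 := by
        rw [intervalIntegral.integral_const, smul_eq_mul]; ring
      rw [← this]
      refine intervalIntegral.integral_mono_on huv (by simp) (hInt u hu v hv) ?_
      intro s hs
      exact hx2 s ⟨hu.1.trans hs.1, hs.2.trans hv.2⟩
    have e1 : (1:ℝ) + 0 * x⁻¹ + (8/405 + -8/405) * x⁻¹ ^ 2 + (-44/25515 - mu x / 2 + (44/25515 + mu x / 2) + (-1/6) * (-8/405 + 8/405)) * x⁻¹ ^ 3 = 1 := by ring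
    rw [Real.norm_eq_abs, Real.norm_eq_abs, e1]
    rcases le_total D (d0 x) with hle | hle
    · have := key D ⟨h1, h2⟩ (d0 x) ⟨h01, h02⟩ hle
      rw [hx1] at this
      rw [abs_of_nonpos (by linarith), abs_of_nonneg (by linarith)]
      linarith
    · have := key (d0 x) ⟨h01, h02⟩ D ⟨h1, h2⟩ hle
      rw [hx1] at this
      rw [abs_of_nonneg (by linarith), abs_of_nonpos (by linarith)]
      linarith
  refine X5.of4 hne (Bd.const _) (Bd.const _) (Bd.const _) hv ?_
  refine hcmp.congr_left fun x => ?_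
  simp only [hd0]; ring

lemma X5Ed : X5 atTop (fun x : ℝ => x⁻¹) (fun x => Ek x (m x) (m (x+1) - m x)) (fun _ => 1) (fun _ => -1/6)
    (fun _ => 341/3240) (fun x => -827/19440 - mu x) (fun x => 626833/29393280 + mu x / 6) := by
  have hmu : Bd atTop mu := Bd.of_tendsto hM
  have hlim := d_lim hM ha
  obtain ⟨w, hw⟩ := X5d hM ha hI
  have ht : Tendsto (fun x : ℝ => (x, m (x+1) - m x)) atTop l2 := by
    refine tendsto_id.prodMk (tendsto_principal.mpr ?_)
    filter_upwards [hlim.eventually_const_le (show (0:ℝ) < 1 by norm_num),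
      hlim.eventually_le_const (show (1:ℝ) < 2 by norm_num)] with x h1 h2
    exact ⟨h1, h2⟩
  have hE := (X5E hmu ha).comp ht
  simp only at hE
  have hpw := fun n : ℕ => X5.pow1 einvBd hw n
  choose rr hp using hpw
  have hm := X5.of_bd (e := fun x : ℝ => x⁻¹) hmu
  have c1 := ((hp 1).const_mul (1/3)).add ((hp 2).const_mul (-1/2))
  have c2 := (((hp 1).const_mul (37/405)).add ((hp 2).const_mul (-5/18))).add
    (((hp 3).const_mul (1/6)).add ((hp 4).const_mul (1/8)))
  have c3 := ((((hp 1).const_mul (29/1215)).add ((hp 2).const_mul (-283/2430))).add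
    (((hp 3).const_mul (74/405)).add ((hp 5).const_mul (-1/8)))).add (((hp 6).const_mul (-1/48)).add
      ((X5.mul einvBd hm (hp 1)).const_mul (-1)))
  have c4 := (((((hp 1).const_mul (1009/164025)).add ((hp 2).const_mul (-13841/328050))).add
    (((hp 3).const_mul (847/7290)).add ((hp 4).const_mul (-311/3240)))).add (((hp 5).const_mul (-17/216)).add
      ((hp 6).const_mul (13/144)))).add ((((hp 7).const_mul (5/144)).add ((hp 8).const_mul (1/384))).add
      (X5.mul einvBd hm ((((hp 1).const_mul (-2/3)).add ((hp 2).const_mul (2/3))).add ((hp 3).const_mul (1/2)))))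
  have s1 := c1.shift einvBd
  have s2 := (c2.shift einvBd).shift einvBd
  have s3 := ((c3.shift einvBd).shift einvBd).shift einvBd
  have s4 := (((c4.shift einvBd).shift einvBd).shift einvBd).shift einvBd
  have hs := ((X5.const (l := atTop) (e := fun x : ℝ => x⁻¹) 1).add s1).add ((s2.add s3).add s4)
  have hf := hs.of_rem_eq (f' := fun x => Ek x (m x) (m (x+1) - m x)) (by
    refine hE.rem.congr_left fun x => ?_
    ring)
  refine hf.of_eq (fun _ => rfl) ?_ ?_ ?_ ?_ ?_ <;> intro x <;> push_cast <;> ring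

lemma S_lim (c : ℝ) : Tendsto (fun x => x ^ 4 * ((1 - 8/405 * (x+1)⁻¹ ^ 2 - c * (x+1)⁻¹ ^ 3) * Ek x (m x) (m (x+1) - m x)
    - (x / m x) * (1 - 8/405 * x⁻¹ ^ 2 - c * x⁻¹ ^ 3)
    + ∫ s in (0:ℝ)..(m (x+1) - m x), Ek x (m x) s * Real.log (1 + s / m x))) atTop
    (nhds (-92/1701 + 7/2 * c + M / 2)) := by
  have hmu : Bd atTop mu := Bd.of_tendsto hM
  obtain ⟨w, hw⟩ := X5d hM ha hI
  obtain ⟨r, hJ⟩ := X5J hmu ha hw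
  have hE := X5Ed hM ha hI
  have hq := X5q hmu ha
  have hv := X5.var (l := atTop) (e := fun x : ℝ => x⁻¹)
  have hv2 := X5.mul einvBd hv hv
  have hv3 := X5.mul einvBd hv2 hv
  have hs2 := X5.mul einvBd X5succ X5succ
  have hs3 := X5.mul einvBd hs2 X5succ
  have h1 := X5.const (l := atTop) (e := fun x : ℝ => x⁻¹) 1
  have hb := (h1.add (hv2.const_mul (-8/405))).add (hv3.const_mul (-c))
  have hb1 := (h1.add (hs2.const_mul (-8/405))).add (hs3.const_mul (-c))
  have hS := ((X5.mul einvBd hb1 hE).add ((X5.mul einvBd hq hb).const_mul (-1))).add (hJ.shift einvBd)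
  have hS2 := hS.congr_f (f' := fun x => ((1 - 8/405 * (x+1)⁻¹ ^ 2 - c * (x+1)⁻¹ ^ 3) * Ek x (m x) (m (x+1) - m x)
    - (x / m x) * (1 - 8/405 * x⁻¹ ^ 2 - c * x⁻¹ ^ 3)
    + ∫ s in (0:ℝ)..(m (x+1) - m x), Ek x (m x) s * Real.log (1 + s / m x))) (by
    filter_upwards [eventually_gt_atTop 0] with x hx
    have : x⁻¹ * ∫ s in (0:ℝ)..(m (x+1) - m x), Ek x (m x) s * (x * Real.log (1 + s / m x)) =
        ∫ s in (0:ℝ)..(m (x+1) - m x), Ek x (m x) s * Real.log (1 + s / m x) := by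
      rw [← intervalIntegral.integral_const_mul]
      congr 1
      funext s
      field_simp
    rw [this]
    ring)
  have hS3 := hS2.of_eq (a' := fun _ => 0) (b' := fun _ => 0) (c' := fun _ => 0) (d' := fun _ => 0)
    (g' := fun x => -92/1701 + 7/2 * c + mu x / 2) (fun _ => rfl) (fun x => by ring) (fun x => by ring)
    (fun x => by ring) (fun x => by ring) (fun x => by ring)
  exact hS3.lim4 ((hM.div_const 2).const_add _)
end

noncomputable def F (x a : ℝ) : ℝ := ∫ t in Ioc (0:ℝ) a, Real.exp (-t) * t ^ (x - 1)

lemma f_int {x : ℝ} (hx : 0 < x) : IntegrableOn (fun t : ℝ => Real.exp (-t) * t ^ (x - 1)) (Ioi 0) :=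
  Real.GammaIntegral_convergent hx

lemma f_intc {x : ℝ} (hx : 0 < x) (a : ℝ) : IntegrableOn (fun t : ℝ => Real.exp (-t) * t ^ (x - 1)) (Ioc 0 a) :=
  (f_int hx).mono_set Ioc_subset_Ioi_self

lemma F_succ {x a : ℝ} (hx : 0 < x) (ha : 0 < a) : F (x+1) a = x * F x a - a ^ x * Real.exp (-a) := by
  have h1 : ∫ t in (0:ℝ)..a, (Real.exp (-t) * (x * t ^ (x-1)) - Real.exp (-t) * t ^ (x + 1 - 1)) =
      Real.exp (-a) * a ^ x - Real.exp (-0) * (0:ℝ) ^ x := by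
    apply intervalIntegral.integral_eq_sub_of_hasDerivAt_of_le (f := fun t => Real.exp (-t) * t ^ x) ha.le
    · apply ContinuousOn.mul (by fun_prop)
      exact fun t _ => (Real.continuousAt_rpow_const _ _ (Or.inr hx.le)).continuousWithinAt
    · intro t ht
      have h2 := ((hasDerivAt_id t).neg.exp).mul (Real.hasDerivAt_rpow_const (x := t) (p := x) (Or.inl ht.1.ne'))
      refine h2.congr_deriv ?_
      simp only [id, add_sub_cancel_right, Pi.neg_apply]
      ring
    · rw [intervalIntegrable_iff_integrableOn_Ioc_of_le ha.le]
      refine Integrable.sub ?_ (f_intc (by linarith) a)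
      refine ((f_intc hx a).const_mul x).congr (Eventually.of_forall fun t => ?_)
      simp only
      ring
  rw [intervalIntegral.integral_of_le ha.le, integral_sub, Real.zero_rpow hx.ne'] at h1
  · unfold F
    have h3 : ∫ t in Ioc 0 a, Real.exp (-t) * (x * t ^ (x-1)) = x * ∫ t in Ioc 0 a, Real.exp (-t) * t ^ (x-1) := by
      rw [← integral_const_mul]
      congr 1; funext t; ring
    rw [h3] at h1
    linarith
  · refine ((f_intc hx a).const_mul x).congr (Eventually.of_forall fun t => ?_)
    simp only
    ring
  · exact f_intc (by linarith) a

lemma F_sub {x a b : ℝ} (hx : 0 < x) (ha : 0 < a) (hb : 0 < b) :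
    F x b - F x a = ∫ t in a..b, Real.exp (-t) * t ^ (x - 1) := by
  unfold F
  rw [← intervalIntegral.integral_of_le ha.le, ← intervalIntegral.integral_of_le hb.le]
  apply intervalIntegral.integral_interval_sub_left
  · rw [intervalIntegrable_iff_integrableOn_Ioc_of_le hb.le]; exact f_intc hx b
  · rw [intervalIntegrable_iff_integrableOn_Ioc_of_le ha.le]; exact f_intc hx a

lemma F_gamma {x a : ℝ} (hx : 0 < x) (ha : 0 < a) :
    F x a = Real.Gamma x - ∫ t in Ioi a, Real.exp (-t) * t ^ (x - 1) := by
  rw [Real.Gamma_eq_integral hx, ← Ioc_union_Ioi_eq_Ioi ha.le, setIntegral_union]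
  · unfold F; ring
  · exact Set.Ioc_disjoint_Ioi le_rfl
  · exact measurableSet_Ioi
  · exact f_intc hx a
  · exact (f_int hx).mono_set (Ioi_subset_Ioi ha.le)

lemma f_shift {x a s : ℝ} (ha : 0 < a) (hs : 0 < a + s) :
    Real.exp (-(a+s)) * (a + s) ^ x = Real.exp (-a) * a ^ x * Ek x a s := by
  have h1 : 0 < 1 + s / a := by
    rw [show 1 + s / a = (a + s) / a by field_simp]
    positivity
  unfold Ek
  rw [show a + s = a * (1 + s / a) by field_simp]
  rw [Real.mul_rpow ha.le h1.le, Real.rpow_def_of_pos h1]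
  rw [show a * (1 + s / a) = a + s by field_simp]
  rw [show x * Real.log (1 + s/a) - s = Real.log (1 + s/a) * x + (-s) by ring, Real.exp_add, neg_add, Real.exp_add]
  ring

lemma int_shift {x a b : ℝ} (ha : 0 < a) (hb : 0 < b) (k : ℝ → ℝ) :
    ∫ t in a..b, Real.exp (-t) * t ^ x * k t = Real.exp (-a) * a ^ x * ∫ s in (0:ℝ)..(b - a), Ek x a s * k (a + s) := by
  rw [← intervalIntegral.integral_const_mul]
  have := intervalIntegral.integral_comp_add_left (a := 0) (b := b - a) (fun t => Real.exp (-t) * t ^ x * k t) a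
  rw [add_zero, add_sub_cancel] at this
  rw [← this]
  apply intervalIntegral.integral_congr
  intro s hs
  have hs' : 0 < a + s := by
    have h1 : min 0 (b - a) ≤ s := hs.1
    rcases le_total 0 (b - a) with h | h
    · rw [min_eq_left h] at h1; linarith
    · rw [min_eq_right h] at h1; linarith
  simp only
  rw [f_shift ha hs']
  ring

lemma F_rec {x a b : ℝ} (hx : 0 < x) (ha : 0 < a) (hb : 0 < b) :
    F (x+1) b = x * F x a + Real.exp (-a) * a ^ x * ((∫ s in (0:ℝ)..(b - a), Ek x a s) - 1) := by
  have h1 := F_sub (x := x+1) (by linarith) ha hb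
  have h2 := F_succ hx ha
  have h3 := int_shift (x := x) ha hb (fun _ => 1)
  simp only [mul_one] at h3
  rw [add_sub_cancel_right, h3] at h1
  linarith

noncomputable def P (x a : ℝ) : ℝ := F x a / Real.Gamma x

lemma P_rec {x a b : ℝ} (hx : 0 < x) (ha : 0 < a) (hb : 0 < b) :
    P (x+1) b - P x a = Real.exp (-a) * a ^ x / Real.Gamma (x+1) * ((∫ s in (0:ℝ)..(b - a), Ek x a s) - 1) := by
  unfold P
  rw [F_rec hx ha hb, Real.Gamma_add_one hx.ne']
  have := Real.Gamma_pos_of_pos hx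
  field_simp
  ring

lemma P_mono {x a b : ℝ} (hx : 0 < x) (ha : 0 < a) (hab : a ≤ b) : P x a ≤ P x b := by
  unfold P
  have hb : 0 < b := by linarith
  have h1 := F_sub hx ha hb
  have h2 : 0 ≤ ∫ t in a..b, Real.exp (-t) * t ^ (x - 1) := by
    apply intervalIntegral.integral_nonneg hab
    intro t ht
    have : 0 ≤ t := by linarith [ht.1]
    positivity
  have := Real.Gamma_pos_of_pos hx
  gcongr
  linarith

/-- Laplace method -/
noncomputable def gL (x v : ℝ) : ℝ := Real.exp (-(x * (Real.exp (v / √x) - 1 - v / √x)))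

lemma psi_bound (w : ℝ) : w ^ 2 / 4 ≤ Real.exp w - 1 - w ∨ |w| / 2 ≤ Real.exp w - 1 - w := by
  rcases le_total 0 w with h | h
  · left
    have := Real.quadratic_le_exp_of_nonneg h
    nlinarith [sq_nonneg w]
  · rcases le_total (-2) w with h2 | h2
    · left
      have h3 := Real.add_one_le_exp (w/2)
      have h4 : Real.exp w = Real.exp (w/2) ^ 2 := by
        rw [← Real.exp_nat_mul]; congr 1; push_cast; ring
      nlinarith
    · right
      rw [abs_of_nonpos h]
      have := Real.exp_pos w
      linarith

lemma gL_bound {x : ℝ} (hx : 1 ≤ x) (v : ℝ) : gL x v ≤ 16 * (1 + v ^ 2)⁻¹ := by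
  have hs : 1 ≤ √x := Real.one_le_sqrt.mpr hx
  have hsx : √x ^ 2 = x := Real.sq_sqrt (by linarith)
  have h1 : |v| / 2 - 1/4 ≤ x * (Real.exp (v / √x) - 1 - v / √x) := by
    rcases psi_bound (v / √x) with h | h
    · have h2 : x * ((v / √x) ^ 2 / 4) ≤ x * (Real.exp (v / √x) - 1 - v / √x) := by gcongr
      have h3 : x * ((v / √x) ^ 2 / 4) = v ^ 2 / 4 := by rw [div_pow, hsx]; field_simp
      nlinarith [sq_nonneg (|v| - 1), sq_abs v]
    · have h2 : x * (|v / √x| / 2) ≤ x * (Real.exp (v / √x) - 1 - v / √x) := by gcongr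
      have h3 : x * (|v / √x| / 2) = √x * |v| / 2 := by
        rw [abs_div, abs_of_pos (show 0 < √x by linarith)]
        nth_rewrite 1 [← hsx]
        field_simp
      nlinarith [abs_nonneg v]
  have h2 : gL x v ≤ Real.exp (1/4 - |v| / 2) := by
    unfold gL
    exact Real.exp_le_exp.mpr (by linarith)
  refine h2.trans ?_
  rw [Real.exp_sub, ← div_eq_mul_inv]
  have h3 := Real.quadratic_le_exp_of_nonneg (show 0 ≤ |v| / 2 by positivity)
  have h4 : (1 + v^2) / 8 ≤ Real.exp (|v| / 2) := by
    nlinarith [abs_nonneg v, sq_abs v]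
  have h5 : Real.exp (1/4) ≤ 2 := by
    have : (1/4:ℝ) ≤ Real.log 2 := by linarith [Real.log_two_gt_d9]
    calc Real.exp (1/4) ≤ Real.exp (Real.log 2) := Real.exp_le_exp.mpr this
      _ = 2 := Real.exp_log (by norm_num)
  calc Real.exp (1/4) / Real.exp (|v|/2) ≤ 2 / ((1 + v^2) / 8) := by gcongr
    _ = 16 / (1 + v^2) := by field_simp; norm_num

lemma gL_lim (v : ℝ) : Tendsto (fun x => gL x v) atTop (nhds (Real.exp (-(1/2) * v ^ 2))) := by
  unfold gL
  refine (Real.continuous_exp.tendsto _).comp ?_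
  have hsq : Tendsto (fun x : ℝ => √x) atTop atTop := Real.tendsto_sqrt_atTop
  have hw : Tendsto (fun x : ℝ => v / √x) atTop (nhds 0) := hsq.const_div_atTop v
  have hb : Tendsto (fun x : ℝ => |v| ^ 3 / √x) atTop (nhds 0) := hsq.const_div_atTop _
  have : Tendsto (fun x : ℝ => x * (Real.exp (v / √x) - 1 - v / √x) - v ^ 2 / 2) atTop (nhds 0) := by
    refine squeeze_zero_norm' ?_ hb
    have hw1 : ∀ᶠ x : ℝ in atTop, |v / √x| ≤ 1 := by
      have := hw.abs
      rw [abs_zero] at this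
      exact this.eventually_le_const (by norm_num)
    filter_upwards [hw1, eventually_ge_atTop 1] with x hx h1
    have hs : 0 < √x := Real.sqrt_pos.mpr (by linarith)
    have hsx : √x ^ 2 = x := Real.sq_sqrt (by linarith)
    have h2 := Real.exp_bound hx (n := 3) (by norm_num)
    simp only [Finset.sum_range_succ, Finset.sum_range_zero, Nat.factorial, pow_zero] at h2
    norm_num at h2
    have e1 : x * (Real.exp (v / √x) - 1 - v / √x) - v ^ 2 / 2 = x * (Real.exp (v / √x) - (1 + v / √x + v ^ 2 / x / 2)) := by
      field_simp
      ring
    rw [e1, Real.norm_eq_abs, abs_mul, abs_of_pos (by linarith : (0:ℝ) < x)]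
    rw [div_pow, hsx] at h2
    refine (mul_le_mul_of_nonneg_left h2 (by linarith)).trans ?_
    rw [abs_div, abs_of_pos hs]
    have e2 : x * ((|v| / √x) ^ 3 * (2/9)) = |v|^3 / √x * (2/9) := by
      nth_rewrite 1 [← hsx]
      field_simp
    rw [e2]
    have : 0 ≤ |v|^3 / √x := by positivity
    linarith
  have h3 := (this.add_const (v^2/2)).neg
  rw [zero_add] at h3
  rw [show -(1/2) * v^2 = -(v^2/2) by ring]
  refine h3.congr fun x => ?_
  ring

lemma gL_int_lim (S : Set ℝ) : Tendsto (fun x => ∫ v in S, gL x v) atTop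
    (nhds (∫ v in S, Real.exp (-(1/2) * v ^ 2))) := by
  refine tendsto_integral_filter_of_dominated_convergence (fun v => 16 * (1 + v ^ 2)⁻¹) ?_ ?_ ?_ ?_
  · refine Eventually.of_forall fun x => ?_
    refine Continuous.aestronglyMeasurable ?_
    unfold gL
    fun_prop
  · filter_upwards [eventually_ge_atTop 1] with x hx
    refine Eventually.of_forall fun v => ?_
    rw [Real.norm_eq_abs, abs_of_pos (by unfold gL; positivity)]
    exact gL_bound hx v
  · exact (integrable_inv_one_add_sq.const_mul 16).integrableOn
  · exact Eventually.of_forall fun v => gL_lim v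

lemma cov {x : ℝ} (hx : 0 < x) (S : Set ℝ) (hS : MeasurableSet S) :
    ∫ t in image (fun v => x * Real.exp (v / √x)) S, Real.exp (-t) * t ^ (x - 1) =
      (Real.exp (-x) * x ^ x / √x) * ∫ v in S, gL x v := by
  have hs : 0 < √x := Real.sqrt_pos.mpr hx
  have hsx : √x ^ 2 = x := Real.sq_sqrt hx.le
  rw [integral_image_eq_integral_abs_deriv_smul (f' := fun v => √x * Real.exp (v / √x)) hS]
  · rw [← integral_const_mul]
    congr 1
    funext v
    have e1 : (x * Real.exp (v / √x)) ^ (x - 1) = x ^ x / x * Real.exp (v / √x * x) * Real.exp (-(v / √x)) := by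
      rw [Real.mul_rpow hx.le (Real.exp_pos _).le, Real.rpow_sub_one hx.ne', ← Real.exp_mul, mul_assoc, ← Real.exp_add]
      congr 2
      ring
    rw [e1, abs_of_pos (by positivity), smul_eq_mul]
    unfold gL
    have e2 : Real.exp (-(x * (Real.exp (v / √x) - 1 - v / √x))) =
        Real.exp (-(x * Real.exp (v / √x))) * Real.exp x * Real.exp (v / √x * x) := by
      rw [← Real.exp_add, ← Real.exp_add]; congr 1; ring
    rw [e2]
    have e3 : Real.exp (-x) * Real.exp x = 1 := by rw [← Real.exp_add]; simp
    have e4 : Real.exp (v / √x) * Real.exp (-(v / √x)) = 1 := by rw [← Real.exp_add]; simp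
    have e5 : √x / x = 1 / √x := by
      nth_rewrite 2 [← hsx]; field_simp
    calc _ = (√x / x) * x ^ x * Real.exp (-(x * Real.exp (v / √x))) * Real.exp (v / √x * x) * (Real.exp (v / √x) * Real.exp (-(v / √x))) := by ring
      _ = (1 / √x) * x ^ x * Real.exp (-(x * Real.exp (v / √x))) * Real.exp (v / √x * x) * (Real.exp (-x) * Real.exp x) := by rw [e4, e5, e3]
      _ = _ := by ring
  · intro v _
    have h1 := (((hasDerivAt_id v).div_const √x).exp).const_mul x
    refine (h1.congr_deriv ?_).hasDerivWithinAt
    simp only [id]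
    nth_rewrite 1 [← hsx]
    field_simp
  · intro u _ v _ huv
    simp only at huv
    have := Real.exp_injective (mul_left_cancel₀ hx.ne' huv)
    field_simp at this
    exact this

lemma img_univ {x : ℝ} (hx : 0 < x) : image (fun v => x * Real.exp (v / √x)) univ = Ioi 0 := by
  have hs : 0 < √x := Real.sqrt_pos.mpr hx
  ext t
  simp only [image_univ, mem_range, mem_Ioi]
  constructor
  · rintro ⟨v, rfl⟩; positivity
  · intro ht
    refine ⟨√x * Real.log (t / x), ?_⟩
    rw [mul_div_cancel_left₀ _ hs.ne', Real.exp_log (by positivity)]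
    field_simp

lemma img_Ioi {x : ℝ} (hx : 0 < x) : image (fun v => x * Real.exp (v / √x)) (Ioi 0) = Ioi x := by
  have hs : 0 < √x := Real.sqrt_pos.mpr hx
  ext t
  simp only [mem_image, mem_Ioi]
  constructor
  · rintro ⟨v, hv, rfl⟩
    have : 1 < Real.exp (v / √x) := Real.one_lt_exp_iff.mpr (by positivity)
    nlinarith
  · intro ht
    have h1 : 1 < t / x := by rw [lt_div_iff₀ hx]; linarith
    refine ⟨√x * Real.log (t / x), ?_, ?_⟩
    · have := Real.log_pos h1
      positivity
    rw [mul_div_cancel_left₀ _ hs.ne', Real.exp_log (by positivity)]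
    field_simp

lemma gamma_eq {x : ℝ} (hx : 0 < x) : Real.Gamma x = (Real.exp (-x) * x ^ x / √x) * ∫ v, gL x v := by
  have := cov hx univ MeasurableSet.univ
  rw [img_univ hx, ← Real.Gamma_eq_integral hx, setIntegral_univ] at this
  exact this

lemma gL_univ_lim : Tendsto (fun x => ∫ v, gL x v) atTop (nhds √(Real.pi / (1/2))) := by
  have := gL_int_lim univ
  simp only [setIntegral_univ] at this
  rwa [integral_gaussian] at this

lemma PP_lim : Tendsto (fun x => P x x) atTop (nhds (1/2)) := by
  have h1 := gL_univ_lim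
  have h2 := gL_int_lim (Ioi 0)
  rw [integral_gaussian_Ioi] at h2
  have hpos : 0 < √(Real.pi / (1/2)) := Real.sqrt_pos.mpr (by positivity)
  have h3 := (h2.div h1 hpos.ne').const_sub 1
  rw [show 1 - √(Real.pi / (1/2)) / 2 / √(Real.pi / (1/2)) = 1/2 by field_simp; norm_num] at h3
  refine h3.congr' ?_
  filter_upwards [eventually_gt_atTop 0] with x hx
  have hg := gamma_eq hx
  have hG := Real.Gamma_pos_of_pos hx
  have hc := cov hx (Ioi 0) measurableSet_Ioi
  rw [img_Ioi hx] at hc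
  unfold P
  rw [F_gamma hx hx, hc, sub_div, div_self hG.ne', hg]
  have hs : 0 < √x := Real.sqrt_pos.mpr hx
  have : 0 < x ^ x := by positivity
  simp only [Pi.div_apply]
  rw [mul_div_mul_left _ _ (by positivity)]

lemma K_lim : Tendsto (fun x => Real.exp (-x) * x ^ x / Real.Gamma x / x) atTop (nhds 0) := by
  have h1 := gL_univ_lim
  have hpos : 0 < √(Real.pi / (1/2)) := Real.sqrt_pos.mpr (by positivity)
  have h2 := (h1.inv₀ hpos.ne').mul (Real.tendsto_sqrt_atTop.inv_tendsto_atTop)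
  rw [mul_zero] at h2
  refine h2.congr' ?_
  filter_upwards [eventually_gt_atTop 0, h1.eventually_const_lt hpos] with x hx hI
  have hs : 0 < √x := Real.sqrt_pos.mpr hx
  have hsx : √x ^ 2 = x := Real.sq_sqrt hx.le
  have : 0 < x ^ x := by positivity
  rw [gamma_eq hx]
  simp only [Pi.inv_apply]
  field_simp
  rw [hsx]

lemma f_max {x t : ℝ} (hx : 0 < x) (ht : 0 < t) : Real.exp (-t) * t ^ x ≤ Real.exp (-x) * x ^ x := by
  rw [Real.rpow_def_of_pos ht, Real.rpow_def_of_pos hx, ← Real.exp_add, ← Real.exp_add]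
  apply Real.exp_le_exp.mpr
  have h1 := Real.log_le_sub_one_of_pos (show 0 < t / x by positivity)
  rw [Real.log_div ht.ne' hx.ne'] at h1
  have h2 : x * (Real.log t - Real.log x) ≤ x * (t / x - 1) := by gcongr
  have h3 : x * (t / x - 1) = t - x := by field_simp
  nlinarith

lemma P_lip {x a : ℝ} (hx : 0 < x) (ha : x / 2 ≤ a) : |P x a - P x x| ≤ 2 * (Real.exp (-x) * x ^ x / Real.Gamma x / x) * |a - x| := by
  have hG := Real.Gamma_pos_of_pos hx
  have ha0 : 0 < a := by linarith
  unfold P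
  rw [← sub_div, F_sub hx hx ha0, abs_div, abs_of_pos hG, div_le_iff₀ hG]
  have hb : ∀ t ∈ uIoc x a, ‖Real.exp (-t) * t ^ (x - 1)‖ ≤ 2 * (Real.exp (-x) * x ^ x / x) := by
    intro t ht
    have h1 : min x a < t := ht.1
    have h2 : x / 2 ≤ min x a := le_min (by linarith) ha
    have ht0 : 0 < t := by linarith
    rw [Real.norm_eq_abs, abs_of_pos (by positivity), Real.rpow_sub_one ht0.ne', ← mul_div_assoc, div_le_iff₀ ht0]
    have h3 := f_max hx ht0
    have h4 : 1 ≤ 2 * t / x := by rw [le_div_iff₀ hx]; linarith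
    have h5 : 0 < Real.exp (-x) * x ^ x := by positivity
    calc _ ≤ Real.exp (-x) * x ^ x * 1 := by linarith
      _ ≤ Real.exp (-x) * x ^ x * (2 * t / x) := by gcongr
      _ = _ := by ring
  have := intervalIntegral.norm_integral_le_of_norm_le_const hb
  rw [Real.norm_eq_abs] at this
  refine this.trans (le_of_eq ?_)
  field_simp

lemma P_lim {a : ℝ → ℝ} (h : Bd atTop (fun x => a x - x)) : Tendsto (fun x => P x (a x)) atTop (nhds (1/2)) := by
  obtain ⟨C, hC⟩ := h.bound
  have h1 : Tendsto (fun x => P x (a x) - P x x) atTop (nhds 0) := by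
    have hz : Tendsto (fun x => 2 * (Real.exp (-x) * x ^ x / Real.Gamma x / x) * C) atTop (nhds 0) := by
      have := (K_lim.const_mul 2).mul_const C
      simpa using this
    refine squeeze_zero_norm' ?_ hz
    filter_upwards [hC, eventually_gt_atTop 0, eventually_ge_atTop (2 * C)] with x hx hx0 hxC
    simp only [Real.norm_eq_abs, abs_one, mul_one] at hx
    have hG := Real.Gamma_pos_of_pos hx0
    have h2 := P_lip (a := a x) hx0 (by linarith [neg_le_of_abs_le hx])
    rw [Real.norm_eq_abs]
    refine h2.trans ?_
    gcongr
  have := h1.add PP_lim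
  simpa using this

noncomputable def Gd (x : ℝ) (S : Set ℝ) : ℝ := ∫ t in S, Real.exp (-t) * t ^ (x - 1) * Real.log t

lemma abs_log_le {t δ : ℝ} (ht : 0 < t) (hδ : 0 < δ) : |Real.log t| ≤ (t ^ δ + t ^ (-δ)) / δ := by
  have h1 := Real.log_le_rpow_div ht.le hδ
  have h2 := Real.log_le_rpow_div (inv_pos.mpr ht).le hδ
  rw [Real.log_inv, Real.inv_rpow ht.le, ← Real.rpow_neg ht.le] at h2
  have h3 : 0 < t ^ δ / δ := by positivity
  have h4 : 0 < t ^ (-δ) / δ := by positivity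
  rw [abs_le, add_div]
  constructor <;> linarith

lemma rpow_le_add {t u p v : ℝ} (ht : 0 < t) (h1 : u ≤ p) (h2 : p ≤ v) : t ^ p ≤ t ^ u + t ^ v := by
  have hu : 0 < t ^ u := by positivity
  have hv : 0 < t ^ v := by positivity
  rcases le_total 1 t with h | h
  · linarith [Real.rpow_le_rpow_of_exponent_le h h2]
  · linarith [Real.rpow_le_rpow_of_exponent_ge ht h h1]

lemma Gd_deriv {x : ℝ} (hx : 0 < x) {S : Set ℝ} (hS : MeasurableSet S) (hS0 : S ⊆ Ioi 0) :
    IntegrableOn (fun t => Real.exp (-t) * t ^ (x - 1) * Real.log t) S ∧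
    HasDerivAt (fun y => ∫ t in S, Real.exp (-t) * t ^ (y - 1)) (Gd x S) x := by
  have hδ : 0 < x / 4 := by positivity
  have hae : ∀ᵐ t ∂(volume.restrict S), 0 < t := by
    filter_upwards [ae_restrict_mem hS] with t ht using hS0 ht
  refine hasDerivAt_integral_of_dominated_loc_of_deriv_le
    (F' := fun y t => Real.exp (-t) * t ^ (y - 1) * Real.log t)
    (s := Ioo (x - x/4) (x + x/4))
    (bound := fun t => (4 / x) * (Real.exp (-t) * t ^ (x / 2 - 1) + 2 * (Real.exp (-t) * t ^ (x - 1)) +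
      Real.exp (-t) * t ^ (3 * x / 2 - 1))) (Ioo_mem_nhds (by linarith) (by linarith)) ?_ ?_ ?_ ?_ ?_ ?_
  · exact Eventually.of_forall fun y => by
      apply Measurable.aestronglyMeasurable
      fun_prop
  · exact (f_int hx).mono_set hS0
  · apply Measurable.aestronglyMeasurable
    fun_prop
  · filter_upwards [hae] with t ht y hy
    have h1 := abs_log_le ht hδ
    have h2 := rpow_le_add (u := x - x/4 - 1) (v := x + x/4 - 1) ht (show x - x/4 - 1 ≤ y - 1 by linarith [hy.1])
      (by linarith [hy.2])
    rw [Real.norm_eq_abs, abs_mul, abs_of_pos (by positivity : 0 < Real.exp (-t) * t ^ (y - 1))]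
    have e1 : t ^ (x / 2 - 1) = t ^ (x - x/4 - 1) * t ^ (-(x/4)) := by
      rw [← Real.rpow_add ht]; congr 1; ring
    have e2 : t ^ (x - 1) = t ^ (x - x/4 - 1) * t ^ (x/4) := by
      rw [← Real.rpow_add ht]; congr 1; ring
    have e3 : t ^ (x - 1) = t ^ (x + x/4 - 1) * t ^ (-(x/4)) := by
      rw [← Real.rpow_add ht]; congr 1; ring
    have e4 : t ^ (3 * x / 2 - 1) = t ^ (x + x/4 - 1) * t ^ (x/4) := by
      rw [← Real.rpow_add ht]; congr 1; ring
    calc _ ≤ Real.exp (-t) * (t ^ (x - x/4 - 1) + t ^ (x + x/4 - 1)) * ((t ^ (x/4) + t ^ (-(x/4))) / (x/4)) := by gcongr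
      _ = (4 / x) * Real.exp (-t) * (t ^ (x - x/4 - 1) * t ^ (-(x/4)) + t ^ (x - x/4 - 1) * t ^ (x/4)
          + t ^ (x + x/4 - 1) * t ^ (-(x/4)) + t ^ (x + x/4 - 1) * t ^ (x/4)) := by field_simp; ring
      _ = _ := by rw [← e1, ← e2, ← e3, ← e4]; ring
  · refine Integrable.const_mul ?_ _
    refine Integrable.add (Integrable.add ?_ (Integrable.const_mul ?_ 2)) ?_
    · exact (f_int (by linarith)).mono_set hS0
    · exact (f_int hx).mono_set hS0
    · exact (f_int (by linarith)).mono_set hS0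
  · filter_upwards [hae] with t ht y _
    have h1 := ((((hasDerivAt_id y).sub_const 1).const_rpow ht)).const_mul (Real.exp (-t))
    refine h1.congr_deriv ?_
    simp only [id]
    ring

lemma Gd_succ {x a : ℝ} (hx : 0 < x) (ha : 0 < a) :
    Gd (x+1) (Ioc 0 a) = F x a + x * Gd x (Ioc 0 a) - a ^ x * Real.log a * Real.exp (-a) := by
  have h1 := (Gd_deriv (x := x+1) (by linarith) (measurableSet_Ioc (a := 0) (b := a)) Ioc_subset_Ioi_self).2
  have h2 := h1.comp_add_const x 1
  have h3 := (Gd_deriv hx (measurableSet_Ioc (a := 0) (b := a)) Ioc_subset_Ioi_self).2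
  have h4 := ((hasDerivAt_id x).mul h3).sub (((hasDerivAt_id x).const_rpow ha).mul_const (Real.exp (-a)))
  have h5 := h4.congr_of_eventuallyEq (f₁ := fun y => ∫ t in Ioc 0 a, Real.exp (-t) * t ^ (y + 1 - 1)) (by
    filter_upwards [eventually_gt_nhds hx] with y hy
    have := F_succ hy ha
    unfold F at this
    simpa using this)
  have := h2.unique h5
  rw [this]
  simp only [F, id]
  ring

lemma Gd_succ_tot {x : ℝ} (hx : 0 < x) :
    Gd (x+1) (Ioi 0) = Real.Gamma x + x * Gd x (Ioi 0) := by
  have h1 := (Gd_deriv (x := x+1) (by linarith) (measurableSet_Ioi (a := 0)) subset_rfl).2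
  have h2 := h1.comp_add_const x 1
  have h3 := (Gd_deriv hx (measurableSet_Ioi (a := 0)) subset_rfl).2
  have h4 := ((hasDerivAt_id x).mul h3)
  have h5 := h4.congr_of_eventuallyEq (f₁ := fun y => ∫ t in Ioi 0, Real.exp (-t) * t ^ (y + 1 - 1)) (by
    filter_upwards [eventually_gt_nhds hx] with y hy
    have := Real.Gamma_add_one hy.ne'
    rw [Real.Gamma_eq_integral (by linarith), Real.Gamma_eq_integral hy] at this
    simpa using this)
  have := h2.unique h5
  rw [this, Real.Gamma_eq_integral hx]
  simp only [id]
  ring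

lemma Gd_sub {x a b : ℝ} (hx : 0 < x) (ha : 0 < a) (hb : 0 < b) :
    Gd x (Ioc 0 b) - Gd x (Ioc 0 a) = ∫ t in a..b, Real.exp (-t) * t ^ (x - 1) * Real.log t := by
  unfold Gd
  rw [← intervalIntegral.integral_of_le ha.le, ← intervalIntegral.integral_of_le hb.le]
  apply intervalIntegral.integral_interval_sub_left
  · rw [intervalIntegrable_iff_integrableOn_Ioc_of_le hb.le]
    exact (Gd_deriv hx measurableSet_Ioc Ioc_subset_Ioi_self).1
  · rw [intervalIntegrable_iff_integrableOn_Ioc_of_le ha.le]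
    exact (Gd_deriv hx measurableSet_Ioc Ioc_subset_Ioi_self).1

/-- derivative of the moving-endpoint part -/
lemma end_deriv {m : ℝ → ℝ} {x d : ℝ} (hm0 : 0 < m x) (hm : HasDerivAt m d x) :
    HasDerivAt (fun y => ∫ t in (m x)..(m y), Real.exp (-t) * t ^ (y - 1))
      (Real.exp (-(m x)) * (m x) ^ (x - 1) * d) x := by
  set c := Real.exp (-(m x)) * (m x) ^ (x - 1) with hc
  have hcont : ContinuousAt (fun p : ℝ × ℝ => Real.exp (-p.2) * p.2 ^ (p.1 - 1)) (x, m x) := by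
    refine ContinuousAt.mul (by fun_prop) ?_
    exact ContinuousAt.rpow (by fun_prop) (by fun_prop) (Or.inl hm0.ne')
  have hr : (fun y => (∫ t in (m x)..(m y), Real.exp (-t) * t ^ (y - 1)) - c * (m y - m x)) =o[nhds x]
      (fun y => m y - m x) := by
    rw [isLittleO_iff]
    intro ε hε
    have h1 := Metric.continuousAt_iff.mp hcont (ε / 2) (by positivity)
    obtain ⟨δ, hδ, h1⟩ := h1
    have hmc := Metric.tendsto_nhds.mp hm.continuousAt (min δ (m x / 2)) (by positivity)
    filter_upwards [hmc, Metric.ball_mem_nhds x hδ] with y hy1 hy2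
    have hy3 := (lt_min_iff.mp hy1).1
    have hy4 := (lt_min_iff.mp hy1).2
    rw [Real.dist_eq] at hy3 hy4
    have hpos : ∀ t ∈ uIcc (m x) (m y), 0 < t := by
      intro t ht
      have : min (m x) (m y) ≤ t := ht.1
      have h5 : m x / 2 ≤ min (m x) (m y) := le_min (by linarith) (by linarith [(abs_lt.mp hy4).1])
      linarith
    have hInt : IntervalIntegrable (fun t => Real.exp (-t) * t ^ (y - 1)) volume (m x) (m y) := by
      apply ContinuousOn.intervalIntegrable
      intro t ht
      refine ContinuousAt.continuousWithinAt ?_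
      exact ContinuousAt.mul (by fun_prop) (Real.continuousAt_rpow_const _ _ (Or.inl (hpos t ht).ne'))
    have e1 : (∫ t in (m x)..(m y), Real.exp (-t) * t ^ (y - 1)) - c * (m y - m x) =
        ∫ t in (m x)..(m y), (Real.exp (-t) * t ^ (y - 1) - c) := by
      rw [intervalIntegral.integral_sub hInt (by simp), intervalIntegral.integral_const, smul_eq_mul]
      ring
    rw [e1]
    refine (intervalIntegral.norm_integral_le_of_norm_le_const (C := ε) ?_)
    intro t ht
    have htd : |t - m x| < δ := by
      have := abs_sub_left_of_mem_uIcc (uIoc_subset_uIcc ht)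
      linarith
    have := h1 (x := (y, t)) (by
      rw [Prod.dist_eq]
      exact max_lt hy2 htd)
    rw [Real.dist_eq] at this
    simp only at this
    rw [Real.norm_eq_abs]
    linarith
  have hr2 := hr.trans_isBigO hm.isBigO_sub
  have h2 := (hm.sub_const (m x)).const_mul c
  rw [hasDerivAt_iff_isLittleO] at h2 ⊢
  refine (hr2.add h2).congr_left fun y => ?_
  simp only [intervalIntegral.integral_same, sub_self, mul_zero, sub_zero]
  ring

section
variable {m m' : ℝ → ℝ}
    (hm : ∀ x > (0:ℝ), 0 < m x ∧
      (∫ t in Set.Ioc (0:ℝ) (m x), Real.exp (-t) * t ^ (x - 1)) =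
        (1/2) * ∫ t in Set.Ioi (0:ℝ), Real.exp (-t) * t ^ (x - 1))
    (hm' : ∀ x > (0:ℝ), HasDerivAt m (m' x) x)
include hm

lemma F_m {x : ℝ} (hx : 0 < x) : F x (m x) = Real.Gamma x / 2 := by
  unfold F
  rw [(hm x hx).2, Real.Gamma_eq_integral hx]
  ring

lemma P_m {x : ℝ} (hx : 0 < x) : P x (m x) = 1/2 := by
  unfold P
  rw [F_m hm hx]
  have := Real.Gamma_pos_of_pos hx
  field_simp

lemma Ek_m {x : ℝ} (hx : 0 < x) : ∫ s in (0:ℝ)..(m (x+1) - m x), Ek x (m x) s = 1 := by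
  have hx1 : 0 < x + 1 := by linarith
  have ha := (hm x hx).1
  have h := P_rec hx ha (hm (x+1) hx1).1
  rw [P_m hm hx, P_m hm hx1, sub_self] at h
  have := Real.Gamma_pos_of_pos hx1
  have h2 := (mul_eq_zero.mp h.symm).resolve_left (by positivity)
  linarith

lemma N_succ {x : ℝ} (hx : 0 < x) :
    1/2 * Gd (x+1) (Ioi 0) - Gd (x+1) (Ioc 0 (m (x+1))) = x * (1/2 * Gd x (Ioi 0) - Gd x (Ioc 0 (m x)))
      - Real.exp (-(m x)) * (m x) ^ x * ∫ s in (0:ℝ)..(m (x+1) - m x), Ek x (m x) s * Real.log (1 + s / m x) := by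
  have hx1 : 0 < x + 1 := by linarith
  have ha := (hm x hx).1
  have hb := (hm (x+1) hx1).1
  have h1 := Gd_sub hx1 ha hb
  rw [add_sub_cancel_right, int_shift ha hb] at h1
  have hpos : ∀ s ∈ uIcc 0 (m (x+1) - m x), 0 < m x + s := by
    intro s hs
    have h1 : min 0 (m (x+1) - m x) ≤ s := hs.1
    rcases le_total 0 (m (x+1) - m x) with h | h
    · rw [min_eq_left h] at h1; linarith
    · rw [min_eq_right h] at h1; linarith
  have hpos' : ∀ s ∈ uIcc 0 (m (x+1) - m x), 0 < 1 + s / m x := by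
    intro s hs
    have := hpos s hs
    rw [show 1 + s / m x = (m x + s) / m x by field_simp]
    positivity
  have hcE : ContinuousOn (fun s => Ek x (m x) s) (uIcc 0 (m (x+1) - m x)) := by
    unfold Ek
    refine ContinuousOn.rexp (ContinuousOn.sub (ContinuousOn.mul (by fun_prop) (ContinuousOn.log (by fun_prop) ?_)) (by fun_prop))
    intro s hs
    exact (hpos' s hs).ne'
  have hcL : ContinuousOn (fun s => Real.log (1 + s / m x)) (uIcc 0 (m (x+1) - m x)) := by
    refine ContinuousOn.log (by fun_prop) ?_
    intro s hs
    exact (hpos' s hs).ne'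
  have e1 : ∫ s in (0:ℝ)..(m (x+1) - m x), Ek x (m x) s * Real.log (m x + s) =
      Real.log (m x) + ∫ s in (0:ℝ)..(m (x+1) - m x), Ek x (m x) s * Real.log (1 + s / m x) := by
    have e2 : ∫ s in (0:ℝ)..(m (x+1) - m x), Ek x (m x) s * Real.log (m x + s) =
        ∫ s in (0:ℝ)..(m (x+1) - m x), (Real.log (m x) * Ek x (m x) s + Ek x (m x) s * Real.log (1 + s / m x)) := by
      apply intervalIntegral.integral_congr
      intro s hs
      simp only
      rw [show m x + s = m x * (1 + s / m x) by field_simp, Real.log_mul ha.ne' (hpos' s hs).ne']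
      ring
    rw [e2, intervalIntegral.integral_add, intervalIntegral.integral_const_mul, Ek_m hm hx, mul_one]
    · exact (hcE.intervalIntegrable).const_mul _
    · exact (hcE.mul hcL).intervalIntegrable
  rw [e1] at h1
  have h2 := Gd_succ hx ha
  rw [F_m hm hx] at h2
  rw [Gd_succ_tot hx]
  linarith

include hm'

lemma N_eq {x : ℝ} (hx : 0 < x) :
    Real.exp (-(m x)) * (m x) ^ (x - 1) * m' x = 1/2 * Gd x (Ioi 0) - Gd x (Ioc 0 (m x)) := by
  have ha := (hm x hx).1
  have h1 := (Gd_deriv hx (measurableSet_Ioc (a := 0) (b := m x)) Ioc_subset_Ioi_self).2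
  have h2 := h1.add (end_deriv ha (hm' x hx))
  have h3 := (Gd_deriv hx (measurableSet_Ioi (a := 0)) subset_rfl).2.const_mul (1/2)
  have h4 := h3.congr_of_eventuallyEq (f₁ := (fun y : ℝ => ∫ t in Ioc 0 (m x), Real.exp (-t) * t ^ (y - 1)) +
      fun y : ℝ => ∫ t in (m x)..(m y), Real.exp (-t) * t ^ (y - 1)) (by
    filter_upwards [eventually_gt_nhds hx] with y hy
    have h5 := F_sub hy ha (hm y hy).1
    have h6 := (hm y hy).2
    unfold F at h5
    simp only [Pi.add_apply]
    linarith)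
  have := h2.unique h4
  linarith

end

lemma seq_neg {u : ℝ → ℝ} (h0 : Tendsto u atTop (nhds 0)) (h : ∀ᶠ x in atTop, u x < u (x+1)) :
    ∀ᶠ x in atTop, u x < 0 := by
  obtain ⟨X, hX⟩ := eventually_atTop.mp h
  filter_upwards [eventually_ge_atTop X] with x hx
  have hmono : Monotone (fun n : ℕ => u (x + n)) := by
    apply monotone_nat_of_le_succ
    intro n
    have := hX (x + n) (by have : (0:ℝ) ≤ n := Nat.cast_nonneg n
                           linarith)
    push_cast
    rw [← add_assoc]
    exact this.le
  have hlim : Tendsto (fun n : ℕ => u (x + n)) atTop (nhds 0) :=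
    h0.comp (tendsto_atTop_add_const_left _ x tendsto_natCast_atTop_atTop)
  have h1 := hmono.ge_of_tendsto hlim 1
  have h2 := hX x hx
  simp only [Nat.cast_one] at h1
  linarith

lemma seq_pos {u : ℝ → ℝ} (h0 : Tendsto u atTop (nhds 0)) (h : ∀ᶠ x in atTop, u (x+1) < u x) :
    ∀ᶠ x in atTop, 0 < u x := by
  have h1 := seq_neg (u := fun x => - u x) (by simpa using h0.neg) (by
    filter_upwards [h] with x hx
    linarith)
  filter_upwards [h1] with x hx
  linarith

lemma D_lim (c : ℝ) : Tendsto (fun x => P x (ac c x) - 1/2) atTop (nhds 0) := by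
  have hb : Bd atTop (fun x => ac c x - x) := by
    have h1 : Tendsto (fun x : ℝ => -1/3 + 8/405 * x⁻¹ + c * x⁻¹ ^ 2) atTop (nhds (-1/3 + 8/405 * 0 + c * 0 ^ 2)) :=
      ((einv0.const_mul _).const_add _).add ((einv0.pow 2).const_mul c)
    refine Bd.of_tendsto (h1.congr fun x => ?_)
    unfold ac
    ring
  have := (P_lim hb).sub_const (1/2)
  simpa using this

lemma ac_pos (c : ℝ) : ∀ᶠ x in atTop, 0 < ac c x :=
  (a_tendsto (mu := fun _ => c) (a := ac c) (Bd.const c) (Eventually.of_forall fun _ => rfl)).eventually_gt_atTop 0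

lemma succ_atTop : Tendsto (fun x : ℝ => x + 1) atTop atTop := tendsto_atTop_add_const_right _ _ tendsto_id

lemma D_neg {c : ℝ} (hc : c < 184/25515) : ∀ᶠ x in atTop, P x (ac c x) < 1/2 := by
  have h := seq_neg (D_lim c) (by
    filter_upwards [eventually_gt_atTop 0, ac_pos c, succ_atTop.eventually (ac_pos c),
      (I_lim c).eventually_const_lt (show 0 < 92/5103 - 5/2 * c by linarith)] with x hx h1 h2 h3
    have h4 := P_rec hx h1 h2
    have h5 := pos_of_mul_pos_right h3 (by positivity)
    have hG := Real.Gamma_pos_of_pos (show 0 < x + 1 by linarith)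
    have : 0 < Real.exp (-ac c x) * ac c x ^ x / Real.Gamma (x+1) := by positivity
    have := mul_pos this h5
    linarith)
  filter_upwards [h] with x hx
  linarith

lemma D_pos {c : ℝ} (hc : 184/25515 < c) : ∀ᶠ x in atTop, 1/2 < P x (ac c x) := by
  have h := seq_pos (D_lim c) (by
    filter_upwards [eventually_gt_atTop 0, ac_pos c, succ_atTop.eventually (ac_pos c),
      (I_lim c).eventually_lt_const (show 92/5103 - 5/2 * c < 0 by linarith)] with x hx h1 h2 h3
    have h4 := P_rec hx h1 h2
    have h5 := neg_of_mul_neg_right h3 (by positivity)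
    have hG := Real.Gamma_pos_of_pos (show 0 < x + 1 by linarith)
    have : 0 < Real.exp (-ac c x) * ac c x ^ x / Real.Gamma (x+1) := by positivity
    have := mul_neg_of_pos_of_neg this h5
    linarith)
  filter_upwards [h] with x hx
  linarith

lemma log_le' {v η : ℝ} (hv : 0 < v) (hη : 0 < η) : |Real.log v| ≤ η + (v + v⁻¹ - 2) / η := by
  have hr : 0 < √v := Real.sqrt_pos.mpr hv
  have hrv : √v ^ 2 = v := Real.sq_sqrt hv.le
  have hl : Real.log v = 2 * Real.log √v := by
    rw [Real.log_sqrt hv.le]; ring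
  have h1 := Real.log_le_sub_one_of_pos hr
  have h2 := Real.one_sub_inv_le_log_of_pos hr
  have hi : √v * (√v)⁻¹ = 1 := mul_inv_cancel₀ hr.ne'
  have h3 : |Real.log √v| ≤ |√v - (√v)⁻¹| := by
    rcases le_total 1 √v with h | h
    · have h4 : (√v)⁻¹ ≤ 1 := inv_le_one_of_one_le₀ h
      rw [abs_of_nonneg (Real.log_nonneg h), abs_of_nonneg (by linarith)]
      linarith
    · have h4 : 1 ≤ (√v)⁻¹ := (one_le_inv₀ hr).mpr h
      rw [abs_of_nonpos (Real.log_nonpos hr.le h), abs_of_nonpos (by linarith)]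
      linarith
  have h5 : (√v - (√v)⁻¹) ^ 2 = v + v⁻¹ - 2 := by
    have : (√v)⁻¹ ^ 2 = v⁻¹ := by rw [inv_pow, hrv]
    nlinarith
  rw [← h5, hl, abs_mul, abs_of_pos (by norm_num : (0:ℝ) < 2), ← sq_abs]
  set q := |√v - (√v)⁻¹|
  have h6 : 2 * q ≤ η + q ^ 2 / η := by
    have : η + q ^ 2 / η - 2 * q = (η - q) ^ 2 / η := by field_simp; ring
    have h7 : 0 ≤ (η - q) ^ 2 / η := by positivity
    linarith
  linarith

lemma logint_le {x a η : ℝ} (hx : 1 < x) (ha : 0 < a) (hη : 0 < η) :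
    ∫ t in Ioi (0:ℝ), Real.exp (-t) * t ^ (x - 1) * |Real.log t - Real.log a| ≤
      Real.Gamma x * (η + (x / a + a / (x - 1) - 2) / η) := by
  have hx0 : 0 < x := by linarith
  have i1 := f_int hx0
  have i2 := f_int (show 0 < x + 1 by linarith)
  have i3 := f_int (show 0 < x - 1 by linarith)
  have hL := (Gd_deriv hx0 (measurableSet_Ioi (a := 0)) subset_rfl).1
  have e : Real.Gamma x * (η + (x / a + a / (x - 1) - 2) / η) =
      ∫ t in Ioi (0:ℝ), ((η - 2 / η) * (Real.exp (-t) * t ^ (x - 1)) + (1 / (a * η)) * (Real.exp (-t) * t ^ (x + 1 - 1))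
        + (a / η) * (Real.exp (-t) * t ^ (x - 1 - 1))) := by
    rw [integral_add, integral_add, integral_const_mul, integral_const_mul, integral_const_mul,
      ← Real.Gamma_eq_integral hx0, ← Real.Gamma_eq_integral (show 0 < x + 1 by linarith),
      ← Real.Gamma_eq_integral (show 0 < x - 1 by linarith), Real.Gamma_add_one hx0.ne']
    · have h1 := Real.Gamma_add_one (show x - 1 ≠ 0 by linarith)
      rw [sub_add_cancel] at h1
      rw [h1]
      have : x - 1 ≠ 0 := by linarith
      field_simp
      ring
    · exact i1.const_mul _
    · exact i2.const_mul _
    · exact (i1.const_mul _).add (i2.const_mul _)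
    · exact i3.const_mul _
  rw [e]
  apply setIntegral_mono_on
  · have : IntegrableOn (fun t => |Real.exp (-t) * t ^ (x - 1) * Real.log t - Real.log a * (Real.exp (-t) * t ^ (x - 1))|) (Ioi 0) :=
      (hL.sub (i1.const_mul (Real.log a))).abs
    refine this.congr_fun (fun t ht => ?_) measurableSet_Ioi
    have ht0 : 0 < t := ht
    simp only
    rw [show Real.exp (-t) * t ^ (x - 1) * Real.log t - Real.log a * (Real.exp (-t) * t ^ (x - 1)) =
      Real.exp (-t) * t ^ (x - 1) * (Real.log t - Real.log a) by ring, abs_mul, abs_of_pos (by positivity)]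
  · exact ((i1.const_mul _).add (i2.const_mul _)).add (i3.const_mul _)
  · exact measurableSet_Ioi
  · intro t ht
    have ht0 : 0 < t := ht
    have h1 := log_le' (show 0 < t / a by positivity) hη
    rw [Real.log_div ht0.ne' ha.ne'] at h1
    have e1 : t ^ (x + 1 - 1) = t ^ (x - 1) * t := by
      rw [← Real.rpow_add_one ht0.ne']; congr 1; ring
    have e2 : t ^ (x - 1 - 1) = t ^ (x - 1) / t := Real.rpow_sub_one ht0.ne' _
    rw [e1, e2]
    calc _ ≤ Real.exp (-t) * t ^ (x - 1) * (η + (t / a + (t / a)⁻¹ - 2) / η) := by gcongr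
      _ = _ := by field_simp; ring

section
variable {m m' : ℝ → ℝ}
    (hm : ∀ x > (0:ℝ), 0 < m x ∧
      (∫ t in Set.Ioc (0:ℝ) (m x), Real.exp (-t) * t ^ (x - 1)) =
        (1/2) * ∫ t in Set.Ioi (0:ℝ), Real.exp (-t) * t ^ (x - 1))
    (hm' : ∀ x > (0:ℝ), HasDerivAt m (m' x) x)
include hm

lemma part1 : Tendsto (fun x => x ^ 2 * (m x - x + 1/3 - 8/(405*x))) atTop (nhds (184/25515)) := by
  rw [tendsto_order]
  constructor
  · intro c hc
    filter_upwards [D_neg hc, eventually_gt_atTop 0] with x h hx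
    have h1 : ac c x < m x := by
      by_contra hcon
      have := P_mono hx (hm x hx).1 (not_lt.mp hcon)
      rw [P_m hm hx] at this
      linarith
    unfold ac at h1
    have h2 : c * x⁻¹ ^ 2 < m x - x + 1/3 - 8/(405*x) := by
      have : 8/(405*x) = 8/405 * x⁻¹ := by field_simp
      linarith
    calc c = x ^ 2 * (c * x⁻¹ ^ 2) := by field_simp
      _ < _ := by gcongr
  · intro c hc
    filter_upwards [D_pos hc, eventually_gt_atTop 0, ac_pos c] with x h hx hac
    have h1 : m x < ac c x := by
      by_contra hcon
      have := P_mono hx hac (not_lt.mp hcon)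
      rw [P_m hm hx] at this
      linarith
    unfold ac at h1
    have h2 : m x - x + 1/3 - 8/(405*x) < c * x⁻¹ ^ 2 := by
      have : 8/(405*x) = 8/405 * x⁻¹ := by field_simp
      linarith
    calc _ < x ^ 2 * (c * x⁻¹ ^ 2) := by gcongr
      _ = c := by field_simp

lemma m_form {x : ℝ} (hx : 0 < x) : m x = x - 1/3 + 8/405 * x⁻¹ + (x ^ 2 * (m x - x + 1/3 - 8/(405*x))) * x⁻¹ ^ 2 := by
  field_simp
  ring

lemma mx_lim : Tendsto (fun x => m x / x) atTop (nhds 1) := by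
  have h1 := ((einv0.const_mul (-1/3)).add ((einv0.pow 2).const_mul (8/405))).add ((part1 hm).mul (einv0.pow 3))
  have h2 := h1.const_add 1
  simp only [mul_zero, ne_eq, OfNat.ofNat_ne_zero, not_false_eq_true, zero_pow, add_zero] at h2
  refine h2.congr' ?_
  filter_upwards [eventually_gt_atTop 0] with x hx
  field_simp
  ring

lemma xm_lim : Tendsto (fun x => x / m x) atTop (nhds 1) := by
  have := (mx_lim hm).inv₀ one_ne_zero
  rw [inv_one] at this
  refine this.congr fun x => ?_
  rw [inv_div]

lemma w_lim : Tendsto (fun x => Real.exp (-(m x)) * (m x) ^ (x - 1) / Real.Gamma x) atTop (nhds 0) := by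
  have h1 := K_lim.mul (xm_lim hm)
  rw [zero_mul] at h1
  refine squeeze_zero' ?_ ?_ h1
  · filter_upwards [eventually_gt_atTop 0] with x hx
    have := Real.Gamma_pos_of_pos hx
    have := (hm x hx).1
    positivity
  · filter_upwards [eventually_gt_atTop 0] with x hx
    have hG := Real.Gamma_pos_of_pos hx
    have ha := (hm x hx).1
    rw [Real.rpow_sub_one ha.ne']
    calc _ = Real.exp (-(m x)) * (m x) ^ x / (Real.Gamma x * m x) := by field_simp
      _ ≤ Real.exp (-x) * x ^ x / (Real.Gamma x * m x) := by
        gcongr ?_ / _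
        exact f_max hx ha
      _ = _ := by field_simp

lemma N_bound {x η : ℝ} (hx : 1 < x) (hη : 0 < η) :
    |1/2 * Gd x (Ioi 0) - Gd x (Ioc 0 (m x))| ≤
      3/2 * (Real.Gamma x * (η + (x / m x + m x / (x - 1) - 2) / η)) := by
  have hx0 : 0 < x := by linarith
  have ha := (hm x hx0).1
  have hle := logint_le hx ha hη
  have key : ∀ S : Set ℝ, MeasurableSet S → S ⊆ Ioi 0 →
      |Gd x S - Real.log (m x) * ∫ t in S, Real.exp (-t) * t ^ (x - 1)| ≤
      ∫ t in Ioi (0:ℝ), Real.exp (-t) * t ^ (x - 1) * |Real.log t - Real.log (m x)| := by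
    intro S hS hS0
    have i1 := (f_int hx0)
    have hL := (Gd_deriv hx0 (measurableSet_Ioi (a := 0)) subset_rfl).1
    have i3 := (hL.sub (i1.const_mul (Real.log (m x)))).abs
    have i4 : IntegrableOn (fun t => Real.exp (-t) * t ^ (x - 1) * |Real.log t - Real.log (m x)|) (Ioi 0) := by
      refine IntegrableOn.congr_fun i3 (fun t ht => ?_) measurableSet_Ioi
      have ht0 : 0 < t := ht
      simp only [Pi.sub_apply]
      rw [show Real.exp (-t) * t ^ (x - 1) * Real.log t - Real.log (m x) * (Real.exp (-t) * t ^ (x - 1)) =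
        Real.exp (-t) * t ^ (x - 1) * (Real.log t - Real.log (m x)) by ring, abs_mul, abs_of_pos (by positivity)]
    unfold Gd
    rw [← integral_const_mul, ← integral_sub (hL.mono_set hS0) ((i1.mono_set hS0).const_mul _)]
    refine (abs_integral_le_integral_abs).trans ?_
    have e1 : ∫ t in S, |Real.exp (-t) * t ^ (x - 1) * Real.log t - Real.log (m x) * (Real.exp (-t) * t ^ (x - 1))| =
        ∫ t in S, Real.exp (-t) * t ^ (x - 1) * |Real.log t - Real.log (m x)| := by
      refine setIntegral_congr_fun hS fun t ht => ?_
      have ht0 : 0 < t := hS0 ht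
      rw [show Real.exp (-t) * t ^ (x - 1) * Real.log t - Real.log (m x) * (Real.exp (-t) * t ^ (x - 1)) =
        Real.exp (-t) * t ^ (x - 1) * (Real.log t - Real.log (m x)) by ring, abs_mul, abs_of_pos (by positivity)]
    rw [e1]
    refine setIntegral_mono_set i4 ?_ (Eventually.of_forall hS0)
    filter_upwards [ae_restrict_mem measurableSet_Ioi] with t ht
    have ht0 : 0 < t := ht
    simp only [Pi.zero_apply]
    positivity
  have k1 := key (Ioi 0) measurableSet_Ioi subset_rfl
  have k2 := key (Ioc 0 (m x)) measurableSet_Ioc Ioc_subset_Ioi_self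
  rw [(hm x hx0).2] at k2
  rw [abs_le] at k1 k2 ⊢
  constructor <;> linarith [k1.1, k1.2, k2.1, k2.2]

lemma A_lim : Tendsto (fun x => (1/2 * Gd x (Ioi 0) - Gd x (Ioc 0 (m x))) / Real.Gamma x) atTop (nhds 0) := by
  have hd : Tendsto (fun x => x / m x + m x / (x - 1) - 2) atTop (nhds 0) := by
    have h1 : Tendsto (fun x : ℝ => 1 - x⁻¹) atTop (nhds 1) := by simpa using einv0.const_sub 1
    have h2 := ((xm_lim hm).add ((mx_lim hm).div h1 one_ne_zero)).sub_const 2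
    rw [show (1:ℝ) + 1 / 1 - 2 = 0 by norm_num] at h2
    refine h2.congr' ?_
    filter_upwards [eventually_gt_atTop 1] with x hx
    have : x - 1 ≠ 0 := by linarith
    have e : 1 - x⁻¹ = (x - 1) / x := by field_simp
    simp only [Pi.div_apply]
    rw [e]
    field_simp
  rw [Metric.tendsto_nhds]
  intro ε hε
  have hη : 0 < ε / 4 := by positivity
  filter_upwards [eventually_gt_atTop 1, hd.eventually_lt_const (show 0 < ε / 4 * (ε / 4) by positivity)] with x hx h
  have hx0 : 0 < x := by linarith
  have hG := Real.Gamma_pos_of_pos hx0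
  have h1 := N_bound hm hx hη
  rw [Real.dist_eq, sub_zero, abs_div, abs_of_pos hG, div_lt_iff₀ hG]
  have h2 : (x / m x + m x / (x - 1) - 2) / (ε / 4) < ε / 4 := by rwa [div_lt_iff₀ hη]
  nlinarith

include hm'

lemma U_lim (c : ℝ) : Tendsto (fun x => Real.exp (-(m x)) * (m x) ^ (x - 1) / Real.Gamma x *
    (m' x - (1 - 8/405 * x⁻¹ ^ 2 - c * x⁻¹ ^ 3))) atTop (nhds 0) := by
  have h1 : Tendsto (fun x : ℝ => 1 - 8/405 * x⁻¹ ^ 2 - c * x⁻¹ ^ 3) atTop (nhds (1 - 8/405 * 0 ^ 2 - c * 0 ^ 3)) :=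
    (((einv0.pow 2).const_mul _).const_sub 1).sub ((einv0.pow 3).const_mul c)
  have h2 := (A_lim hm).sub ((w_lim hm).mul h1)
  rw [zero_mul, sub_zero] at h2
  refine h2.congr' ?_
  filter_upwards [eventually_gt_atTop 0] with x hx
  rw [← N_eq hm hm' hx]
  ring

lemma U_succ (c : ℝ) {x : ℝ} (hx : 0 < x) :
    Real.exp (-(m (x+1))) * (m (x+1)) ^ (x + 1 - 1) / Real.Gamma (x+1) *
    (m' (x+1) - (1 - 8/405 * (x+1)⁻¹ ^ 2 - c * (x+1)⁻¹ ^ 3)) -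
    Real.exp (-(m x)) * (m x) ^ (x - 1) / Real.Gamma x *
    (m' x - (1 - 8/405 * x⁻¹ ^ 2 - c * x⁻¹ ^ 3)) =
    - (Real.exp (-(m x)) * (m x) ^ x / Real.Gamma (x+1)) *
    ((1 - 8/405 * (x+1)⁻¹ ^ 2 - c * (x+1)⁻¹ ^ 3) * Ek x (m x) (m (x+1) - m x)
    - (x / m x) * (1 - 8/405 * x⁻¹ ^ 2 - c * x⁻¹ ^ 3)
    + ∫ s in (0:ℝ)..(m (x+1) - m x), Ek x (m x) s * Real.log (1 + s / m x)) := by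
  have hx1 : 0 < x + 1 := by linarith
  have ha := (hm x hx).1
  have hb := (hm (x+1) hx1).1
  have hG := Real.Gamma_pos_of_pos hx
  have h1 := N_eq hm hm' hx
  have h2 := N_eq hm hm' hx1
  have h3 := N_succ hm hx
  rw [← h1, ← h2] at h3
  have h4 := f_shift (x := x) (s := m (x+1) - m x) ha (by linarith)
  rw [add_sub_cancel] at h4
  have h5 := Real.rpow_sub_one ha.ne' x
  rw [add_sub_cancel_right] at h3 ⊢
  generalize (1 - 8/405 * (x+1)⁻¹ ^ 2 - c * (x+1)⁻¹ ^ 3) = b1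
  generalize (1 - 8/405 * x⁻¹ ^ 2 - c * x⁻¹ ^ 3) = b0
  generalize (∫ s in (0:ℝ)..(m (x+1) - m x), Ek x (m x) s * Real.log (1 + s / m x)) = J at *
  rw [Real.Gamma_add_one hx.ne']
  rw [h5] at h3 ⊢
  rw [h4] at h3 ⊢
  have e1 : Real.exp (-(m x)) * (m x) ^ x * Ek x (m x) (m (x+1) - m x) / (x * Real.Gamma x) * (m' (x+1) - b1) =
      (Real.exp (-(m x)) * (m x) ^ x * Ek x (m x) (m (x+1) - m x) * m' (x+1)) / (x * Real.Gamma x) -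
      Real.exp (-(m x)) * (m x) ^ x * Ek x (m x) (m (x+1) - m x) / (x * Real.Gamma x) * b1 := by ring
  rw [e1, h3]
  field_simp
  ring

lemma part2 : Tendsto (fun x => x ^ 3 * (m' x - 1 + 8/(405*x^2))) atTop (nhds (-368/25515)) := by
  have hS := S_lim (m := m) (part1 hm) (by
    filter_upwards [eventually_gt_atTop 0] with x hx using m_form hm hx) (by
    filter_upwards [eventually_gt_atTop 0] with x hx using Ek_m hm hx)
  have hw : ∀ x > (0:ℝ), 0 < Real.exp (-(m x)) * (m x) ^ (x - 1) / Real.Gamma x := by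
    intro x hx
    have := (hm x hx).1
    have := Real.Gamma_pos_of_pos hx
    positivity
  have hK : ∀ x > (0:ℝ), 0 < Real.exp (-(m x)) * (m x) ^ x / Real.Gamma (x+1) := by
    intro x hx
    have := (hm x hx).1
    have := Real.Gamma_pos_of_pos (show 0 < x + 1 by linarith)
    positivity
  have hform : ∀ c : ℝ, ∀ x > (0:ℝ), x ^ 3 * (m' x - 1 + 8/(405*x^2)) =
      -c + x ^ 3 * (m' x - (1 - 8/405 * x⁻¹ ^ 2 - c * x⁻¹ ^ 3)) := by
    intro c x hx
    field_simp
    ring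
  rw [tendsto_order]
  constructor
  · intro c hc
    have h := seq_pos (U_lim hm hm' (-c)) (by
      filter_upwards [eventually_gt_atTop 0, (hS (-c)).eventually_const_lt
        (show 0 < -92/1701 + 7/2 * (-c) + 184/25515 / 2 by linarith)] with x hx h1
      have h2 := pos_of_mul_pos_right h1 (by positivity)
      have h3 := U_succ hm hm' (-c) hx
      have h4 := mul_pos (hK x hx) h2
      linarith)
    filter_upwards [h, eventually_gt_atTop 0] with x h1 hx
    have h2 := pos_of_mul_pos_right h1 (hw x hx).le
    rw [hform (-c) x hx]
    have : 0 < x ^ 3 * (m' x - (1 - 8/405 * x⁻¹ ^ 2 - -c * x⁻¹ ^ 3)) := by positivity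
    linarith
  · intro c hc
    have h := seq_neg (U_lim hm hm' (-c)) (by
      filter_upwards [eventually_gt_atTop 0, (hS (-c)).eventually_lt_const
        (show -92/1701 + 7/2 * (-c) + 184/25515 / 2 < 0 by linarith)] with x hx h1
      have h2 := neg_of_mul_neg_right h1 (by positivity)
      have h3 := U_succ hm hm' (-c) hx
      have h4 := mul_neg_of_pos_of_neg (hK x hx) h2
      linarith)
    filter_upwards [h, eventually_gt_atTop 0] with x h1 hx
    have h2 := neg_of_mul_neg_right h1 (hw x hx).le
    rw [hform (-c) x hx]
    have : x ^ 3 * (m' x - (1 - 8/405 * x⁻¹ ^ 2 - -c * x⁻¹ ^ 3)) < 0 :=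
      mul_neg_of_pos_of_neg (by positivity) h2
    linarith

end

end GM

/-- As `x → ∞` the median `m` of the gamma distribution satisfies
`m(x) = x − 1/3 + 8/(405x) + 184/(25515x²) + o(x^{−2})` and
`m'(x) = 1 − 8/(405x²) − 368/(25515x³) + o(x^{−3})`; i.e.
`x²(m(x) − x + 1/3 − 8/(405x)) → 184/25515` and
`x³(m'(x) − 1 + 8/(405x²)) → −368/25515`. -/
theorem gammaMedian_asymptotics_at_infinity (m m' : ℝ → ℝ)
    (hm : ∀ x > (0:ℝ), 0 < m x ∧
      (∫ t in Set.Ioc (0:ℝ) (m x), Real.exp (-t) * t ^ (x - 1)) =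
        (1/2) * ∫ t in Set.Ioi (0:ℝ), Real.exp (-t) * t ^ (x - 1))
    (hm' : ∀ x > (0:ℝ), HasDerivAt m (m' x) x) :
    Tendsto (fun x => x ^ 2 * (m x - x + 1/3 - 8/(405*x))) atTop
      (nhds (184/25515)) ∧
    Tendsto (fun x => x ^ 3 * (m' x - 1 + 8/(405*x^2))) atTop
      (nhds (-368/25515)) := by
  exact ⟨GM.part1 hm, GM.part2 hm hm'⟩
end
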